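/- Let Q be a Dynkin quiver. For all finitely supported functions μ, ν, ξ : Φ_+ → ℕ there exists a polynomial F_{μν}^ξ ∈ ℤ[T], depending only on Q, μ, ν, ξ, such that for every finite field k with q elements and all finite-dimensional kQ-modules M, N, X with [M] = μ, [N] = ν, [X] = ξ, the Hall number satisfies F_{MN}^X = F_{μν}^ξ(q). -/

import Mathlib

open Polynomial

/-- A finite quiver, given by a finite set of vertices, a finite set of arrows,
and source/target maps. -/
structure QuiverData where
  V : Type
  A : Type
  [fintV : Fintype V]
  [decV : DecidableEq V]
  [fintA : Fintype A]
  s : A → V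
  t : A → V

attribute [instance] QuiverData.fintV QuiverData.decV QuiverData.fintA

/-- A representation of a quiver over a field `k`:  a finite dimensional vector
space at each vertex together with a linear map for each arrow.  This is the same
thing as a `kQ`-module (finite dimensionality is imposed separately via `FinDim`). -/
structure Repn (k : Type) [Field k] (Q : QuiverData) where
  space : Q.V → Type
  [addcg : ∀ v, AddCommGroup (space v)]
  [mod : ∀ v, Module k (space v)]
  map : ∀ a : Q.A, space (Q.s a) →ₗ[k] space (Q.t a)

attribute [instance] Repn.addcg Repn.mod

namespace Repn

variable {k : Type} [Field k] {Q : QuiverData}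

/-- An isomorphism of representations. -/
structure Iso (M N : Repn k Q) where
  e : ∀ v, M.space v ≃ₗ[k] N.space v
  comm : ∀ (a : Q.A) (x : M.space (Q.s a)), e (Q.t a) (M.map a x) = N.map a (e (Q.s a) x)

/-- Direct sum of two representations. -/
def dsum (M N : Repn k Q) : Repn k Q where
  space v := M.space v × N.space v
  map a := (M.map a).prodMap (N.map a)

/-- Direct sum of a family of representations. -/
def dsumFam {ι : Type} (X : ι → Repn k Q) : Repn k Q where
  space v := ∀ i, (X i).space v
  map a := LinearMap.pi fun i => ((X i).map a).comp (LinearMap.proj i)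

/-- The zero representation(s). -/
def IsZero (M : Repn k Q) : Prop := ∀ (v : Q.V) (x : M.space v), x = 0

/-- Pointwise finite dimensionality, i.e. `M` is a finite `kQ`-module. -/
def FinDim (M : Repn k Q) : Prop := ∀ v, FiniteDimensional k (M.space v)

/-- Indecomposability. -/
def Indec (M : Repn k Q) : Prop :=
  ¬ M.IsZero ∧ ∀ Y Z : Repn k Q, Nonempty (Iso M (Y.dsum Z)) → Y.IsZero ∨ Z.IsZero

/-- The dimension vector. -/
noncomputable def dimv (M : Repn k Q) : Q.V → ℕ := fun v => Module.finrank k (M.space v)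

end Repn

/-- A subrepresentation of `X`, i.e. a `kQ`-submodule. -/
structure Subrep {k : Type} [Field k] {Q : QuiverData} (X : Repn k Q) where
  sub : ∀ v, Submodule k (X.space v)
  stable : ∀ a : Q.A, (sub (Q.s a)).map (X.map a) ≤ sub (Q.t a)

namespace Subrep

variable {k : Type} [Field k] {Q : QuiverData} {X : Repn k Q}

/-- A subrepresentation as a representation. -/
def repn (U : Subrep X) : Repn k Q where
  space v := U.sub v
  map a := (X.map a).restrict fun _ hx => U.stable a (Submodule.mem_map_of_mem hx)

/-- The quotient representation `X/U`. -/
def quot (U : Subrep X) : Repn k Q where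
  space v := X.space v ⧸ U.sub v
  map a := Submodule.mapQ (U.sub (Q.s a)) (U.sub (Q.t a)) (X.map a)
    (Submodule.map_le_iff_le_comap.mp (U.stable a))

end Subrep

/-- The Hall number `F_{MN}^X`: the number of subrepresentations `U ≤ X` with
`U ≅ N` and `X/U ≅ M`. -/
noncomputable def hallNum {k : Type} [Field k] {Q : QuiverData} (M N X : Repn k Q) : ℕ :=
  Nat.card {U : Subrep X // Nonempty (Repn.Iso U.repn N) ∧ Nonempty (Repn.Iso U.quot M)}

/-- The number of automorphisms of a representation. -/
noncomputable def autCard {k : Type} [Field k] {Q : QuiverData} (M : Repn k Q) : ℕ :=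
  Nat.card (Repn.Iso M M)

/-- The Euler form of the quiver `Q`. -/
def eulerZ (Q : QuiverData) (d e : Q.V → ℤ) : ℤ :=
  (∑ v, d v * e v) - ∑ a, d (Q.s a) * e (Q.t a)

/-- The Tits quadratic form of `Q`. -/
def titsZ (Q : QuiverData) (d : Q.V → ℤ) : ℤ := eulerZ Q d d

/-- Coercion of a dimension vector to an integral vector. -/
def natc {Q : QuiverData} (d : Q.V → ℕ) : Q.V → ℤ := fun v => (d v : ℤ)

/-- Connectedness of the underlying graph of `Q`. -/
def QuiverData.Connected (Q : QuiverData) : Prop :=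
  ∀ u v : Q.V, Relation.ReflTransGen
    (fun x y => ∃ a, (Q.s a = x ∧ Q.t a = y) ∨ (Q.s a = y ∧ Q.t a = x)) u v

/-- `Q` is a Dynkin quiver iff it is connected and its Tits form is positive definite. -/
def IsDynkin (Q : QuiverData) : Prop :=
  Q.Connected ∧ ∀ d : Q.V → ℤ, d ≠ 0 → 0 < titsZ Q d

/-- `Q` is an extended Dynkin (affine) quiver iff it is connected and its Tits form is
positive semidefinite but not definite. -/
def IsAffine (Q : QuiverData) : Prop :=
  Q.Connected ∧ (∀ d : Q.V → ℤ, 0 ≤ titsZ Q d) ∧ ∃ d : Q.V → ℤ, d ≠ 0 ∧ titsZ Q d = 0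

/-- `δ` is the minimal positive imaginary root of the affine quiver `Q`. -/
def IsMinImagRoot (Q : QuiverData) (δ : Q.V → ℕ) : Prop :=
  δ ≠ 0 ∧ titsZ Q (natc δ) = 0 ∧
    ∀ d : Q.V → ℕ, d ≠ 0 → titsZ Q (natc d) = 0 → ∀ v, δ v ≤ d v

/-- `Q` is an oriented cycle iff every vertex has exactly one incoming and one
outgoing arrow (`Q` being connected). -/
def IsOrientedCycle (Q : QuiverData) : Prop :=
  ∀ v : Q.V, Nat.card {a : Q.A // Q.s a = v} = 1 ∧ Nat.card {a : Q.A // Q.t a = v} = 1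

/-- The standard map whose kernel is `Hom(M,N)` and whose cokernel is `Ext¹(M,N)`. -/
noncomputable def extMap {k : Type} [Field k] {Q : QuiverData} (M N : Repn k Q) :
    (∀ v, M.space v →ₗ[k] N.space v) →ₗ[k] (∀ a : Q.A, M.space (Q.s a) →ₗ[k] N.space (Q.t a)) :=
  LinearMap.pi fun a =>
    ((LinearMap.llcomp k (M.space (Q.s a)) (N.space (Q.s a)) (N.space (Q.t a)) (N.map a)).comp
        (LinearMap.proj (Q.s a)))
      - ((LinearMap.lcomp k (N.space (Q.t a)) (M.map a)).comp (LinearMap.proj (Q.t a)))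

/-- `dim_k Hom(M,N)`. -/
noncomputable def homDim {k : Type} [Field k] {Q : QuiverData} (M N : Repn k Q) : ℕ :=
  Module.finrank k (LinearMap.ker (extMap M N))

/-- `dim_k Ext¹(M,N)`. -/
noncomputable def extDim {k : Type} [Field k] {Q : QuiverData} (M N : Repn k Q) : ℕ :=
  Module.finrank k
    ((∀ a : Q.A, M.space (Q.s a) →ₗ[k] N.space (Q.t a)) ⧸ LinearMap.range (extMap M N))

/-- A positive root of the Tits form of `Q`. -/
def IsPosRoot (Q : QuiverData) (d : Q.V → ℕ) : Prop := d ≠ 0 ∧ titsZ Q (natc d) = 1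

/-- `[M] = μ` for a Dynkin quiver:  by Gabriel's theorem the indecomposables are
classified by their dimension vectors, which are the positive roots; `μ` records
the multiplicity of each indecomposable (labelled by its dimension vector) in a
decomposition of `M` into indecomposable direct summands. -/
def HasClassDynkin {k : Type} [Field k] {Q : QuiverData}
    (M : Repn k Q) (μ : (Q.V → ℕ) → ℕ) : Prop :=
  ∃ (ι : Type) (_ : Fintype ι) (Xi : ι → Repn k Q) (r : ι → Q.V → ℕ),
    (∀ i, (Xi i).Indec ∧ (Xi i).FinDim ∧ Repn.dimv (Xi i) = r i) ∧
    (∀ d, μ d = Nat.card {i // r i = d}) ∧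
    Nonempty (Repn.Iso M (Repn.dsumFam Xi))


attribute [reducible] Repn.dsum Subrep.repn Subrep.quot Repn.dsumFam
set_option linter.all false

set_option linter.all false

namespace HP
open Repn
variable {k : Type} [Field k] {Q : QuiverData}

abbrev Gr (M N : Repn k Q) := ∀ v, M.space v →ₗ[k] N.space v

abbrev Co (M N : Repn k Q) := ∀ a : Q.A, M.space (Q.s a) →ₗ[k] N.space (Q.t a)

def IsHom {M N : Repn k Q} (f : Gr M N) : Prop :=
  ∀ (a : Q.A) (x : M.space (Q.s a)), f (Q.t a) (M.map a x) = N.map a (f (Q.s a) x)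

noncomputable abbrev Hm (M N : Repn k Q) : Submodule k (Gr M N) := LinearMap.ker (extMap M N)

lemma extMap_apply (M N : Repn k Q) (f : Gr M N) (a : Q.A) (x : M.space (Q.s a)) :
    extMap M N f a x = N.map a (f (Q.s a) x) - f (Q.t a) (M.map a x) := rfl

lemma mem_Hm {M N : Repn k Q} {f : Gr M N} : f ∈ Hm M N ↔ IsHom f := by
  rw [LinearMap.mem_ker]
  constructor
  · intro h a x
    have := congrFun h a
    have h2 := LinearMap.congr_fun this x
    rw [extMap_apply] at h2
    exact (sub_eq_zero.mp h2).symm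
  · intro h
    funext a
    ext x
    rw [extMap_apply]
    exact sub_eq_zero.mpr (h a x).symm

def gid (M : Repn k Q) : Gr M M := fun _ => LinearMap.id
def gcomp {M N L : Repn k Q} (g : Gr N L) (f : Gr M N) : Gr M L := fun v => (g v).comp (f v)

lemma isHom_gid (M : Repn k Q) : IsHom (gid M) := fun _ _ => rfl

lemma IsHom.comp {M N L : Repn k Q} {g : Gr N L} {f : Gr M N} (hg : IsHom g) (hf : IsHom f) :
    IsHom (gcomp g f) := by
  intro a x
  show g _ (f _ _) = _
  rw [hf, hg]; rfl

lemma IsHom.zero {M N : Repn k Q} : IsHom (0 : Gr M N) := mem_Hm.1 (Hm M N).zero_mem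
lemma IsHom.add {M N : Repn k Q} {f g : Gr M N} (hf : IsHom f) (hg : IsHom g) : IsHom (f + g) :=
  mem_Hm.1 ((Hm M N).add_mem (mem_Hm.2 hf) (mem_Hm.2 hg))
lemma IsHom.sub {M N : Repn k Q} {f g : Gr M N} (hf : IsHom f) (hg : IsHom g) : IsHom (f - g) :=
  mem_Hm.1 ((Hm M N).sub_mem (mem_Hm.2 hf) (mem_Hm.2 hg))
lemma IsHom.smul {M N : Repn k Q} {f : Gr M N} (c : k) (hf : IsHom f) : IsHom (c • f) :=
  mem_Hm.1 ((Hm M N).smul_mem c (mem_Hm.2 hf))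

-- isomorphisms
def irefl (M : Repn k Q) : Iso M M := ⟨fun _ => LinearEquiv.refl _ _, fun _ _ => rfl⟩
def isymm {M N : Repn k Q} (e : Iso M N) : Iso N M :=
  ⟨fun v => (e.e v).symm, fun a x => by
    rw [LinearEquiv.symm_apply_eq, e.comm, LinearEquiv.apply_symm_apply]⟩
def itrans {M N L : Repn k Q} (e : Iso M N) (f : Iso N L) : Iso M L :=
  ⟨fun v => (e.e v).trans (f.e v), fun a x => by
    simp [e.comm, f.comm]⟩

def ihom {M N : Repn k Q} (e : Iso M N) : Gr M N := fun v => (e.e v).toLinearMap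
lemma isHom_ihom {M N : Repn k Q} (e : Iso M N) : IsHom (ihom e) := e.comm

lemma iso_ext {M N : Repn k Q} {e f : Iso M N} (h : ∀ v x, e.e v x = f.e v x) : e = f := by
  cases e; cases f
  congr
  funext v
  ext x
  exact h v x

noncomputable def isoOf {M N : Repn k Q} (f : Gr M N) (hf : IsHom f)
    (hb : ∀ v, Function.Bijective (f v)) : Iso M N :=
  ⟨fun v => LinearEquiv.ofBijective (f v) (hb v), fun a x => hf a x⟩

abbrev IsoP (M N : Repn k Q) : Prop := Nonempty (Iso M N)

lemma IsoP.refl (M : Repn k Q) : IsoP M M := ⟨irefl M⟩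
lemma IsoP.symm {M N : Repn k Q} (h : IsoP M N) : IsoP N M := h.map isymm
lemma IsoP.trans {M N L : Repn k Q} (h : IsoP M N) (h' : IsoP N L) : IsoP M L :=
  ⟨itrans h.some h'.some⟩

lemma IsoP.dsum_congr {M N M' N' : Repn k Q} (h : IsoP M M') (h' : IsoP N N') :
    IsoP (M.dsum N) (M'.dsum N') :=
  ⟨⟨fun v => LinearEquiv.prodCongr (h.some.e v) (h'.some.e v), fun a x => by
    have h1 := h.some.comm a x.1
    have h2 := h'.some.comm a x.2
    exact Prod.ext h1 h2⟩⟩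

lemma dsum_comm (M N : Repn k Q) : IsoP (M.dsum N) (N.dsum M) :=
  ⟨⟨fun v => LinearEquiv.prodComm k _ _, fun a x => rfl⟩⟩

lemma dsum_assoc (M N L : Repn k Q) : IsoP ((M.dsum N).dsum L) (M.dsum (N.dsum L)) :=
  ⟨⟨fun v => LinearEquiv.prodAssoc k _ _ _, fun a x => rfl⟩⟩

lemma dsum_left_comm (M N L : Repn k Q) : IsoP (M.dsum (N.dsum L)) (N.dsum (M.dsum L)) :=
  ((dsum_assoc M N L).symm.trans (IsoP.dsum_congr (dsum_comm M N) (IsoP.refl L))).trans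
    (dsum_assoc N M L)

lemma dsum_isZero_left {M N : Repn k Q} (h : M.IsZero) : IsoP (M.dsum N) N :=
  ⟨isoOf (fun v => LinearMap.snd k _ _) (fun a x => rfl) (fun v => by
    constructor
    · intro x y hxy
      exact Prod.ext ((h v x.1).trans (h v y.1).symm) hxy
    · intro y; exact ⟨(0, y), rfl⟩)⟩

lemma dsum_isZero_right {M N : Repn k Q} (h : N.IsZero) : IsoP (M.dsum N) M :=
  (dsum_comm M N).trans (dsum_isZero_left h)

lemma iso_of_isZero {M N : Repn k Q} (h : M.IsZero) (h' : N.IsZero) : IsoP M N :=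
  ⟨isoOf 0 IsHom.zero (fun v => ⟨fun x y _ => (h v x).trans (h v y).symm,
    fun y => ⟨0, (h' v _).trans (h' v y).symm⟩⟩)⟩

lemma IsoP.isZero {M N : Repn k Q} (h : IsoP M N) (hz : M.IsZero) : N.IsZero := by
  intro v x
  have := hz v ((h.some.e v).symm x)
  simpa using this

lemma IsoP.finDim {M N : Repn k Q} (h : IsoP M N) (hz : M.FinDim) : N.FinDim := by
  intro v
  haveI := hz v
  exact Module.Finite.equiv (h.some.e v)

lemma IsoP.dimv {M N : Repn k Q} (h : IsoP M N) : M.dimv = N.dimv :=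
  funext fun v => (h.some.e v).finrank_eq

lemma IsoP.indec {M N : Repn k Q} (h : IsoP M N) (hz : M.Indec) : N.Indec :=
  ⟨fun hn => hz.1 (h.symm.isZero hn), fun Y Z hYZ => hz.2 Y Z (h.trans hYZ)⟩

lemma finDim_dsum {M N : Repn k Q} (h : M.FinDim) (h' : N.FinDim) : (M.dsum N).FinDim := by
  intro v
  haveI := h v
  haveI := h' v
  exact (inferInstance : Module.Finite k (M.space v × N.space v))

lemma finDim_dsum_left {M N : Repn k Q} (h : (M.dsum N).FinDim) : M.FinDim := by
  intro v
  haveI : Module.Finite k (M.space v × N.space v) := h v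
  exact Module.Finite.of_surjective (LinearMap.fst k (M.space v) (N.space v)) Prod.fst_surjective

lemma finDim_dsum_right {M N : Repn k Q} (h : (M.dsum N).FinDim) : N.FinDim := by
  intro v
  haveI : Module.Finite k (M.space v × N.space v) := h v
  exact Module.Finite.of_surjective (LinearMap.snd k (M.space v) (N.space v)) Prod.snd_surjective

lemma finDim_of_isZero {M : Repn k Q} (h : M.IsZero) : M.FinDim := by
  intro v
  haveI : Subsingleton (M.space v) := ⟨fun x y => (h v x).trans (h v y).symm⟩
  infer_instance

lemma dimv_dsum {M N : Repn k Q} (h : M.FinDim) (h' : N.FinDim) :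
    (M.dsum N).dimv = M.dimv + N.dimv := by
  funext v
  haveI := h v
  haveI := h' v
  exact Module.finrank_prod

lemma isZero_iff_dimv {M : Repn k Q} (h : M.FinDim) : M.IsZero ↔ M.dimv = 0 := by
  constructor
  · intro hz
    funext v
    haveI : Subsingleton (M.space v) := ⟨fun x y => (hz v x).trans (hz v y).symm⟩
    exact Module.finrank_zero_of_subsingleton
  · intro hd v x
    haveI := h v
    have := congrFun hd v
    have h2 : Subsingleton (M.space v) := Module.finrank_zero_iff.1 this
    exact Subsingleton.elim _ _

-- sub representations
def mkSub {X : Repn k Q} (U : ∀ v, Submodule k (X.space v))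
    (h : ∀ a x, x ∈ U (Q.s a) → X.map a x ∈ U (Q.t a)) : Subrep X :=
  ⟨U, fun a => by rintro _ ⟨x, hx, rfl⟩; exact h a x hx⟩

lemma Subrep.mem {X : Repn k Q} (U : Subrep X) {a : Q.A} {x : X.space (Q.s a)}
    (h : x ∈ U.sub (Q.s a)) : X.map a x ∈ U.sub (Q.t a) :=
  U.stable a (Submodule.mem_map_of_mem h)

lemma Subrep.ext' {X : Repn k Q} {U W : Subrep X} (h : ∀ v, U.sub v = W.sub v) : U = W := by
  cases U; cases W; congr; exact funext h

def kerS {X Y : Repn k Q} (f : Gr X Y) (hf : IsHom f) : Subrep X :=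
  mkSub (fun v => LinearMap.ker (f v)) (fun a x hx => by
    rw [LinearMap.mem_ker] at *; rw [hf, hx, map_zero])

def ranS {X Y : Repn k Q} (f : Gr X Y) (hf : IsHom f) : Subrep Y :=
  mkSub (fun v => LinearMap.range (f v)) (fun a x hx => by
    obtain ⟨y, rfl⟩ := hx
    exact ⟨X.map a y, hf a y⟩)

lemma finDim_repn {X : Repn k Q} (h : X.FinDim) (U : Subrep X) : U.repn.FinDim := fun v => by
  haveI := h v
  exact (inferInstance : Module.Finite k (U.sub v))

lemma finDim_quot {X : Repn k Q} (h : X.FinDim) (U : Subrep X) : U.quot.FinDim := fun v => by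
  haveI := h v
  exact (inferInstance : Module.Finite k (X.space v ⧸ U.sub v))

lemma dimv_sub_quot {X : Repn k Q} (h : X.FinDim) (U : Subrep X) :
    U.quot.dimv + U.repn.dimv = X.dimv := funext fun v => by
  haveI := h v
  exact Submodule.finrank_quotient_add_finrank (U.sub v)

lemma repnIso {K X : Repn k Q} (f : Gr K X) (hf : IsHom f) (hi : ∀ v, Function.Injective (f v))
    (U : Subrep X) (hU : ∀ v, LinearMap.range (f v) = U.sub v) : IsoP U.repn K := by
  refine IsoP.symm ⟨⟨fun v => (LinearEquiv.ofInjective (f v) (hi v)).trans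
    (LinearEquiv.ofEq _ _ (hU v)), fun a x => Subtype.ext ?_⟩⟩
  exact hf a x

lemma quotIso {X L : Repn k Q} (g : Gr X L) (hg : IsHom g) (hs : ∀ v, Function.Surjective (g v))
    (U : Subrep X) (hU : ∀ v, LinearMap.ker (g v) = U.sub v) : IsoP U.quot L := by
  refine ⟨⟨fun v => (Submodule.quotEquivOfEq _ _ (hU v).symm).trans
    ((g v).quotKerEquivOfSurjective (hs v)), fun a x => ?_⟩⟩
  obtain ⟨x, rfl⟩ := Submodule.mkQ_surjective _ x
  exact hg a x

/-- internal direct sum -/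
lemma isoOfCompl {X : Repn k Q} (U W : Subrep X) (h : ∀ v, IsCompl (U.sub v) (W.sub v)) :
    IsoP X (U.repn.dsum W.repn) := by
  refine IsoP.symm ⟨⟨fun v => Submodule.prodEquivOfIsCompl _ _ (h v), fun a x => ?_⟩⟩
  show ((X.map a x.1 : X.space (Q.t a))) + X.map a x.2 = X.map a (x.1 + x.2)
  rw [map_add]

lemma Indec.compl {X : Repn k Q} (hX : X.Indec) (U W : Subrep X)
    (h : ∀ v, IsCompl (U.sub v) (W.sub v)) : (∀ v, U.sub v = ⊥) ∨ (∀ v, W.sub v = ⊥) := by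
  rcases hX.2 _ _ (isoOfCompl U W h) with h1 | h1
  · left; intro v; rw [Submodule.eq_bot_iff]; intro x hx
    exact congrArg Subtype.val (h1 v (⟨x, hx⟩ : U.sub v))
  · right; intro v; rw [Submodule.eq_bot_iff]; intro x hx
    exact congrArg Subtype.val (h1 v (⟨x, hx⟩ : W.sub v))

lemma Indec.idem {X : Repn k Q} (hX : X.Indec) (e : Gr X X) (he : IsHom e)
    (hi : gcomp e e = e) : e = 0 ∨ e = gid X := by
  have hi' : ∀ v x, e v (e v x) = e v x := fun v x => LinearMap.congr_fun (congrFun hi v) x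
  rcases Indec.compl hX (ranS e he) (kerS e he) (fun v => by
    have : IsIdempotentElem (e v) := congrFun hi v
    exact (LinearMap.IsIdempotentElem.isCompl this)) with h | h
  · left; funext v; ext x
    have : e v x ∈ (ranS e he).sub v := ⟨x, rfl⟩
    rw [h v] at this; exact this
  · right; funext v; ext x
    have : e v x - x ∈ (kerS e he).sub v := by
      show e v (e v x - x) = 0
      rw [map_sub, hi', sub_self]
    rw [h v] at this
    exact sub_eq_zero.1 this

lemma indec_of_idem {X : Repn k Q} (h0 : ¬ X.IsZero)
    (h : ∀ e : Gr X X, IsHom e → gcomp e e = e → e = 0 ∨ e = gid X) : X.Indec := by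
  refine ⟨h0, fun Y Z ⟨φ⟩ => ?_⟩
  let p : Gr (Y.dsum Z) (Y.dsum Z) := fun v => (LinearMap.inl k _ _).comp (LinearMap.fst k _ _)
  have hp : IsHom p := fun a x => by
    show ((Y.map a x.1, (0 : Z.space _)) : Y.space _ × Z.space _) = (Y.map a x.1, Z.map a 0)
    rw [map_zero]
  let e : Gr X X := gcomp (ihom (isymm φ)) (gcomp p (ihom φ))
  have he : IsHom e := (isHom_ihom _).comp (hp.comp (isHom_ihom _))
  have hv : ∀ v (x : X.space v), φ.e v (e v x) = p v (φ.e v x) := fun v x =>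
    LinearEquiv.apply_symm_apply _ _
  rcases h e he (by
    funext v; ext x
    show (φ.e v).symm (p v (φ.e v ((φ.e v).symm (p v (φ.e v x))))) = (φ.e v).symm (p v (φ.e v x))
    rw [LinearEquiv.apply_symm_apply]; rfl) with h | h
  · left; intro v y
    have := hv v ((φ.e v).symm (y, 0))
    rw [h, LinearEquiv.apply_symm_apply] at this
    have h2 := congrArg Prod.fst this
    have h3 : (φ.e v ((0 : Gr X X) v ((φ.e v).symm (y, 0)))) = 0 := map_zero _
    rw [h3] at h2
    exact h2.symm
  · right; intro v z
    have := hv v ((φ.e v).symm (0, z))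
    rw [h, LinearEquiv.apply_symm_apply] at this
    have h3 : (φ.e v (gid X v ((φ.e v).symm (0, z)))) = (0, z) := LinearEquiv.apply_symm_apply _ _
    rw [h3] at this
    exact congrArg Prod.snd this

end HP

set_option linter.all false

namespace HP
open Repn
variable {k : Type} [Field k] {Q : QuiverData}

@[reducible] def exr (M N : Repn k Q) (c : Co M N) : Repn k Q where
  space v := N.space v × M.space v
  map a := LinearMap.prod
    ((N.map a).comp (LinearMap.fst k _ _) + (c a).comp (LinearMap.snd k _ _))
    ((M.map a).comp (LinearMap.snd k _ _))

def ext0 (M N : Repn k Q) : Prop := Function.Surjective (extMap M N)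

lemma ext0_iff {M N : Repn k Q} : ext0 M N ↔ ∀ c : Co M N, ∃ f : Gr M N,
    ∀ a x, c a x = N.map a (f (Q.s a) x) - f (Q.t a) (M.map a x) := by
  constructor
  · intro h c
    obtain ⟨f, rfl⟩ := h c
    exact ⟨f, fun a x => rfl⟩
  · intro h c
    obtain ⟨f, hf⟩ := h c
    exact ⟨f, funext fun a => LinearMap.ext fun x => (hf a x).symm⟩

lemma finDim_exr {M N : Repn k Q} (h : M.FinDim) (h' : N.FinDim) (c : Co M N) :
    (exr M N c).FinDim := by
  intro v
  have := h v
  have := h' v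
  exact (inferInstance : Module.Finite k (N.space v × M.space v))

lemma dimv_exr {M N : Repn k Q} (h : M.FinDim) (h' : N.FinDim) (c : Co M N) :
    (exr M N c).dimv = M.dimv + N.dimv := by
  funext v
  have := h v
  have := h' v
  exact (Module.finrank_prod (R := k) (M := N.space v) (M' := M.space v)).trans (add_comm _ _)

/-- changing a cocycle by a coboundary -/
lemma exr_cob {M N : Repn k Q} (c : Co M N) (f : Gr M N) :
    IsoP (exr M N (c + extMap M N f)) (exr M N c) := by
  refine ⟨isoOf (fun v => LinearMap.prod (LinearMap.fst k _ _ + (f v).comp (LinearMap.snd k _ _))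
    (LinearMap.snd k _ _)) ?_ ?_⟩
  · rintro a ⟨n, m⟩
    refine Prod.ext ?_ rfl
    show N.map a n + (c a m + (N.map a (f _ m) - f _ (M.map a m))) + f _ (M.map a m)
      = N.map a (n + f _ m) + c a m
    rw [map_add]; abel
  · intro v
    constructor
    · rintro ⟨n, m⟩ ⟨n', m'⟩ h
      have h2 : m = m' := congrArg Prod.snd h
      have h1 : n + f v m = n' + f v m' := congrArg Prod.fst h
      subst h2
      exact Prod.ext (add_right_cancel h1) rfl
    · rintro ⟨n, m⟩
      exact ⟨(n - f v m, m), Prod.ext (sub_add_cancel _ _) rfl⟩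

lemma exr_zero (M N : Repn k Q) : IsoP (exr M N 0) (N.dsum M) :=
  ⟨isoOf (fun v => LinearMap.id) (fun a x => by
    refine Prod.ext ?_ rfl
    exact add_zero (N.map a x.1)) (fun v => Function.bijective_id)⟩

lemma exr_split {M N : Repn k Q} (h : ext0 M N) (c : Co M N) : IsoP (exr M N c) (N.dsum M) := by
  obtain ⟨f, rfl⟩ := h c
  have := exr_cob 0 f
  rw [zero_add] at this
  exact this.trans (exr_zero M N)

-- ext0 closure
lemma ext0_congr {M N M' N' : Repn k Q} (hM : IsoP M M') (hN : IsoP N N') (h : ext0 M N) :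
    ext0 M' N' := by
  obtain ⟨φ⟩ := hM
  obtain ⟨ψ⟩ := hN
  rw [ext0_iff] at *
  intro c
  obtain ⟨f, hf⟩ := h (fun a => ((ψ.e _).symm.toLinearMap.comp (c a)).comp (φ.e _).toLinearMap)
  refine ⟨fun v => ((ψ.e v).toLinearMap.comp (f v)).comp (φ.e v).symm.toLinearMap, fun a x => ?_⟩
  have h1 := congrArg (ψ.e _) (hf a ((φ.e _).symm x))
  have h2 : φ.e (Q.t a) (M.map a ((φ.e (Q.s a)).symm x)) = M'.map a x := by
    rw [φ.comm, LinearEquiv.apply_symm_apply]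
  simp only [LinearMap.comp_apply, LinearEquiv.coe_coe, LinearEquiv.apply_symm_apply, map_sub,
    ψ.comm] at h1 ⊢
  rw [h1, ← h2, LinearEquiv.symm_apply_apply]

lemma ext0_dsum_left {A B N : Repn k Q} : ext0 (A.dsum B) N ↔ ext0 A N ∧ ext0 B N := by
  simp only [ext0_iff]
  constructor
  · intro h
    constructor
    · intro c
      obtain ⟨f, hf⟩ := h (fun a => (c a).comp (LinearMap.fst k _ _))
      refine ⟨fun v => (f v).comp (LinearMap.inl k _ _), fun a x => ?_⟩
      have := hf a (x, 0)
      simpa using this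
    · intro c
      obtain ⟨f, hf⟩ := h (fun a => (c a).comp (LinearMap.snd k _ _))
      refine ⟨fun v => (f v).comp (LinearMap.inr k _ _), fun a x => ?_⟩
      have := hf a (0, x)
      simpa using this
  · rintro ⟨h1, h2⟩ c
    obtain ⟨f, hf⟩ := h1 (fun a => (c a).comp (LinearMap.inl k _ _))
    obtain ⟨g, hg⟩ := h2 (fun a => (c a).comp (LinearMap.inr k _ _))
    refine ⟨fun v => (f v).coprod (g v), fun a x => ?_⟩
    obtain ⟨x, y⟩ := x
    have e1 := hf a x
    have e2 := hg a y
    have e3 : c a (x, y) = c a (x, 0) + c a (0, y) := by rw [← map_add]; simp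
    rw [e3]
    simp only [LinearMap.comp_apply, LinearMap.inl_apply, LinearMap.inr_apply] at e1 e2
    rw [e1, e2]
    simp only [LinearMap.coprod_apply, LinearMap.prodMap_apply, map_add]
    abel

lemma ext0_dsum_right {A B N : Repn k Q} : ext0 N (A.dsum B) ↔ ext0 N A ∧ ext0 N B := by
  simp only [ext0_iff]
  constructor
  · intro h
    constructor
    · intro c
      obtain ⟨f, hf⟩ := h (fun a => (LinearMap.inl k _ _).comp (c a))
      refine ⟨fun v => (LinearMap.fst k _ _).comp (f v), fun a x => ?_⟩
      exact congrArg Prod.fst (hf a x)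
    · intro c
      obtain ⟨f, hf⟩ := h (fun a => (LinearMap.inr k _ _).comp (c a))
      refine ⟨fun v => (LinearMap.snd k _ _).comp (f v), fun a x => ?_⟩
      exact congrArg Prod.snd (hf a x)
  · rintro ⟨h1, h2⟩ c
    obtain ⟨f, hf⟩ := h1 (fun a => (LinearMap.fst k _ _).comp (c a))
    obtain ⟨g, hg⟩ := h2 (fun a => (LinearMap.snd k _ _).comp (c a))
    exact ⟨fun v => (f v).prod (g v), fun a x => Prod.ext (hf a x) (hg a x)⟩

lemma ext0_of_isZero_left {M N : Repn k Q} (h : M.IsZero) : ext0 M N := by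
  rw [ext0_iff]
  intro c
  refine ⟨0, fun a x => ?_⟩
  rw [h _ x]; simp

lemma ext0_of_isZero_right {M N : Repn k Q} (h : N.IsZero) : ext0 M N := by
  rw [ext0_iff]
  intro c
  exact ⟨0, fun a x => (h _ _).trans (h _ _).symm⟩

-- homDim
lemma homDim_of_equiv {Q' : QuiverData} {M N : Repn k Q} {M' N' : Repn k Q'}
    (E : Gr M N ≃ₗ[k] Gr M' N') (h : ∀ f, IsHom f ↔ IsHom (E f)) : homDim M N = homDim M' N' := by
  refine LinearEquiv.finrank_eq (LinearEquiv.ofSubmodules E (Hm M N) (Hm M' N') ?_)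
  ext g
  rw [Submodule.mem_map]
  constructor
  · rintro ⟨f, hf, rfl⟩
    exact mem_Hm.2 ((h f).1 (mem_Hm.1 hf))
  · intro hg
    refine ⟨E.symm g, mem_Hm.2 ((h _).2 ?_), ?_⟩
    · rw [LinearEquiv.apply_symm_apply]; exact mem_Hm.1 hg
    · simp

lemma homDim_congr {M N M' N' : Repn k Q} (hM : IsoP M M') (hN : IsoP N N') :
    homDim M N = homDim M' N' := by
  obtain ⟨φ⟩ := hM
  obtain ⟨ψ⟩ := hN
  refine homDim_of_equiv (LinearEquiv.piCongrRight fun v =>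
    LinearEquiv.arrowCongr (φ.e v) (ψ.e v)) fun f => ?_
  constructor
  · intro hf
    have := (isHom_ihom ψ).comp (hf.comp (isHom_ihom (isymm φ)))
    exact this
  · intro hf
    have := (isHom_ihom (isymm ψ)).comp (hf.comp (isHom_ihom φ))
    convert this using 1
    funext v; ext x
    simp [gcomp, ihom, isymm, LinearEquiv.arrowCongr_apply]

lemma finite_Gr {M N : Repn k Q} (h : M.FinDim) (h' : N.FinDim) : Module.Finite k (Gr M N) := by
  have := h
  have := h'
  unfold FinDim at *
  infer_instance

lemma finite_Hm {M N : Repn k Q} (h : M.FinDim) (h' : N.FinDim) : Module.Finite k (Hm M N) := by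
  have := finite_Gr h h'
  infer_instance

lemma finite_Co {M N : Repn k Q} (h : M.FinDim) (h' : N.FinDim) : Module.Finite k (Co M N) := by
  have := h
  have := h'
  unfold FinDim at *
  infer_instance

lemma finrank_Gr {M N : Repn k Q} (h : M.FinDim) (h' : N.FinDim) :
    Module.finrank k (Gr M N) = ∑ v, M.dimv v * N.dimv v := by
  have := h
  have := h'
  unfold FinDim at *
  rw [Module.finrank_pi_fintype]
  exact Finset.sum_congr rfl fun v _ => Module.finrank_linearMap k k _ _

lemma finrank_Co {M N : Repn k Q} (h : M.FinDim) (h' : N.FinDim) :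
    Module.finrank k (Co M N) = ∑ a, M.dimv (Q.s a) * N.dimv (Q.t a) := by
  have := h
  have := h'
  unfold FinDim at *
  rw [Module.finrank_pi_fintype]
  exact Finset.sum_congr rfl fun v _ => Module.finrank_linearMap k k _ _

lemma euler_range {M N : Repn k Q} (h : M.FinDim) (h' : N.FinDim) :
    (homDim M N : ℤ) = eulerZ Q (natc M.dimv) (natc N.dimv) +
      (Module.finrank k (Co M N) - Module.finrank k (LinearMap.range (extMap M N)) : ℤ) := by
  have := finite_Gr h h'
  have h1 := LinearMap.finrank_range_add_finrank_ker (extMap M N)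
  rw [finrank_Gr h h'] at h1
  rw [finrank_Co h h']
  unfold homDim eulerZ natc
  zify at h1
  push_cast
  linarith

lemma euler_le {M N : Repn k Q} (h : M.FinDim) (h' : N.FinDim) :
    eulerZ Q (natc M.dimv) (natc N.dimv) ≤ homDim M N := by
  have := finite_Co h h'
  rw [euler_range h h']
  have := Submodule.finrank_le (LinearMap.range (extMap M N))
  zify at this
  linarith

lemma ext0_iff_dim {M N : Repn k Q} (h : M.FinDim) (h' : N.FinDim) :
    ext0 M N ↔ (homDim M N : ℤ) = eulerZ Q (natc M.dimv) (natc N.dimv) := by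
  have := finite_Co h h'
  rw [euler_range h h', ext0, ← LinearMap.range_eq_top]
  constructor
  · intro h
    rw [h, finrank_top]; ring
  · intro h
    apply Submodule.eq_top_of_finrank_eq
    zify; linarith

def hmProdL (A B N : Repn k Q) : Gr (A.dsum B) N ≃ₗ[k] Gr A N × Gr B N where
  toFun f := (fun v => (f v).comp (LinearMap.inl k _ _), fun v => (f v).comp (LinearMap.inr k _ _))
  invFun g := fun v => (g.1 v).coprod (g.2 v)
  map_add' f g := rfl
  map_smul' c f := rfl
  left_inv f := by funext v; ext <;> simp
  right_inv g := by ext <;> simp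

def hmProdR (A B N : Repn k Q) : Gr N (A.dsum B) ≃ₗ[k] Gr N A × Gr N B where
  toFun f := (fun v => (LinearMap.fst k _ _).comp (f v), fun v => (LinearMap.snd k _ _).comp (f v))
  invFun g := fun v => (g.1 v).prod (g.2 v)
  map_add' f g := rfl
  map_smul' c f := rfl
  left_inv f := by funext v; ext <;> simp
  right_inv g := by ext <;> simp

lemma isHom_inl (A B : Repn k Q) : IsHom (M := A) (N := A.dsum B) (fun v => LinearMap.inl k _ _) :=
  fun a x => by
    refine Prod.ext rfl ?_
    exact (map_zero (B.map a)).symm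
lemma isHom_inr (A B : Repn k Q) : IsHom (M := B) (N := A.dsum B) (fun v => LinearMap.inr k _ _) :=
  fun a x => by
    refine Prod.ext ?_ rfl
    exact (map_zero (A.map a)).symm
lemma isHom_fst (A B : Repn k Q) : IsHom (M := A.dsum B) (N := A) (fun v => LinearMap.fst k _ _) :=
  fun a x => rfl
lemma isHom_snd (A B : Repn k Q) : IsHom (M := A.dsum B) (N := B) (fun v => LinearMap.snd k _ _) :=
  fun a x => rfl

lemma finrank_prodSub {V W : Type} [AddCommGroup V] [Module k V] [AddCommGroup W] [Module k W]
    [Module.Finite k V] [Module.Finite k W] (p : Submodule k V) (q : Submodule k W) :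
    Module.finrank k (p.prod q) = Module.finrank k p + Module.finrank k q := by
  rw [← Module.finrank_prod]
  exact LinearEquiv.finrank_eq
    { toFun := fun x => (⟨x.1.1, x.2.1⟩, ⟨x.1.2, x.2.2⟩)
      invFun := fun x => ⟨(x.1.1, x.2.1), ⟨x.1.2, x.2.2⟩⟩
      map_add' := fun _ _ => rfl
      map_smul' := fun _ _ => rfl
      left_inv := fun _ => rfl
      right_inv := fun _ => rfl }

lemma homDim_dsum_left {A B N : Repn k Q} (hA : A.FinDim) (hB : B.FinDim) (hN : N.FinDim) :
    homDim (A.dsum B) N = homDim A N + homDim B N := by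
  have := finite_Gr hA hN
  have := finite_Gr hB hN
  unfold homDim
  rw [← finrank_prodSub]
  refine LinearEquiv.finrank_eq (LinearEquiv.ofSubmodules (hmProdL A B N) _ _ ?_)
  ext g
  rw [Submodule.mem_map, Submodule.mem_prod]
  constructor
  · rintro ⟨f, hf, rfl⟩
    have hf := mem_Hm.1 hf
    exact ⟨mem_Hm.2 (hf.comp (isHom_inl A B)), mem_Hm.2 (hf.comp (isHom_inr A B))⟩
  · rintro ⟨h1, h2⟩
    refine ⟨(hmProdL A B N).symm g, mem_Hm.2 ?_, by simp⟩
    exact ((mem_Hm.1 h1).comp (isHom_fst A B)).add ((mem_Hm.1 h2).comp (isHom_snd A B))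

lemma homDim_dsum_right {A B N : Repn k Q} (hA : A.FinDim) (hB : B.FinDim) (hN : N.FinDim) :
    homDim N (A.dsum B) = homDim N A + homDim N B := by
  have := finite_Gr hN hA
  have := finite_Gr hN hB
  unfold homDim
  rw [← finrank_prodSub]
  refine LinearEquiv.finrank_eq (LinearEquiv.ofSubmodules (hmProdR A B N) _ _ ?_)
  ext g
  rw [Submodule.mem_map, Submodule.mem_prod]
  constructor
  · rintro ⟨f, hf, rfl⟩
    have hf := mem_Hm.1 hf
    exact ⟨mem_Hm.2 ((isHom_fst A B).comp hf), mem_Hm.2 ((isHom_snd A B).comp hf)⟩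
  · rintro ⟨h1, h2⟩
    refine ⟨(hmProdR A B N).symm g, mem_Hm.2 ?_, by simp⟩
    intro a x
    exact Prod.ext (mem_Hm.1 h1 a x) (mem_Hm.1 h2 a x)

/-- composition maps on homs -/
def preC {M M' : Repn k Q} (N : Repn k Q) (g : Gr M M') (hg : IsHom g) : Hm M' N →ₗ[k] Hm M N where
  toFun f := ⟨gcomp f.1 g, mem_Hm.2 ((mem_Hm.1 f.2).comp hg)⟩
  map_add' _ _ := rfl
  map_smul' _ _ := rfl

def postC {N N' : Repn k Q} (M : Repn k Q) (g : Gr N N') (hg : IsHom g) : Hm M N →ₗ[k] Hm M N' where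
  toFun f := ⟨gcomp g f.1, mem_Hm.2 (hg.comp (mem_Hm.1 f.2))⟩
  map_add' f f' := Subtype.ext <| funext fun v => LinearMap.ext fun x => map_add (g v) _ _
  map_smul' c f := Subtype.ext <| funext fun v => LinearMap.ext fun x => map_smul (g v) _ _

lemma isHom_exr_inl (A B : Repn k Q) (c : Co A B) :
    IsHom (M := B) (N := exr A B c) (fun v => LinearMap.inl k _ _) := fun a x => by
  refine Prod.ext ?_ (map_zero (A.map a)).symm
  show B.map a x = B.map a x + c a 0
  rw [map_zero, add_zero]
lemma isHom_exr_snd (A B : Repn k Q) (c : Co A B) :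
    IsHom (M := exr A B c) (N := A) (fun v => LinearMap.snd k _ _) := fun a x => rfl

lemma homDim_exr_left {A B N : Repn k Q} (hA : A.FinDim) (hB : B.FinDim) (hN : N.FinDim)
    (c : Co A B) : homDim (exr A B c) N ≤ homDim A N + homDim B N := by
  have := finite_Hm (finDim_exr hA hB c) hN
  have := finite_Hm hA hN
  have := finite_Hm hB hN
  let ρ := preC N _ (isHom_exr_inl A B c)
  have h1 := LinearMap.finrank_range_add_finrank_ker ρ
  have h2 : Module.finrank k (LinearMap.range ρ) ≤ homDim B N := Submodule.finrank_le _
  have h3 : Module.finrank k (LinearMap.ker ρ) ≤ homDim A N := by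
    have key : ∀ f ∈ LinearMap.ker ρ, ∀ v (x : (exr A B c).space v), f.1 v x = f.1 v (0, x.2) := by
      intro f hf v x
      have h0 : f.1 v (x.1, 0) = 0 := LinearMap.congr_fun (congrFun (congrArg Subtype.val hf) v) x.1
      have h5 : x = ((x.1, 0) : B.space v × A.space v) + ((0, x.2) : B.space v × A.space v) := by simp
      conv_lhs => rw [h5]
      rw [map_add, h0, zero_add]
    refine LinearMap.finrank_le_finrank_of_injective (f :=
      ({ toFun := fun f => ⟨fun v => (f.1.1 v).comp (LinearMap.inr k _ _), mem_Hm.2 ?_⟩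
         map_add' := fun _ _ => rfl
         map_smul' := fun _ _ => rfl } : LinearMap.ker ρ →ₗ[k] Hm A N)) ?_
    · intro a x
      have h4 := mem_Hm.1 f.1.2 a ((0, x) : B.space _ × A.space _)
      rw [key _ f.2] at h4
      exact h4
    · intro f g hfg
      apply Subtype.ext; apply Subtype.ext
      funext v
      refine LinearMap.ext fun x => ?_
      rw [key _ f.2, key _ g.2]
      exact LinearMap.congr_fun (congrFun (congrArg Subtype.val hfg) v) x.2
  have h4 : homDim (exr A B c) N = Module.finrank k (Hm (exr A B c) N) := rfl
  omega

lemma homDim_exr_right_aux {A B N : Repn k Q} (hA : A.FinDim) (hB : B.FinDim) (hN : N.FinDim)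
    (c : Co A B) : homDim N (exr A B c) ≤ homDim N B +
      Module.finrank k (LinearMap.range (postC N _ (isHom_exr_snd A B c))) := by
  have := finite_Hm hN (finDim_exr hA hB c)
  have := finite_Hm hN hA
  have := finite_Hm hN hB
  let ρ := postC N _ (isHom_exr_snd A B c)
  have h1 := LinearMap.finrank_range_add_finrank_ker ρ
  have h3 : Module.finrank k (LinearMap.ker ρ) ≤ homDim N B := by
    have key : ∀ f ∈ LinearMap.ker ρ, ∀ v (x : N.space v), (f.1 v x).2 = 0 := by
      intro f hf v x
      exact LinearMap.congr_fun (congrFun (congrArg Subtype.val hf) v) x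
    refine LinearMap.finrank_le_finrank_of_injective (f :=
      ({ toFun := fun f => ⟨fun v => (LinearMap.fst k _ _).comp (f.1.1 v), mem_Hm.2 ?_⟩
         map_add' := fun _ _ => rfl
         map_smul' := fun _ _ => rfl } : LinearMap.ker ρ →ₗ[k] Hm N B)) ?_
    · intro a x
      have h4 := congrArg Prod.fst (mem_Hm.1 f.1.2 a x)
      have h5 : ((exr A B c).map a (f.1.1 (Q.s a) x)).1
        = B.map a (f.1.1 (Q.s a) x).1 + c a (f.1.1 (Q.s a) x).2 := rfl
      rw [h5, key _ f.2, map_zero, add_zero] at h4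
      exact h4
    · intro f g hfg
      apply Subtype.ext; apply Subtype.ext
      funext v; 
      refine LinearMap.ext fun x => Prod.ext ?_ ?_
      · exact LinearMap.congr_fun (congrFun (congrArg Subtype.val hfg) v) x
      · rw [key _ f.2, key _ g.2]
  have h4 : homDim N (exr A B c) = Module.finrank k (Hm N (exr A B c)) := rfl
  have h5 : Module.finrank k (LinearMap.range (postC N _ (isHom_exr_snd A B c)))
    = Module.finrank k (LinearMap.range ρ) := rfl
  omega

lemma homDim_exr_right {A B N : Repn k Q} (hA : A.FinDim) (hB : B.FinDim) (hN : N.FinDim)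
    (c : Co A B) : homDim N (exr A B c) ≤ homDim N B + homDim N A := by
  have := finite_Hm hN hA
  refine (homDim_exr_right_aux hA hB hN c).trans (Nat.add_le_add_left (Submodule.finrank_le _) _)

lemma homDim_exr_right_lt {A B : Repn k Q} (hA : A.FinDim) (hB : B.FinDim)
    (c : Co A B) (hc : c ∉ LinearMap.range (extMap A B)) :
    homDim A (exr A B c) < homDim A B + homDim A A := by
  have := finite_Hm hA hA
  refine (homDim_exr_right_aux hA hB hA c).trans_lt (Nat.add_lt_add_left ?_ _)
  apply Submodule.finrank_lt
  intro htop
  apply hc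
  rw [LinearMap.range_eq_top] at htop
  obtain ⟨f, hf⟩ := htop ⟨gid A, mem_Hm.2 (isHom_gid A)⟩
  have hf2 : ∀ v x, (f.1 v x).2 = x := fun v x =>
    LinearMap.congr_fun (congrFun (congrArg Subtype.val hf) v) x
  refine ⟨- (fun v => (LinearMap.fst k _ _).comp (f.1 v)), ?_⟩
  funext a; ext x
  rw [extMap_apply]
  have h4 := congrArg Prod.fst (mem_Hm.1 f.2 a x)
  have h5 : ((exr A B c).map a (f.1 (Q.s a) x)).1
    = B.map a (f.1 (Q.s a) x).1 + c a (f.1 (Q.s a) x).2 := rfl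
  rw [h5, hf2] at h4
  have h6 : c a x = (f.1 (Q.t a) (A.map a x)).1 - B.map a (f.1 (Q.s a) x).1 := by
    rw [h4]; abel
  rw [h6]
  simp only [Pi.neg_apply, LinearMap.neg_apply, LinearMap.comp_apply, LinearMap.fst_apply, map_neg]
  abel

lemma homDim_exr_lt {A B : Repn k Q} (hA : A.FinDim) (hB : B.FinDim)
    (c : Co A B) (hc : c ∉ LinearMap.range (extMap A B)) :
    homDim (exr A B c) (exr A B c) < homDim (A.dsum B) (A.dsum B) := by
  have hX := finDim_exr hA hB c
  have h1 := homDim_exr_left hA hB hX c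
  have h2 := homDim_exr_right_lt hA hB c hc
  have h3 := homDim_exr_right hA hB hB c
  rw [homDim_dsum_left hA hB (finDim_dsum hA hB), homDim_dsum_right hA hB hA,
    homDim_dsum_right hA hB hB]
  omega

end HP

set_option linter.all false

namespace HP
open Repn
variable {k : Type} [Field k]

@[reducible] def mkQ (R : QuiverData) (s t : R.A → R.V) : QuiverData :=
  { V := R.V, A := R.A, fintV := R.fintV, decV := R.decV, fintA := R.fintA, s := s, t := t }

section refl
variable {R : QuiverData}

/-- total incoming map -/
noncomputable def tot (X : Repn k R) : (∀ a, X.space (R.s a)) →ₗ[k] (∀ v, X.space v) :=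
  ∑ a, (LinearMap.single k X.space (R.t a)).comp ((X.map a).comp (LinearMap.proj a))

noncomputable def totv (X : Repn k R) (v : R.V) : (∀ a, X.space (R.s a)) →ₗ[k] X.space v :=
  (LinearMap.proj v).comp (tot X)

lemma tot_apply (X : Repn k R) (w : ∀ a, X.space (R.s a)) :
    tot X w = ∑ a, Pi.single (R.t a) (X.map a (w a)) := by
  simp [tot]

lemma totv_apply (X : Repn k R) (v : R.V) (w : ∀ a, X.space (R.s a)) :
    totv X v w = ∑ a, (Pi.single (R.t a) (X.map a (w a)) : ∀ v, X.space v) v := by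
  show (tot X w) v = _
  rw [tot_apply, Finset.sum_apply]

open Classical in
lemma totv_single (X : Repn k R) (a : R.A) (x : X.space (R.s a)) :
    totv X (R.t a) (Pi.single a x) = X.map a x := by
  rw [totv_apply, Finset.sum_eq_single a]
  · simp
  · intro b _ hb
    rw [Pi.single_eq_of_ne hb]; simp
  · simp

lemma totv_congr (X : Repn k R) (v : R.V) (w w' : ∀ a, X.space (R.s a))
    (h : ∀ a, R.t a = v → w a = w' a) : totv X v w = totv X v w' := by
  rw [totv_apply, totv_apply]
  refine Finset.sum_congr rfl fun a _ => ?_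
  by_cases ha : R.t a = v
  · rw [h a ha]
  · rw [Pi.single_eq_of_ne (Ne.symm ha), Pi.single_eq_of_ne (Ne.symm ha)]

lemma tot_hom {X Y : Repn k R} {f : Gr X Y} (hf : IsHom f) (w : ∀ a, X.space (R.s a)) (v : R.V) :
    totv Y v (fun a => f (R.s a) (w a)) = f v (totv X v w) := by
  rw [totv_apply, totv_apply, map_sum]
  refine Finset.sum_congr rfl fun a _ => ?_
  by_cases ha : R.t a = v
  · subst ha
    rw [Pi.single_eq_same, Pi.single_eq_same, hf]
  · rw [Pi.single_eq_of_ne (Ne.symm ha), Pi.single_eq_of_ne (Ne.symm ha), map_zero]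

@[reducible] def Amb (X : Repn k R) : Type := (∀ v, X.space v) × (∀ a, X.space (R.s a))

def Supp (X : Repn k R) (i : R.V) : Submodule k (∀ a, X.space (R.s a)) where
  carrier := {w | ∀ a, R.t a ≠ i → w a = 0}
  add_mem' := fun {x y} hx hy a ha => by
    show x a + y a = 0
    rw [hx a ha, hy a ha, add_zero]
  zero_mem' := fun a _ => rfl
  smul_mem' := fun c x hx a ha => by
    show c • x a = 0
    rw [hx a ha, smul_zero]

noncomputable def sp (X : Repn k R) (i v : R.V) : Submodule k (Amb X) :=
  if v = i then Submodule.map (LinearMap.inr k _ _) (Supp X i ⊓ LinearMap.ker (totv X i))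
  else LinearMap.range ((LinearMap.inl k (∀ v, X.space v) (∀ a, X.space (R.s a))).comp
    (LinearMap.single k X.space v))

lemma mem_sp_ne {X : Repn k R} {i v : R.V} (h : v ≠ i) {p : Amb X} :
    p ∈ sp X i v ↔ ∃ x : X.space v, p = (Pi.single v x, 0) := by
  rw [sp, if_neg h]
  constructor
  · rintro ⟨x, rfl⟩; exact ⟨x, rfl⟩
  · rintro ⟨x, rfl⟩; exact ⟨x, rfl⟩

lemma mem_sp_eq {X : Repn k R} {i : R.V} {p : Amb X} :
    p ∈ sp X i i ↔ ∃ w, (∀ a, R.t a ≠ i → w a = 0) ∧ totv X i w = 0 ∧ p = (0, w) := by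
  rw [sp, if_pos rfl]
  constructor
  · rintro ⟨w, ⟨h1, h2⟩, rfl⟩; exact ⟨w, h1, h2, rfl⟩
  · rintro ⟨w, h1, h2, rfl⟩; exact ⟨w, ⟨h1, h2⟩, rfl⟩

noncomputable def ambE (X : Repn k R) (i : R.V) (a : R.A) : Amb X →ₗ[k] Amb X :=
  if R.t a = i then (LinearMap.inl k _ _).comp ((LinearMap.single k X.space (R.s a)).comp
    ((LinearMap.proj a).comp (LinearMap.snd k (∀ v, X.space v) (∀ a, X.space (R.s a)))))
  else (LinearMap.inl k _ _).comp ((LinearMap.single k X.space (R.t a)).comp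
    ((X.map a).comp ((LinearMap.proj (R.s a)).comp
      (LinearMap.fst k (∀ v, X.space v) (∀ a, X.space (R.s a))))))

lemma ambE_eq {X : Repn k R} {i : R.V} {a : R.A} (h : R.t a = i) (p : Amb X) :
    ambE X i a p = (Pi.single (R.s a) (p.2 a), 0) := by rw [ambE, if_pos h]; rfl
lemma ambE_ne {X : Repn k R} {i : R.V} {a : R.A} (h : R.t a ≠ i) (p : Amb X) :
    ambE X i a p = (Pi.single (R.t a) (X.map a (p.1 (R.s a))), 0) := by rw [ambE, if_neg h]; rfl

structure RData (R : QuiverData) (i : R.V) (s t : R.A → R.V) : Prop where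
  sink : ∀ a, R.s a ≠ i
  s1 : ∀ a, R.t a = i → s a = i
  t1 : ∀ a, R.t a = i → t a = R.s a
  s2 : ∀ a, R.t a ≠ i → s a = R.s a
  t2 : ∀ a, R.t a ≠ i → t a = R.t a

variable {i : R.V} {s t : R.A → R.V}

lemma RData.t_ne (D : RData R i s t) (a : R.A) : t a ≠ i := by
  by_cases h : R.t a = i
  · rw [D.t1 a h]; exact D.sink a
  · rw [D.t2 a h]; exact h

lemma ambE_mem (D : RData R i s t) (X : Repn k R) (a : R.A) (p : Amb X) :
    ambE X i a p ∈ sp X i (t a) := by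
  rw [mem_sp_ne (D.t_ne a)]
  by_cases h : R.t a = i
  · rw [ambE_eq h, D.t1 a h]; exact ⟨_, rfl⟩
  · rw [ambE_ne h, D.t2 a h]; exact ⟨_, rfl⟩

@[reducible] noncomputable def rfl' (D : RData R i s t) (X : Repn k R) : Repn k (mkQ R s t) where
  space v := sp X i v
  map a := (ambE X i a).restrict fun p _ => ambE_mem D X a p

noncomputable def ambF {X Y : Repn k R} (f : Gr X Y) : Amb X →ₗ[k] Amb Y :=
  LinearMap.prodMap (LinearMap.pi fun v => (f v).comp (LinearMap.proj v))
    (LinearMap.pi fun a => (f (R.s a)).comp (LinearMap.proj a))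

lemma ambF_apply {X Y : Repn k R} (f : Gr X Y) (p : Amb X) :
    ambF f p = (fun v => f v (p.1 v), fun a => f (R.s a) (p.2 a)) := rfl

lemma map_pisingle {X Y : Repn k R} (f : Gr X Y) (v : R.V) (x : X.space v) :
    (fun u => f u ((Pi.single v x : ∀ u, X.space u) u)) = Pi.single v (f v x) := by
  funext u
  by_cases h : u = v
  · subst h; simp
  · simp [Pi.single_eq_of_ne h]

lemma ambF_mem {X Y : Repn k R} {f : Gr X Y} (hf : IsHom f) (i v : R.V) (p : Amb X)
    (hp : p ∈ sp X i v) : ambF f p ∈ sp Y i v := by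
  by_cases h : v = i
  · subst h
    rw [mem_sp_eq] at *
    obtain ⟨w, h1, h2, rfl⟩ := hp
    refine ⟨fun a => f (R.s a) (w a), ?_, ?_, ?_⟩
    · intro a ha; show f _ (w a) = 0; rw [h1 a ha, map_zero]
    · rw [tot_hom hf, h2, map_zero]
    · rw [ambF_apply]
      refine Prod.ext ?_ rfl
      funext v; exact map_zero _
  · rw [mem_sp_ne h] at *
    obtain ⟨x, rfl⟩ := hp
    refine ⟨f v x, ?_⟩
    rw [ambF_apply]
    refine Prod.ext (map_pisingle f v x) ?_
    funext a; exact map_zero _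

noncomputable def rF (D : RData R i s t) {X Y : Repn k R} (f : Gr X Y) (hf : IsHom f) :
    Gr (rfl' D X) (rfl' D Y) :=
  fun v => (ambF f).restrict (ambF_mem hf i v)

lemma rF_val (D : RData R i s t) {X Y : Repn k R} (f : Gr X Y) (hf : IsHom f) (v : R.V)
    (p : sp X i v) : (rF D f hf v p).1 = ambF f p.1 := rfl

lemma rF_isHom (D : RData R i s t) {X Y : Repn k R} (f : Gr X Y) (hf : IsHom f) :
    IsHom (rF D f hf) := by
  intro a p
  apply Subtype.ext
  show ambF f (ambE X i a p.1) = ambE Y i a (ambF f p.1)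
  by_cases h : R.t a = i
  · rw [ambE_eq h, ambE_eq h, ambF_apply, ambF_apply]
    refine Prod.ext (map_pisingle f _ _) ?_
    funext a; exact map_zero _
  · rw [ambE_ne h, ambE_ne h, ambF_apply, ambF_apply]
    refine Prod.ext ?_ ?_
    · show _ = Pi.single (R.t a) (Y.map a (f _ _))
      rw [← hf]
      exact map_pisingle f _ _
    · funext a; exact map_zero _

lemma rF_comp (D : RData R i s t) {X Y Z : Repn k R} (f : Gr X Y) (hf : IsHom f) (g : Gr Y Z)
    (hg : IsHom g) : rF D (gcomp g f) (hg.comp hf) = gcomp (rF D g hg) (rF D f hf) := by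
  funext v; refine LinearMap.ext fun p => ?_; rfl

lemma rF_id (D : RData R i s t) (X : Repn k R) : rF D (gid X) (isHom_gid X) = gid _ := by
  funext v; refine LinearMap.ext fun p => ?_; rfl

noncomputable def rFl (D : RData R i s t) (X Y : Repn k R) : Hm X Y →ₗ[k] Hm (rfl' D X) (rfl' D Y) where
  toFun f := ⟨rF D f.1 (mem_Hm.1 f.2), mem_Hm.2 (rF_isHom D _ _)⟩
  map_add' f g := by
    apply Subtype.ext; funext v; refine LinearMap.ext fun p => ?_; rfl
  map_smul' c f := by
    apply Subtype.ext; funext v; refine LinearMap.ext fun p => ?_; rfl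

lemma sp_single {X : Repn k R} {v : R.V} (h : v ≠ i) (x : X.space v) :
    ((Pi.single v x, 0) : Amb X) ∈ sp X i v := (mem_sp_ne h).2 ⟨x, rfl⟩

lemma rFl_inj (D : RData R i s t) (X Y : Repn k R) (hX : Function.Surjective (totv X i)) :
    Function.Injective (rFl D X Y) := by
  rw [injective_iff_map_eq_zero]
  intro f hf
  have hf' : ∀ v (p : sp X i v), ambF f.1 p.1 = 0 := fun v p =>
    congrArg Subtype.val (LinearMap.congr_fun (congrFun (congrArg Subtype.val hf) v) p)
  have h1 : ∀ v, v ≠ i → ∀ x, f.1 v x = 0 := by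
    intro v hv x
    have := congrFun (congrArg Prod.fst (hf' v ⟨_, sp_single hv x⟩)) v
    rw [ambF_apply] at this
    simpa using this
  apply Subtype.ext
  funext v
  refine LinearMap.ext fun x => ?_
  by_cases hv : v = i
  · subst hv
    obtain ⟨w, rfl⟩ := hX x
    rw [← tot_hom (mem_Hm.1 f.2)]
    have : (fun a => f.1 (R.s a) (w a)) = 0 := by
      funext a; exact h1 _ (D.sink a) _
    rw [this, map_zero]; rfl
  · exact h1 v hv x

open Classical in
lemma exists_section (X : Repn k R) (v : R.V) : ∃ σ : X.space v →ₗ[k] (∀ a, X.space (R.s a)),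
    (∀ x a, R.t a ≠ v → σ x a = 0) ∧
    (Function.Surjective (totv X v) → ∀ x, totv X v (σ x) = x) := by
  by_cases h : Function.Surjective (totv X v)
  · obtain ⟨τ, hτ⟩ := LinearMap.exists_rightInverse_of_surjective (totv X v) (LinearMap.range_eq_top.2 h)
    let P : (∀ a, X.space (R.s a)) →ₗ[k] (∀ a, X.space (R.s a)) :=
      LinearMap.pi fun a => if R.t a = v then LinearMap.proj a else 0
    have hP : ∀ w a, R.t a = v → P w a = w a := by
      intro w a ha
      simp [P, ha]
    refine ⟨P.comp τ, ?_, fun _ x => ?_⟩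
    · intro x a ha
      simp [P, ha]
    · rw [LinearMap.comp_apply, totv_congr X v _ _ (hP (τ x))]
      exact LinearMap.congr_fun hτ x
  · exact ⟨0, fun _ _ _ => rfl, fun h' => absurd h' h⟩

lemma rFl_surj (D : RData R i s t) (X Y : Repn k R) (hX : Function.Surjective (totv X i)) :
    Function.Surjective (rFl D X Y) := by
  classical
  rintro ⟨g, hg⟩
  have hg := mem_Hm.1 hg
  let f0 : Gr X Y := fun v => if h : v = i then 0 else
    (LinearMap.proj v).comp ((LinearMap.fst k (∀ v, Y.space v) (∀ a, Y.space (R.s a))).comp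
      ((sp Y i v).subtype.comp ((g v).comp
        (LinearMap.codRestrict (sp X i v) ((LinearMap.inl k (∀ v, X.space v)
          (∀ a, X.space (R.s a))).comp (LinearMap.single k X.space v)) (fun x => sp_single h x)))))
  have hf0 : ∀ v (h : v ≠ i) x, (g v ⟨_, sp_single h x⟩).1 = (Pi.single v (f0 v x), 0) := by
    intro v h x
    obtain ⟨y, hy⟩ := (mem_sp_ne h).1 (g v ⟨_, sp_single h x⟩).2
    have : f0 v x = ((g v ⟨_, sp_single h x⟩).1).1 v := by
      simp only [f0, dif_neg h]; rfl
    rw [hy] at this ⊢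
    rw [this]
    simp
  choose σ hσ1 hσ2 using exists_section X
  let f : Gr X Y := fun v => if v = i then
      (totv Y v).comp ((LinearMap.pi fun a => (f0 (R.s a)).comp (LinearMap.proj a)).comp (σ v))
    else f0 v
  have hfne : ∀ v, v ≠ i → f v = f0 v := fun v h => by simp only [f, if_neg h]
  have hfi : ∀ x, f i x = totv Y i (fun a => f0 (R.s a) (σ i x a)) := fun x => by
    simp only [f]; rw [if_pos trivial]; rfl
  -- key: elements of sp X i i
  have key : ∀ w, (∀ a, R.t a ≠ i → w a = 0) → totv X i w = 0 → ∀ h : ((0, w) : Amb X) ∈ sp X i i,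
      (g i ⟨(0, w), h⟩).1 = (0, fun a => f0 (R.s a) (w a)) := by
    intro w h1 h2 h
    obtain ⟨w', h1', h2', e⟩ := mem_sp_eq.1 (g i ⟨(0, w), h⟩).2
    rw [e]
    refine Prod.ext rfl ?_
    funext b
    by_cases hb : R.t b = i
    · have hs := D.s1 b hb
      have ht := D.t1 b hb
      have hc : ∀ (u : R.V) (hu : u = i) (hm : ((0, w) : Amb X) ∈ sp X i u),
          (g u ⟨(0, w), hm⟩).1 = (0, w') := by
        intro u hu hm; subst hu; exact e
      have hc2 : ∀ (u : R.V) (hu : u = R.s b) (q : Amb X) (hm : q ∈ sp X i u)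
          (hq : q = (Pi.single (R.s b) (w b), 0)),
          (g u ⟨q, hm⟩).1 = (Pi.single (R.s b) (f0 (R.s b) (w b)), 0) := by
        intro u hu q hm hq; subst hu; subst hq; exact hf0 _ (D.sink b) _
      have hm : ((0, w) : Amb X) ∈ sp X i (s b) := by rw [hs]; exact h
      have h3 := congrArg Subtype.val (hg b ⟨(0, w), hm⟩)
      have h4 : (g (t b) ((rfl' D X).map b ⟨(0, w), hm⟩)).1 =
        (Pi.single (R.s b) (f0 (R.s b) (w b)), 0) := hc2 _ ht _ _ (ambE_eq hb _)
      have h5 : ((rfl' D Y).map b (g (s b) ⟨(0, w), hm⟩)).1 = (Pi.single (R.s b) (w' b), 0) := by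
        show ambE Y i b (g (s b) ⟨(0, w), hm⟩).1 = _
        rw [hc _ hs hm, ambE_eq hb]
      have h6 := (h5.symm.trans h3.symm).trans h4
      have h7 := congrFun (congrArg Prod.fst h6) (R.s b)
      simpa using h7
    · show w' b = f0 _ (w b)
      rw [h1 b hb, h1' b hb, map_zero]
  have hf : IsHom f := by
    intro a x
    rw [hfne _ (D.sink a)]
    by_cases ha : R.t a = i
    · -- arrow into i
      subst ha
      let w : ∀ b, X.space (R.s b) := Pi.single a x - σ (R.t a) (X.map a x)
      have hw1 : ∀ b, R.t b ≠ R.t a → w b = 0 := by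
        intro b hb
        have hne : b ≠ a := fun h => hb (by rw [h])
        simp only [w, Pi.sub_apply]
        rw [Pi.single_eq_of_ne hne, hσ1 _ _ _ hb, sub_zero]
      have hw2 : totv X (R.t a) w = 0 := by
        simp only [w]
        rw [map_sub, totv_single, hσ2 _ hX, sub_self]
      have hm : ((0, w) : Amb X) ∈ sp X (R.t a) (R.t a) := mem_sp_eq.2 ⟨w, hw1, hw2, rfl⟩
      have h3 := key w hw1 hw2 hm
      obtain ⟨w', h1', h2', e⟩ := mem_sp_eq.1 (g (R.t a) ⟨(0, w), hm⟩).2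
      rw [h3] at e
      have e2 : (fun b => f0 (R.s b) (w b)) = w' := congrArg Prod.snd e
      rw [← e2] at h2'
      have e3 : (fun b => f0 (R.s b) (w b)) =
          Pi.single a (f0 (R.s a) x) - fun b => f0 (R.s b) (σ (R.t a) (X.map a x) b) := by
        funext b
        simp only [w, Pi.sub_apply, map_sub]
        congr 1
        by_cases hb : b = a
        · subst hb; simp
        · rw [Pi.single_eq_of_ne hb, Pi.single_eq_of_ne hb, map_zero]
      rw [e3, map_sub, totv_single, sub_eq_zero] at h2'
      rw [hfi, h2']
    · rw [hfne _ ha]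
      have hm : ((Pi.single (R.s a) x, 0) : Amb X) ∈ sp X i (s a) := by
        rw [D.s2 a ha]; exact sp_single (D.sink a) x
      have h3 := congrArg Subtype.val (hg a ⟨_, hm⟩)
      have hc2 : ∀ (u v : R.V) (hv : v ≠ i) (hu : u = v) (z : X.space v) (q : Amb X)
          (hm : q ∈ sp X i u) (hq : q = (Pi.single v z, 0)),
          (g u ⟨q, hm⟩).1 = (Pi.single v (f0 v z), 0) := by
        intro u v hv hu z q hm hq; subst hu; subst hq; exact hf0 _ hv _
      have h4 : (g (t a) ((rfl' D X).map a ⟨_, hm⟩)).1 =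
        (Pi.single (R.t a) (f0 (R.t a) (X.map a x)), 0) := by
          refine hc2 _ _ ha (D.t2 a ha) _ _ _ ?_
          show ambE X i a _ = _
          rw [ambE_ne ha]; simp
      have h5 : ((rfl' D Y).map a (g (s a) ⟨_, hm⟩)).1 =
          (Pi.single (R.t a) (Y.map a (f0 (R.s a) x)), 0) := by
        show ambE Y i a (g (s a) ⟨_, hm⟩).1 = _
        rw [hc2 _ _ (D.sink a) (D.s2 a ha) x _ hm rfl, ambE_ne ha]; simp
      have h6 := (h5.symm.trans h3.symm).trans h4
      have h7 := congrFun (congrArg Prod.fst h6) (R.t a)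
      simpa using h7.symm
  refine ⟨⟨f, mem_Hm.2 hf⟩, ?_⟩
  apply Subtype.ext
  funext v
  refine LinearMap.ext fun p => Subtype.ext ?_
  show ambF f p.1 = (g v p).1
  obtain ⟨p, hp⟩ := p
  by_cases hv : v = i
  · subst hv
    obtain ⟨w, h1, h2, rfl⟩ := mem_sp_eq.1 hp
    rw [key w h1 h2, ambF_apply]
    refine Prod.ext ?_ ?_
    · funext v; exact map_zero _
    · funext a
      show f _ (w a) = f0 _ (w a)
      rw [hfne _ (D.sink a)]
  · obtain ⟨x, rfl⟩ := (mem_sp_ne (R := R) (X := X) (v := v) hv).1 hp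
    rw [hf0 v hv x, ambF_apply]
    refine Prod.ext ?_ ?_
    · show (fun u => f u ((Pi.single v x : ∀ u, X.space u) u)) = _
      rw [map_pisingle, hfne _ hv]
    · funext v; exact map_zero _

lemma rfl_homDim (D : RData R i s t) (X Y : Repn k R) (hX : Function.Surjective (totv X i)) :
    homDim (rfl' D X) (rfl' D Y) = homDim X Y :=
  (LinearEquiv.finrank_eq (LinearEquiv.ofBijective (rFl D X Y)
    ⟨rFl_inj D X Y hX, rFl_surj D X Y hX⟩)).symm

end refl
end HP

set_option linter.all false

namespace HP
open Repn
variable {k : Type} [Field k] {R : QuiverData} {i : R.V} {s t : R.A → R.V}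

lemma rfl_iso (D : RData R i s t) {X Y : Repn k R} (hX : Function.Surjective (totv X i))
    (hY : Function.Surjective (totv Y i)) (h : IsoP (rfl' D X) (rfl' D Y)) : IsoP X Y := by
  obtain ⟨φ⟩ := h
  obtain ⟨f, hf⟩ := rFl_surj D X Y hX ⟨ihom φ, mem_Hm.2 (isHom_ihom φ)⟩
  obtain ⟨g, hg⟩ := rFl_surj D Y X hY ⟨ihom (isymm φ), mem_Hm.2 (isHom_ihom _)⟩
  have hf' : rF D f.1 (mem_Hm.1 f.2) = ihom φ := congrArg Subtype.val hf
  have hg' : rF D g.1 (mem_Hm.1 g.2) = ihom (isymm φ) := congrArg Subtype.val hg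
  have h1 : gcomp g.1 f.1 = gid X := by
    have := rFl_inj D X X hX (a₁ := ⟨gcomp g.1 f.1, mem_Hm.2 ((mem_Hm.1 g.2).comp (mem_Hm.1 f.2))⟩)
      (a₂ := ⟨gid X, mem_Hm.2 (isHom_gid X)⟩) (Subtype.ext (by
        show rF D (gcomp g.1 f.1) ((mem_Hm.1 g.2).comp (mem_Hm.1 f.2)) = rF D (gid X) (isHom_gid X)
        rw [rF_comp D f.1 (mem_Hm.1 f.2) g.1 (mem_Hm.1 g.2), hf', hg', rF_id]
        funext v; refine LinearMap.ext fun x => ?_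
        exact LinearEquiv.symm_apply_apply (φ.e v) x))
    exact congrArg Subtype.val this
  have h2 : gcomp f.1 g.1 = gid Y := by
    have := rFl_inj D Y Y hY (a₁ := ⟨gcomp f.1 g.1, mem_Hm.2 ((mem_Hm.1 f.2).comp (mem_Hm.1 g.2))⟩)
      (a₂ := ⟨gid Y, mem_Hm.2 (isHom_gid Y)⟩) (Subtype.ext (by
        show rF D (gcomp f.1 g.1) ((mem_Hm.1 f.2).comp (mem_Hm.1 g.2)) = rF D (gid Y) (isHom_gid Y)
        rw [rF_comp D g.1 (mem_Hm.1 g.2) f.1 (mem_Hm.1 f.2), hf', hg', rF_id]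
        funext v; refine LinearMap.ext fun x => ?_
        exact LinearEquiv.apply_symm_apply (φ.e v) x))
    exact congrArg Subtype.val this
  refine ⟨isoOf f.1 (mem_Hm.1 f.2) fun v => ?_⟩
  refine Function.bijective_iff_has_inverse.2 ⟨g.1 v, fun x => ?_, fun y => ?_⟩
  · exact LinearMap.congr_fun (congrFun h1 v) x
  · exact LinearMap.congr_fun (congrFun h2 v) y

lemma rfl_indec (D : RData R i s t) {X : Repn k R} (hX : Function.Surjective (totv X i))
    (h : X.Indec) : (rfl' D X).Indec := by
  apply indec_of_idem
  · intro hz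
    apply h.1
    have : (⟨gid X, mem_Hm.2 (isHom_gid X)⟩ : Hm X X) = 0 := rFl_inj D X X hX (Subtype.ext (by
      funext v; refine LinearMap.ext fun x => ?_
      exact (hz v _).trans (hz v _).symm))
    intro v x
    exact LinearMap.congr_fun (congrFun (congrArg Subtype.val this) v) x
  · intro e he hi
    obtain ⟨f, hf⟩ := rFl_surj D X X hX ⟨e, mem_Hm.2 he⟩
    have hf' : rF D f.1 (mem_Hm.1 f.2) = e := congrArg Subtype.val hf
    have h1 : gcomp f.1 f.1 = f.1 := by
      have := rFl_inj D X X hX (a₁ := ⟨gcomp f.1 f.1, mem_Hm.2 ((mem_Hm.1 f.2).comp (mem_Hm.1 f.2))⟩)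
        (a₂ := f) (Subtype.ext (by
          show rF D (gcomp f.1 f.1) ((mem_Hm.1 f.2).comp (mem_Hm.1 f.2)) = rF D f.1 (mem_Hm.1 f.2)
          rw [rF_comp D f.1 (mem_Hm.1 f.2) f.1 (mem_Hm.1 f.2), hf', hi]))
      exact congrArg Subtype.val this
    rcases Indec.idem h f.1 (mem_Hm.1 f.2) h1 with h2 | h2
    · left
      have : f = 0 := Subtype.ext h2
      rw [this, map_zero] at hf
      exact (congrArg Subtype.val hf).symm
    · right
      rw [← hf', ← rF_id]
      congr 1

lemma finDim_rfl (D : RData R i s t) {X : Repn k R} (h : X.FinDim) : (rfl' D X).FinDim := by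
  intro v
  have := h
  unfold FinDim at this
  exact (inferInstance : Module.Finite k (sp X i v))

/-- reflection on integer vectors -/
def sr (R : QuiverData) (i : R.V) (d : R.V → ℤ) : R.V → ℤ :=
  Function.update d i ((∑ a, ((if R.t a = i then d (R.s a) else 0) +
    (if R.s a = i then d (R.t a) else 0))) - d i)

def suppE (X : Repn k R) (i : R.V) : Supp X i ≃ₗ[k] (∀ a : {a // R.t a = i}, X.space (R.s a.1)) where
  toFun w := fun a => w.1 a.1
  invFun w := ⟨fun a => if h : R.t a = i then w ⟨a, h⟩ else 0, fun a ha => dif_neg ha⟩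
  map_add' _ _ := rfl
  map_smul' _ _ := rfl
  left_inv w := by
    apply Subtype.ext
    funext a
    by_cases h : R.t a = i
    · simp [h]
    · simp only [dif_neg h]; exact (w.2 a h).symm
  right_inv w := by
    funext a
    simp [a.2]

lemma finrank_Supp {X : Repn k R} (h : X.FinDim) (i : R.V) :
    Module.finrank k (Supp X i) = ∑ a, if R.t a = i then X.dimv (R.s a) else 0 := by
  have := h
  unfold FinDim at this
  rw [(suppE X i).finrank_eq, Module.finrank_pi_fintype, ← Finset.sum_filter]
  exact (Finset.sum_subtype (Finset.univ.filter fun a => R.t a = i) (by simp)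
    (fun a => X.dimv (R.s a))).symm

lemma dimv_rfl (D : RData R i s t) {X : Repn k R} (h : X.FinDim)
    (hX : Function.Surjective (totv X i)) :
    natc (Q := mkQ R s t) (rfl' D X).dimv = sr R i (natc X.dimv) := by
  have := h
  unfold FinDim at this
  funext v
  unfold natc sr
  by_cases hv : v = i
  · subst hv
    rw [Function.update_self]
    have e1 : (rfl' D X).dimv v = Module.finrank k (Supp X v ⊓ LinearMap.ker (totv X v) :
        Submodule k _) := by
      show Module.finrank k (sp X v v) = _
      rw [sp, if_pos rfl]
      exact (Submodule.equivMapOfInjective _ LinearMap.inr_injective _).finrank_eq.symm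
    let ρ := (totv X v).comp (Supp X v).subtype
    have hρ : Function.Surjective ρ := by
      obtain ⟨σ, h1, h2⟩ := exists_section X v
      intro x
      exact ⟨⟨σ x, h1 x⟩, h2 hX x⟩
    have h1 := LinearMap.finrank_range_add_finrank_ker ρ
    rw [LinearMap.range_eq_top.2 hρ, finrank_top, finrank_Supp h] at h1
    have h2 : Module.finrank k (LinearMap.ker ρ) = (rfl' D X).dimv v := by
      rw [e1]
      refine LinearEquiv.finrank_eq
        { toFun := fun x => ⟨x.1.1, ⟨x.1.2, x.2⟩⟩
          invFun := fun x => ⟨⟨x.1, x.2.1⟩, x.2.2⟩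
          map_add' := fun _ _ => rfl
          map_smul' := fun _ _ => rfl
          left_inv := fun _ => rfl
          right_inv := fun _ => rfl }
    rw [h2] at h1
    have h3 : ∑ a, ((if R.t a = v then (X.dimv (R.s a) : ℤ) else 0) +
        (if R.s a = v then (X.dimv (R.t a) : ℤ) else 0)) =
        ((∑ a, if R.t a = v then X.dimv (R.s a) else 0 : ℕ) : ℤ) := by
      push_cast
      refine Finset.sum_congr rfl fun a _ => ?_
      rw [if_neg (D.sink a), add_zero]
    rw [h3, ← h1]
    have h4 : X.dimv v = Module.finrank k (X.space v) := rfl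
    show _ = _ - (X.dimv v : ℤ)
    rw [h4]
    push_cast
    ring
  · rw [Function.update_of_ne hv]
    have : (rfl' D X).dimv v = X.dimv v := by
      show Module.finrank k (sp X i v) = _
      rw [sp, if_neg hv]
      exact LinearMap.finrank_range_of_inj (LinearMap.inl_injective.comp (Pi.single_injective v))
    rw [this]

/-- decomposable unless surjective at a sink -/
lemma indec_surj {X : Repn k R} (hs : ∀ a, R.s a ≠ i) (h : X.Indec) (hfd : X.FinDim)
    (hd : X.dimv ≠ Pi.single i 1) : Function.Surjective (totv X i) := by
  classical
  by_contra hns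
  have hX0 : ∀ v, v ≠ i → ∀ x : X.space v, x = 0 := by
    choose C hC using fun v => Submodule.exists_isCompl (LinearMap.range (totv X v))
    let U : Subrep X := mkSub (fun v => if v = i then C v else ⊥) (by
      intro a x hx
      rw [if_neg (hs a), Submodule.mem_bot] at hx
      rw [hx, map_zero]; exact Submodule.zero_mem _)
    let W : Subrep X := mkSub (fun v => if v = i then LinearMap.range (totv X v) else ⊤) (by
      intro a x hx
      by_cases hv : R.t a = i
      · rw [if_pos hv]; exact ⟨_, totv_single X a x⟩
      · rw [if_neg hv]; trivial)
    rcases Indec.compl h U W (by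
      intro v
      show IsCompl (if v = i then C v else ⊥) (if v = i then LinearMap.range (totv X v) else ⊤)
      by_cases hv : v = i
      · rw [if_pos hv, if_pos hv]; exact (hC v).symm
      · rw [if_neg hv, if_neg hv]; exact isCompl_bot_top) with h1 | h1
    · exfalso
      apply hns
      have h2 : (if i = i then C i else ⊥) = ⊥ := h1 i
      rw [if_pos rfl] at h2
      have h3 := (hC i).sup_eq_top
      rw [h2, sup_bot_eq] at h3
      exact LinearMap.range_eq_top.1 h3
    · intro v hv x
      have h2 : (if v = i then LinearMap.range (totv X v) else ⊤) = ⊥ := h1 v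
      rw [if_neg hv] at h2
      have : x ∈ (⊤ : Submodule k (X.space v)) := trivial
      rw [h2] at this
      exact this
  apply hd
  have hnz : ∃ x : X.space i, x ≠ 0 := by
    by_contra hcon
    push Not at hcon
    apply h.1
    intro v x
    by_cases hv : v = i
    · subst hv; exact hcon x
    · exact hX0 v hv x
  obtain ⟨x, hx⟩ := hnz
  choose C hC using fun v => Submodule.exists_isCompl
    (Submodule.span k {(Pi.single i x : ∀ v, X.space v) v})
  have hz : ∀ (a : R.A) (y : X.space (R.s a)), X.map a y = 0 := fun a y => by
    rw [hX0 _ (hs a) y, map_zero]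
  rcases Indec.compl h (mkSub _ (fun a y _ => by rw [hz]; exact Submodule.zero_mem _))
    (mkSub C (fun a y _ => by rw [hz]; exact Submodule.zero_mem _)) hC with h1 | h1
  · exfalso
    have h2 := h1 i
    have : x ∈ Submodule.span k {(Pi.single i x : ∀ v, X.space v) i} := by
      rw [Pi.single_eq_same]; exact Submodule.mem_span_singleton_self x
    have h3 : x ∈ (⊥ : Submodule k (X.space i)) := by rw [← h2]; exact this
    exact hx h3
  · have h2 : C i = ⊥ := h1 i
    have h3 := (hC i).sup_eq_top
    rw [h2, sup_bot_eq, Pi.single_eq_same] at h3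
    funext v
    by_cases hv : v = i
    · subst hv
      rw [Pi.single_eq_same]
      show Module.finrank k (X.space v) = 1
      rw [← finrank_top, ← h3, finrank_span_singleton hx]
    · rw [Pi.single_eq_of_ne hv]
      have : Subsingleton (X.space v) := ⟨fun a b => (hX0 v hv a).trans (hX0 v hv b).symm⟩
      exact Module.finrank_zero_of_subsingleton

lemma zero_of_dimv_single {X : Repn k R} (hfd : X.FinDim) (hd : X.dimv = Pi.single i 1)
    {v : R.V} (hv : v ≠ i) (x : X.space v) : x = 0 := by
  have := hfd v
  have h1 : Module.finrank k (X.space v) = 0 := by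
    have h2 := congrFun hd v
    rw [Pi.single_eq_of_ne hv] at h2
    exact h2
  have := Module.finrank_zero_iff.1 h1
  exact Subsingleton.elim _ _

lemma dead_ext0 {X Y : Repn k R} (hs : ∀ a, R.s a ≠ i) (hfd : X.FinDim)
    (hd : X.dimv = Pi.single i 1) : ext0 X Y := by
  rw [ext0_iff]
  intro c
  refine ⟨0, fun a x => ?_⟩
  rw [zero_of_dimv_single hfd hd (hs a) x]; simp

lemma dead_hom {X Y : Repn k R} (hs : ∀ a, R.s a ≠ i) (hfd : X.FinDim)
    (hd : X.dimv = Pi.single i 1) (hY : Function.Surjective (totv Y i)) : homDim Y X = 0 := by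
  have : Subsingleton (Hm Y X) := by
    refine ⟨fun f g => ?_⟩
    suffices H : ∀ f : Hm Y X, f = 0 by rw [H f, H g]
    intro f
    apply Subtype.ext
    funext v
    refine LinearMap.ext fun x => ?_
    by_cases hv : v = i
    · subst hv
      obtain ⟨w, rfl⟩ := hY x
      rw [← tot_hom (mem_Hm.1 f.2)]
      have : (fun a => f.1 (R.s a) (w a)) = 0 := by
        funext a; exact zero_of_dimv_single hfd hd (hs a) _
      rw [this, map_zero]; rfl
    · exact zero_of_dimv_single hfd hd hv _
  exact Module.finrank_zero_of_subsingleton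

lemma dead_iso {X Y : Repn k R} (hs : ∀ a, R.s a ≠ i) (hfd : X.FinDim) (hfd' : Y.FinDim)
    (hd : X.dimv = Pi.single i 1) (hd' : Y.dimv = Pi.single i 1) : IsoP X Y := by
  have h : ∀ v, Nonempty (X.space v ≃ₗ[k] Y.space v) := fun v => by
    have := hfd v
    have := hfd' v
    exact FiniteDimensional.nonempty_linearEquiv_of_finrank_eq
      ((congrFun hd v).trans (congrFun hd' v).symm)
  exact ⟨⟨fun v => (h v).some, fun a x => by
    rw [zero_of_dimv_single hfd hd (hs a) x]; simp⟩⟩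

end HP

set_option linter.all false

namespace HP
open Repn

section comb

lemma sum_update_mul {V : Type} [Fintype V] [DecidableEq V] (d e : V → ℤ) (i : V) (x y : ℤ) :
    ∑ v, Function.update d i x v * Function.update e i y v
      = (∑ v, d v * e v) + (x * y - d i * e i) := by
  rw [← Finset.add_sum_erase _ _ (Finset.mem_univ i),
    ← Finset.add_sum_erase Finset.univ (fun v => d v * e v) (Finset.mem_univ i)]
  have : ∑ v ∈ Finset.univ.erase i, Function.update d i x v * Function.update e i y v =
      ∑ v ∈ Finset.univ.erase i, d v * e v := by
    refine Finset.sum_congr rfl fun v hv => ?_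
    have := Finset.ne_of_mem_erase hv
    rw [Function.update_of_ne this, Function.update_of_ne this]
  rw [this]
  simp
  ring

variable {R : QuiverData} {i : R.V} {s t : R.A → R.V}

lemma euler_refl (D : RData R i s t) (d e : R.V → ℤ) :
    eulerZ (mkQ R s t) (sr R i d) (sr R i e) = eulerZ R d e := by
  have hS : ∀ d : R.V → ℤ, sr R i d = Function.update d i ((∑ a, if R.t a = i then d (R.s a) else 0) - d i) := by
    intro d
    unfold sr
    congr 2
    refine Finset.sum_congr rfl fun a _ => ?_
    rw [if_neg (D.sink a), add_zero]
  have h1 : ∑ v, sr R i d v * sr R i e v = (∑ v, d v * e v) +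
      (((∑ a, if R.t a = i then d (R.s a) else 0) - d i) *
        ((∑ a, if R.t a = i then e (R.s a) else 0) - e i) - d i * e i) := by
    rw [hS, hS]
    exact sum_update_mul d e i _ _
  have h2 : ∑ a, sr R i d (s a) * sr R i e (t a) = (∑ a, d (R.s a) * e (R.t a)) +
      ((sr R i d i) * (∑ a, if R.t a = i then e (R.s a) else 0) -
        (∑ a, if R.t a = i then d (R.s a) else 0) * e i) := by
    rw [Finset.mul_sum, Finset.sum_mul, ← Finset.sum_sub_distrib, ← Finset.sum_add_distrib]
    refine Finset.sum_congr rfl fun a _ => ?_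
    have hne := D.sink a
    by_cases ha : R.t a = i
    · rw [D.s1 a ha, D.t1 a ha, if_pos ha, if_pos ha, ha]
      have : sr R i e (R.s a) = e (R.s a) := Function.update_of_ne hne _ _
      rw [this]; ring
    · rw [D.s2 a ha, D.t2 a ha, if_neg ha, if_neg ha]
      have h3 : sr R i e (R.t a) = e (R.t a) := Function.update_of_ne ha _ _
      have h4 : sr R i d (R.s a) = d (R.s a) := Function.update_of_ne hne _ _
      rw [h3, h4]; ring
  have h3 : sr R i d i = (∑ a, if R.t a = i then d (R.s a) else 0) - d i := by
    rw [hS, Function.update_self]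
  unfold eulerZ
  show (∑ v, sr R i d v * sr R i e v) - (∑ a, sr R i d (s a) * sr R i e (t a)) = _
  rw [h1, h2, h3]
  ring

lemma sr_add (R : QuiverData) (i : R.V) (d e : R.V → ℤ) : sr R i (d + e) = sr R i d + sr R i e := by
  funext v
  by_cases hv : v = i
  · subst hv
    simp only [sr, Function.update_self, Pi.add_apply]
    have : ∑ a, ((if R.t a = v then d (R.s a) + e (R.s a) else 0) +
        (if R.s a = v then d (R.t a) + e (R.t a) else 0)) =
      (∑ a, ((if R.t a = v then d (R.s a) else 0) + (if R.s a = v then d (R.t a) else 0))) +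
      ∑ a, ((if R.t a = v then e (R.s a) else 0) + (if R.s a = v then e (R.t a) else 0)) := by
      rw [← Finset.sum_add_distrib]
      refine Finset.sum_congr rfl fun a _ => ?_
      split_ifs <;> ring
    rw [this]; ring
  · simp [sr, Function.update_of_ne hv]

def Flip (Q : QuiverData) (s t : Q.A → Q.V) : Prop :=
  ∀ a, (s a = Q.s a ∧ t a = Q.t a) ∨ (s a = Q.t a ∧ t a = Q.s a)

lemma sr_flip {Q : QuiverData} {s t : Q.A → Q.V} (h : Flip Q s t) (i : Q.V) (d : Q.V → ℤ) :
    sr (mkQ Q s t) i d = sr Q i d := by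
  unfold sr
  congr 2
  refine Finset.sum_congr rfl fun a _ => ?_
  show (if t a = i then d (s a) else 0) + (if s a = i then d (t a) else 0) = _
  rcases h a with ⟨h1, h2⟩ | ⟨h1, h2⟩
  · rw [h1, h2]
  · rw [h1, h2]; ring

lemma tits_flip {Q : QuiverData} {s t : Q.A → Q.V} (h : Flip Q s t) (d : Q.V → ℤ) :
    titsZ (mkQ Q s t) d = titsZ Q d := by
  unfold titsZ eulerZ
  congr 1
  refine Finset.sum_congr rfl fun a _ => ?_
  show d (s a) * d (t a) = _
  rcases h a with ⟨h1, h2⟩ | ⟨h1, h2⟩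
  · rw [h1, h2]
  · rw [h1, h2]; ring

def PD (Q : QuiverData) : Prop := ∀ d : Q.V → ℤ, d ≠ 0 → 0 < titsZ Q d

lemma PD.nonneg {Q : QuiverData} (h : PD Q) (d : Q.V → ℤ) : 0 ≤ titsZ Q d := by
  by_cases hd : d = 0
  · subst hd; simp [titsZ, eulerZ]
  · exact (h d hd).le

variable {Q : QuiverData}

/-- the symmetric form against a coordinate vector -/
def gr (Q : QuiverData) (v : Q.V) (d : Q.V → ℤ) : ℤ :=
  2 * d v - ∑ a, ((if Q.t a = v then d (Q.s a) else 0) + (if Q.s a = v then d (Q.t a) else 0))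

lemma tits_gr (d : Q.V → ℤ) : 2 * titsZ Q d = ∑ v, d v * gr Q v d := by
  unfold titsZ eulerZ gr
  simp only [mul_sub, Finset.sum_sub_distrib, Finset.mul_sum]
  congr 1
  · exact Finset.sum_congr rfl fun v _ => by ring
  · rw [Finset.sum_comm]
    refine Finset.sum_congr rfl fun a _ => ?_
    simp only [mul_add, Finset.sum_add_distrib, mul_ite, mul_zero]
    rw [Finset.sum_ite_eq, Finset.sum_ite_eq]
    simp only [Finset.mem_univ, if_true]
    ring

lemma tits_add (d e : Q.V → ℤ) : titsZ Q (d + e) = titsZ Q d + titsZ Q e + (eulerZ Q d e + eulerZ Q e d) := by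
  unfold titsZ eulerZ
  simp only [Pi.add_apply]
  have h1 : ∑ v, (d v + e v) * (d v + e v) = ∑ v, d v * d v + ∑ v, e v * e v + (∑ v, d v * e v + ∑ v, e v * d v) := by
    simp only [← Finset.sum_add_distrib]
    exact Finset.sum_congr rfl fun v _ => by ring
  have h2 : ∑ a, (d (Q.s a) + e (Q.s a)) * (d (Q.t a) + e (Q.t a)) = ∑ a, d (Q.s a) * d (Q.t a) + ∑ a, e (Q.s a) * e (Q.t a) + (∑ a, d (Q.s a) * e (Q.t a) + ∑ a, e (Q.s a) * d (Q.t a)) := by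
    simp only [← Finset.sum_add_distrib]
    exact Finset.sum_congr rfl fun v _ => by ring
  rw [h1, h2]
  ring

lemma euler_single (d : Q.V → ℤ) (v : Q.V) :
    eulerZ Q d (Pi.single v 1) + eulerZ Q (Pi.single v 1) d = gr Q v d := by
  unfold eulerZ gr
  simp only [Pi.single_apply, mul_ite, mul_one, mul_zero, ite_mul, one_mul, zero_mul,
    Finset.sum_ite_eq', Finset.mem_univ, if_true, Finset.sum_add_distrib]
  ring

lemma euler_neg_right (d e : Q.V → ℤ) : eulerZ Q d (-e) = - eulerZ Q d e := by
  unfold eulerZ; simp [Finset.sum_neg_distrib]; ring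
lemma euler_neg_left (d e : Q.V → ℤ) : eulerZ Q (-d) e = - eulerZ Q d e := by
  unfold eulerZ; simp [Finset.sum_neg_distrib]; ring

lemma gr_bound (h : PD Q) (d : Q.V → ℤ) (v : Q.V) :
    |gr Q v d| ≤ titsZ Q d + titsZ Q (Pi.single v 1) := by
  have h1 := h.nonneg (d + Pi.single v 1)
  have h2 := h.nonneg (d + - Pi.single v 1)
  rw [tits_add, euler_single] at h1
  rw [tits_add, euler_neg_right, euler_neg_left, ← neg_add, euler_single] at h2
  have h3 : titsZ Q (-Pi.single v 1) = titsZ Q (Pi.single v 1) := by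
    unfold titsZ; rw [euler_neg_right, euler_neg_left, neg_neg]
  rw [h3] at h2
  rw [abs_le]; constructor <;> linarith

lemma tits_bound (h : PD Q) (c : ℤ) : ∃ K : ℤ, ∀ d : Q.V → ℤ, titsZ Q d = c → ∀ v, |d v| ≤ K := by
  let G : Matrix Q.V Q.V ℤ := Matrix.of fun v u => gr Q v (Pi.single u 1)
  have hG : ∀ d v, (G.mulVec d) v = gr Q v d := by
    intro d v
    have : ∀ u, gr Q v (Pi.single u 1) * d u = (if v = u then 2 * d v else 0) -
        ∑ a, ((if Q.t a = v then (if Q.s a = u then d (Q.s a) else 0) else 0) +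
          (if Q.s a = v then (if Q.t a = u then d (Q.t a) else 0) else 0)) := by
      intro u
      unfold gr
      rw [sub_mul, Finset.sum_mul]
      congr 1
      · simp only [Pi.single_apply]; split_ifs with h <;> simp [h] <;> try ring
      · refine Finset.sum_congr rfl fun a _ => ?_
        simp only [Pi.single_apply]
        split_ifs <;> simp_all <;> try ring
    simp only [Matrix.mulVec, dotProduct, G, Matrix.of_apply, this]
    rw [Finset.sum_sub_distrib, Finset.sum_comm]
    unfold gr
    congr 1
    · simp
    · refine Finset.sum_congr rfl fun a _ => ?_
      rw [Finset.sum_add_distrib]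
      congr 1
      · by_cases h : Q.t a = v <;> simp [h]
      · by_cases h : Q.s a = v <;> simp [h]
  have hdet : G.det ≠ 0 := by
    intro h0
    obtain ⟨d, hd, hd0⟩ := Matrix.exists_mulVec_eq_zero_iff.2 h0
    have h1 := h d hd
    have h2 := tits_gr d
    have h3 : ∀ v, gr Q v d = 0 := fun v => by rw [← hG, hd0]; rfl
    simp only [h3, mul_zero, Finset.sum_const_zero] at h2
    omega
  refine ⟨∑ v, ∑ u, |G.adjugate v u| * (c + titsZ Q (Pi.single u 1)), fun d hd v => ?_⟩
  have h1 : G.det * d v = ∑ u, G.adjugate v u * gr Q u d := by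
    have h2 : (G.adjugate * G).mulVec d = (G.det • (1 : Matrix Q.V Q.V ℤ)).mulVec d := by
      rw [Matrix.adjugate_mul]
    rw [← Matrix.mulVec_mulVec] at h2
    have h3 := congrFun h2 v
    rw [Matrix.smul_mulVec, Matrix.one_mulVec] at h3
    have h4 : (G.det • d) v = G.det * d v := rfl
    rw [← h4, ← h3]
    simp only [Matrix.mulVec, dotProduct]
    refine Finset.sum_congr rfl fun u _ => ?_
    rw [← hG]; rfl
  have hnn : ∀ u, 0 ≤ c + titsZ Q (Pi.single u 1) := fun u => by
    rw [← hd]; exact add_nonneg (h.nonneg _) (h.nonneg _)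
  have h2 : |d v| ≤ |G.det * d v| := by
    rw [abs_mul]
    have : 1 ≤ |G.det| := Int.one_le_abs hdet
    nlinarith [abs_nonneg (d v)]
  refine h2.trans ?_
  rw [h1]
  refine (Finset.abs_sum_le_sum_abs _ _).trans ?_
  refine le_trans (b := ∑ u, |G.adjugate v u| * (c + titsZ Q (Pi.single u 1))) ?_ ?_
  · refine Finset.sum_le_sum fun u _ => ?_
    rw [abs_mul, ← hd]
    exact mul_le_mul_of_nonneg_left (gr_bound h d u) (abs_nonneg _)
  · exact Finset.single_le_sum (f := fun v => ∑ u, |G.adjugate v u| * (c + titsZ Q (Pi.single u 1)))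
      (fun v _ => Finset.sum_nonneg fun u _ => mul_nonneg (abs_nonneg _) (hnn u)) (Finset.mem_univ v)

/-- acyclicity -/
lemma PD.acyclic (h : PD Q) : ∃ f : Q.V → ℕ, Function.Injective f ∧ ∀ a, f (Q.t a) < f (Q.s a) := by
  classical
  let r : Q.V → Q.V → Prop := fun u v => ∃ a, Q.s a = v ∧ Q.t a = u
  have wf : WellFounded r := by
    rw [WellFounded.wellFounded_iff_has_min]
    intro S hS
    by_contra hcon
    push Not at hcon
    have hch : ∀ v : S, ∃ a, Q.s a = v.1 ∧ Q.t a ∈ S := by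
      rintro ⟨v, hv⟩
      obtain ⟨x, hx, a, h1, h2⟩ := hcon v hv
      exact ⟨a, h1, h2 ▸ hx⟩
    choose A hA1 hA2 using hch
    let d : Q.V → ℤ := fun v => if v ∈ S then 1 else 0
    have hd : d ≠ 0 := by
      obtain ⟨v, hv⟩ := hS
      intro h0
      have := congrFun h0 v
      simp [d, hv] at this
    have h1 := h d hd
    unfold titsZ eulerZ at h1
    have hinj : Function.Injective A := fun u v huv => Subtype.ext (by rw [← hA1 u, ← hA1 v, huv])
    have h2 : ∑ v, d v * d v = ∑ v : S, (1 : ℤ) := by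
      have : ∀ v, d v * d v = if v ∈ S then 1 else 0 := fun v => by simp [d]
      simp only [this]
      rw [← Finset.sum_filter]
      exact (Finset.sum_subtype (Finset.univ.filter fun v => v ∈ S) (by simp) (fun _ => (1 : ℤ)))
    have h3 : ∑ v : S, (1 : ℤ) ≤ ∑ a, d (Q.s a) * d (Q.t a) := by
      calc ∑ v : S, (1 : ℤ) = ∑ v : S, d (Q.s (A v)) * d (Q.t (A v)) := by
            refine Finset.sum_congr rfl fun v _ => ?_
            simp [d, hA1, hA2]
        _ = ∑ a ∈ Finset.univ.map ⟨A, hinj⟩, d (Q.s a) * d (Q.t a) := by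
            rw [Finset.sum_map]; rfl
        _ ≤ _ := by
            refine Finset.sum_le_sum_of_subset_of_nonneg (Finset.subset_univ _) fun a _ _ => ?_
            simp only [d]; split_ifs <;> simp
    linarith
  have wft := wf.transGen
  let ht : Q.V → ℕ := fun v => (Finset.univ.filter fun u => Relation.TransGen r u v).card
  have hlt : ∀ a, ht (Q.t a) < ht (Q.s a) := by
    intro a
    apply Finset.card_lt_card
    rw [Finset.ssubset_iff_of_subset]
    · refine ⟨Q.t a, ?_, ?_⟩
      · simp only [Finset.mem_filter, Finset.mem_univ, true_and]
        exact Relation.TransGen.single ⟨a, rfl, rfl⟩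
      · simp only [Finset.mem_filter, Finset.mem_univ, true_and]
        exact fun h => wft.irrefl.irrefl _ h
    · intro u hu
      simp only [Finset.mem_filter, Finset.mem_univ, true_and] at *
      exact hu.tail ⟨a, rfl, rfl⟩
  let n := Fintype.card Q.V
  let ix := Fintype.equivFin Q.V
  refine ⟨fun v => ht v * (n + 1) + (ix v : ℕ), ?_, ?_⟩
  · intro u v huv
    have hu : (ix u : ℕ) < n + 1 := (ix u).2.trans (Nat.lt_succ_self _)
    have hv : (ix v : ℕ) < n + 1 := (ix v).2.trans (Nat.lt_succ_self _)
    have h1 := congrArg (· % (n + 1)) huv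
    simp only [Nat.mul_add_mod_of_lt hu, Nat.mul_add_mod_of_lt hv] at h1
    apply ix.injective
    apply Fin.ext
    exact h1
  · intro a
    have h1 := hlt a
    have hu : (ix (Q.t a) : ℕ) < n + 1 := (ix (Q.t a)).2.trans (Nat.lt_succ_self _)
    show ht (Q.t a) * (n + 1) + _ < ht (Q.s a) * (n + 1) + _
    nlinarith

end comb
end HP

set_option linter.all false

namespace HP
open Repn

/-- iterated reflections -/
def Dg (Q : QuiverData) (sq : ℕ → Q.V) : ℕ → ℕ → (Q.V → ℤ) → (Q.V → ℤ)
  | _, 0, d => d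
  | m, j+1, d => Dg Q sq (m+1) j (sr Q (sq m) d)

structure SeqD (Q : QuiverData) where
  sq : ℕ → Q.V
  σ : ℕ → Q.A → Q.V
  τ : ℕ → Q.A → Q.V
  flip : ∀ m, Flip Q (σ m) (τ m)
  h0s : σ 0 = Q.s
  h0t : τ 0 = Q.t
  rd : ∀ m, RData (mkQ Q (σ m) (τ m)) (sq m) (σ (m+1)) (τ (m+1))
  term : ∀ x : Q.V → ℤ, (∀ j v, 0 ≤ Dg Q sq 0 j x v) → x = 0

section
variable {Q : QuiverData} {sq : ℕ → Q.V}

lemma Dg_succ (m j : ℕ) (d : Q.V → ℤ) : Dg Q sq m (j+1) d = sr Q (sq (m+j)) (Dg Q sq m j d) := by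
  induction j generalizing m d with
  | zero => rfl
  | succ j ih =>
    show Dg Q sq (m+1) (j+1) _ = _
    rw [ih, show m + 1 + j = m + (j+1) by ring]
    rfl

lemma Dg_addv (m j : ℕ) (d e : Q.V → ℤ) : Dg Q sq m j (d + e) = Dg Q sq m j d + Dg Q sq m j e := by
  induction j with
  | zero => rfl
  | succ j ih => rw [Dg_succ, Dg_succ, Dg_succ, ih, sr_add]

lemma Dg_sum (m j : ℕ) {ι : Type} (s : Finset ι) (f : ι → Q.V → ℤ) :
    Dg Q sq m j (∑ p ∈ s, f p) = ∑ p ∈ s, Dg Q sq m j (f p) :=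
  map_sum (AddMonoidHom.mk' (Dg Q sq m j) (Dg_addv m j)) f s

lemma Dg_comp (j l : ℕ) (d : Q.V → ℤ) : Dg Q sq 0 (j + l) d = Dg Q sq j l (Dg Q sq 0 j d) := by
  induction l with
  | zero => rfl
  | succ l ih => rw [← add_assoc, Dg_succ, Dg_succ, ih, zero_add]

lemma Dg_shift (n : ℕ) (hp : ∀ m, sq (m + n) = sq m) (p l : ℕ) (d : Q.V → ℤ) :
    Dg Q sq (n * p) l d = Dg Q sq 0 l d := by
  have h : ∀ m, sq (n * p + m) = sq m := by
    intro m
    induction p with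
    | zero => simp
    | succ p ih => rw [show n * (p+1) + m = (n * p + m) + n by ring, hp, ih]
  induction l with
  | zero => rfl
  | succ l ih => rw [Dg_succ, Dg_succ, ih, h, zero_add]

lemma sr_ne {i u : Q.V} (h : u ≠ i) (d : Q.V → ℤ) : sr Q i d u = d u :=
  Function.update_of_ne h _ _

lemma term_aux (hQ : PD Q) (n : ℕ) (ρ : Q.V ≃ Fin n) (hn : 0 < n)
    (hsq : ∀ m, (ρ (sq m) : ℕ) = m % n)
    (htits : ∀ m d, titsZ Q (sr Q (sq m) d) = titsZ Q d)
    (x : Q.V → ℤ) (hx : ∀ j v, 0 ≤ Dg Q sq 0 j x v) : x = 0 := by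
  have hp : ∀ m, sq (m + n) = sq m := fun m => ρ.injective (Fin.ext (by simp [hsq]))
  have hT : ∀ j, titsZ Q (Dg Q sq 0 j x) = titsZ Q x := by
    intro j
    induction j with
    | zero => rfl
    | succ j ih => rw [Dg_succ, htits, ih]
  have hfix : ∀ y, Dg Q sq 0 n y = y → y = 0 := by
    intro y hy
    have hj : ∀ j, j ≤ n → Dg Q sq 0 j y = y := by
      intro j hj
      funext u
      rcases Nat.lt_or_ge (ρ u) j with h | h
      · have : ∀ l, j ≤ l → l ≤ n → Dg Q sq 0 l y u = Dg Q sq 0 j y u := by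
          intro l hl
          induction l, hl using Nat.le_induction with
          | base => intro _; rfl
          | succ l hl ih =>
            intro hln
            rw [Dg_succ, sr_ne, ih (by omega)]
            intro he
            have := hsq (0 + l)
            rw [← he, zero_add, Nat.mod_eq_of_lt (by omega)] at this
            omega
        rw [← this n hj le_rfl, hy]
      · have : ∀ l, l ≤ (ρ u : ℕ) → Dg Q sq 0 l y u = y u := by
          intro l
          induction l with
          | zero => intro _; rfl
          | succ l ih =>
            intro hl
            rw [Dg_succ, sr_ne, ih (by omega)]
            intro he
            have := hsq (0 + l)
            rw [← he, zero_add, Nat.mod_eq_of_lt (by have := (ρ u).2; omega)] at this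
            omega
        exact this j h
    have hg : ∀ v, gr Q v y = 0 := by
      intro v
      have h1 : sq (ρ v) = v := ρ.injective (Fin.ext (by rw [hsq, Nat.mod_eq_of_lt (ρ v).2]))
      have h2 : sr Q v y = y := by
        have := hj (ρ v + 1) (ρ v).2
        rw [Dg_succ, hj _ (ρ v).2.le, zero_add, h1] at this
        exact this
      have h3 := congrFun h2 v
      unfold sr at h3
      rw [Function.update_self] at h3
      unfold gr
      omega
    by_contra hne
    have h1 := hQ y hne
    have h2 := tits_gr y
    simp only [hg, mul_zero, Finset.sum_const_zero] at h2
    omega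
  obtain ⟨K, hK⟩ := tits_bound hQ (titsZ Q x)
  have hfin : {d : Q.V → ℤ | titsZ Q d = titsZ Q x}.Finite := by
    refine (Set.finite_Icc (fun _ => -K) (fun _ => K)).subset fun d hd => ?_
    have := hK d hd
    exact ⟨fun v => (abs_le.1 (this v)).1, fun v => (abs_le.1 (this v)).2⟩
  obtain ⟨j, l, hjl, he⟩ := hfin.exists_lt_map_eq_of_forall_mem
    (f := fun p : ℕ => Dg Q sq 0 (n * p) x) (fun p => hT _)
  have hstep : ∀ p, Dg Q sq 0 n (Dg Q sq 0 (n * p) x) = Dg Q sq 0 (n * (p+1)) x := by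
    intro p
    rw [mul_add, mul_one, Dg_comp, Dg_shift n hp]
  have hy := hfix (∑ p ∈ Finset.Ico j l, Dg Q sq 0 (n * p) x) (by
    rw [Dg_sum, Finset.sum_congr rfl fun p _ => hstep p]
    have h1 := Finset.sum_Ico_add' (fun p => Dg Q sq 0 (n * p) x) j l 1
    rw [h1]
    have h2 := Finset.sum_Ico_succ_top hjl.le (fun p => Dg Q sq 0 (n * p) x)
    have h3 := Finset.sum_eq_sum_Ico_succ_bot (show j < l + 1 by omega) (fun p => Dg Q sq 0 (n * p) x)
    rw [h2] at h3
    have he' : Dg Q sq 0 (n * j) x = Dg Q sq 0 (n * l) x := he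
    rw [he', add_comm] at h3
    exact (add_left_cancel h3).symm)
  have h0 : Dg Q sq 0 (n * j) x = 0 := by
    funext v
    have h1 := congrFun hy v
    rw [Finset.sum_apply] at h1
    exact (Finset.sum_eq_zero_iff_of_nonneg (fun p _ => hx (n * p) v)).1 h1 j
      (Finset.mem_Ico.2 ⟨le_rfl, hjl⟩)
  have h1 := hT (n * j)
  rw [h0] at h1
  by_contra hne
  have h2 := hQ x hne
  rw [← h1] at h2
  simp [titsZ, eulerZ] at h2

end

lemma exists_seqD {Q : QuiverData} (hQ : PD Q) [Nonempty Q.V] : Nonempty (SeqD Q) := by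
  obtain ⟨f, hf, hlt⟩ := hQ.acyclic
  letI := LinearOrder.lift' f hf
  let n := Fintype.card Q.V
  have hn : 0 < n := Fintype.card_pos
  let ρ : Q.V ≃o Fin n := (Fintype.orderIsoFinOfCardEq Q.V rfl).symm
  have hρ : ∀ a, (ρ (Q.t a) : ℕ) < ρ (Q.s a) := by
    intro a
    have : Q.t a < Q.s a := hlt a
    exact (ρ.lt_iff_lt.2 this)
  have inj : ∀ u v : Q.V, u = v ↔ (ρ u : ℕ) = ρ v := fun u v =>
    ⟨fun h => by rw [h], fun h => ρ.injective (Fin.ext h)⟩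
  let sq : ℕ → Q.V := fun m => ρ.symm ⟨m % n, Nat.mod_lt _ hn⟩
  have hsq : ∀ m, (ρ (sq m) : ℕ) = m % n := fun m => by simp [sq]
  let σ : ℕ → Q.A → Q.V := fun m a =>
    if (ρ (Q.t a) : ℕ) < m % n ∧ m % n ≤ ρ (Q.s a) then Q.t a else Q.s a
  let τ : ℕ → Q.A → Q.V := fun m a =>
    if (ρ (Q.t a) : ℕ) < m % n ∧ m % n ≤ ρ (Q.s a) then Q.s a else Q.t a
  have hflip : ∀ m, Flip Q (σ m) (τ m) := by
    intro m a
    simp only [σ, τ]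
    split_ifs <;> simp
  have hmod : ∀ m, (m+1) % n = m % n + 1 ∨ (m % n + 1 = n ∧ (m+1) % n = 0) := by
    intro m
    have := Nat.mod_lt m hn
    rcases Nat.lt_or_ge (m % n + 1) n with h | h
    · left; rw [Nat.add_mod_eq_ite]; 
      have : 1 % n = 1 := Nat.mod_eq_of_lt (by omega)
      rw [this, if_neg (by omega)]
    · right
      have h1 : m % n + 1 = n := by omega
      refine ⟨h1, ?_⟩
      rw [← Nat.mod_add_mod, h1, Nat.mod_self]
  have hrd : ∀ m, RData (mkQ Q (σ m) (τ m)) (sq m) (σ (m+1)) (τ (m+1)) := by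
    intro m
    have hm := hmod m
    have hm' := Nat.mod_lt m hn
    constructor
    · intro a
      show σ m a ≠ sq m
      rw [Ne, inj, hsq]
      have := hρ a
      simp only [σ]
      split_ifs <;> omega
    · intro a
      show τ m a = sq m → σ (m+1) a = sq m
      rw [inj, inj, hsq]
      have := hρ a
      have := (ρ (Q.s a)).2
      simp only [σ, τ]
      split_ifs <;> omega
    · intro a
      show τ m a = sq m → τ (m+1) a = σ m a
      rw [inj, inj, hsq]
      have := hρ a
      have := (ρ (Q.s a)).2
      simp only [σ, τ]
      split_ifs <;> omega
    · intro a
      show τ m a ≠ sq m → σ (m+1) a = σ m a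
      rw [Ne, inj, inj, hsq]
      have := hρ a
      have := (ρ (Q.s a)).2
      simp only [σ, τ]
      split_ifs <;> omega
    · intro a
      show τ m a ≠ sq m → τ (m+1) a = τ m a
      rw [Ne, inj, inj, hsq]
      have := hρ a
      have := (ρ (Q.s a)).2
      simp only [σ, τ]
      split_ifs <;> omega
  refine ⟨⟨sq, σ, τ, hflip, ?_, ?_, hrd, ?_⟩⟩
  · funext a; simp [σ]
  · funext a; simp [τ]
  · refine term_aux hQ n ρ.toEquiv hn hsq ?_
    intro m d
    have h1 := euler_refl (hrd m) d d
    have h2 := tits_flip (hflip (m+1)) (sr Q (sq m) d)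
    have h3 := tits_flip (hflip m) d
    rw [sr_flip (hflip m)] at h1
    rw [← h2, ← h3]
    exact h1

end HP

set_option linter.all false

namespace HP
open Repn

inductive TauIs {Q : QuiverData} (S : SeqD Q) : ℕ → (Q.V → ℤ) → ℕ → Prop
  | now (m : ℕ) (d : Q.V → ℤ) (h : d = Pi.single (S.sq m) 1) : TauIs S m d 0
  | later (m j : ℕ) (d : Q.V → ℤ) (h : d ≠ Pi.single (S.sq m) 1)
      (h' : TauIs S (m+1) (sr Q (S.sq m) d) j) : TauIs S m d (j+1)

section
variable {k : Type} [Field k] {Q : QuiverData} (S : SeqD Q)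

@[reducible] def St (m : ℕ) : QuiverData := mkQ Q (S.σ m) (S.τ m)

variable {S}

lemma TauIs.zero_iff {m : ℕ} {d : Q.V → ℤ} : TauIs S m d 0 ↔ d = Pi.single (S.sq m) 1 :=
  ⟨fun h => by cases h; assumption, fun h => .now _ _ h⟩

lemma TauIs.succ_iff {m j : ℕ} {d : Q.V → ℤ} : TauIs S m d (j+1) ↔
    d ≠ Pi.single (S.sq m) 1 ∧ TauIs S (m+1) (sr Q (S.sq m) d) j :=
  ⟨fun h => by cases h; exact ⟨by assumption, by assumption⟩, fun h => .later _ _ _ h.1 h.2⟩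

lemma TauIs.unique {m j l : ℕ} {d : Q.V → ℤ} (h : TauIs S m d j) (h' : TauIs S m d l) : j = l := by
  induction j generalizing m d l with
  | zero =>
    cases l with
    | zero => rfl
    | succ l => exact absurd (TauIs.zero_iff.1 h) (TauIs.succ_iff.1 h').1
  | succ j ih =>
    cases l with
    | zero => exact absurd (TauIs.zero_iff.1 h') (TauIs.succ_iff.1 h).1
    | succ l => rw [ih (TauIs.succ_iff.1 h).2 (TauIs.succ_iff.1 h').2]

lemma natc_inj {Q : QuiverData} {d e : Q.V → ℕ} (h : natc (Q := Q) d = natc e) : d = e := by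
  funext v
  have := congrFun h v
  simpa [natc] using this

lemma natc_single {Q : QuiverData} (i : Q.V) : natc (Q := Q) (Pi.single i 1) = Pi.single i 1 := by
  funext v
  by_cases h : v = i
  · subst h; simp [natc]
  · simp [natc, h]

@[reducible] noncomputable def rS (S : SeqD Q) (m : ℕ) (Y : Repn k (St S m)) : Repn k (St S (m+1)) :=
  rfl' (R := St S m) (S.rd m) Y

/-- one reflection step for a live indecomposable -/
lemma live_step {m : ℕ} {Y : Repn k (St S m)} (h : Y.Indec) (hf : Y.FinDim)
    (hd : natc (Q := Q) Y.dimv ≠ Pi.single (S.sq m) 1) :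
    Function.Surjective (totv Y (S.sq m)) ∧
    Indec (rS S m Y) ∧ FinDim (rS S m Y) ∧
    natc (Q := Q) (rS S m Y).dimv = sr Q (S.sq m) (natc (Q := Q) Y.dimv) := by
  have hs : Function.Surjective (totv Y (S.sq m)) := by
    refine indec_surj (S.rd m).sink h hf fun he => hd ?_
    rw [he]; exact natc_single (Q := St S m) _
  refine ⟨hs, rfl_indec (S.rd m) hs h, finDim_rfl (S.rd m) hf, ?_⟩
  have := dimv_rfl (S.rd m) hf hs
  rw [sr_flip (S.flip m)] at this
  exact this

lemma dead_dimv {m : ℕ} {Y : Repn k (St S m)}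
    (hd : natc (Q := Q) Y.dimv = Pi.single (S.sq m) 1) : Y.dimv = Pi.single (S.sq m) 1 := by
  apply natc_inj (Q := St S m)
  rw [natc_single (Q := St S m)]
  exact hd

lemma tau_iso {m j : ℕ} {Y Z : Repn k (St S m)} (hY : Y.Indec) (fY : Y.FinDim) (hZ : Z.Indec)
    (fZ : Z.FinDim) (tY : TauIs S m (natc (Q := Q) Y.dimv) j)
    (tZ : TauIs S m (natc (Q := Q) Z.dimv) j) : IsoP Y Z := by
  induction j generalizing m with
  | zero =>
    exact dead_iso (S.rd m).sink fY fZ (dead_dimv (TauIs.zero_iff.1 tY)) (dead_dimv (TauIs.zero_iff.1 tZ))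
  | succ j ih =>
    obtain ⟨n1, t1⟩ := TauIs.succ_iff.1 tY
    obtain ⟨n2, t2⟩ := TauIs.succ_iff.1 tZ
    obtain ⟨a1, a2, a3, a4⟩ := live_step hY fY n1
    obtain ⟨b1, b2, b3, b4⟩ := live_step hZ fZ n2
    rw [← a4] at t1
    rw [← b4] at t2
    exact rfl_iso (S.rd m) a1 b1 (ih a2 a3 b2 b3 t1 t2)

lemma tau_ext0 {m j l : ℕ} {Y Z : Repn k (St S m)} (hY : Y.Indec) (fY : Y.FinDim) (hZ : Z.Indec)
    (fZ : Z.FinDim) (tY : TauIs S m (natc (Q := Q) Y.dimv) j)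
    (tZ : TauIs S m (natc (Q := Q) Z.dimv) l) (hjl : j ≤ l) : ext0 Y Z := by
  induction j generalizing m l with
  | zero =>
    exact dead_ext0 (S.rd m).sink fY (dead_dimv (TauIs.zero_iff.1 tY))
  | succ j ih =>
    obtain ⟨l, rfl⟩ : ∃ l', l = l' + 1 := ⟨l - 1, by omega⟩
    obtain ⟨n1, t1⟩ := TauIs.succ_iff.1 tY
    obtain ⟨n2, t2⟩ := TauIs.succ_iff.1 tZ
    obtain ⟨a1, a2, a3, a4⟩ := live_step hY fY n1
    obtain ⟨b1, b2, b3, b4⟩ := live_step hZ fZ n2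
    rw [← a4] at t1
    rw [← b4] at t2
    have h1 := (ext0_iff_dim a3 b3).1 (ih a2 a3 b2 b3 t1 t2 (by omega))
    rw [ext0_iff_dim fY fZ, ← rfl_homDim (S.rd m) Y Z a1]
    have h2 := euler_refl (S.rd m) (natc Y.dimv) (natc Z.dimv)
    rw [← h2, ← dimv_rfl (S.rd m) fY a1, ← dimv_rfl (S.rd m) fZ b1]
    exact h1

lemma tau_hom0 {m j l : ℕ} {Y Z : Repn k (St S m)} (hY : Y.Indec) (fY : Y.FinDim) (hZ : Z.Indec)
    (fZ : Z.FinDim) (tY : TauIs S m (natc (Q := Q) Y.dimv) j)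
    (tZ : TauIs S m (natc (Q := Q) Z.dimv) l) (hjl : j < l) : homDim Z Y = 0 := by
  induction j generalizing m l with
  | zero =>
    obtain ⟨l, rfl⟩ : ∃ l', l = l' + 1 := ⟨l - 1, by omega⟩
    obtain ⟨n2, t2⟩ := TauIs.succ_iff.1 tZ
    obtain ⟨b1, b2, b3, b4⟩ := live_step hZ fZ n2
    exact dead_hom (S.rd m).sink fY (dead_dimv (TauIs.zero_iff.1 tY)) b1
  | succ j ih =>
    obtain ⟨l, rfl⟩ : ∃ l', l = l' + 1 := ⟨l - 1, by omega⟩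
    obtain ⟨n1, t1⟩ := TauIs.succ_iff.1 tY
    obtain ⟨n2, t2⟩ := TauIs.succ_iff.1 tZ
    obtain ⟨a1, a2, a3, a4⟩ := live_step hY fY n1
    obtain ⟨b1, b2, b3, b4⟩ := live_step hZ fZ n2
    rw [← a4] at t1
    rw [← b4] at t2
    rw [← rfl_homDim (S.rd m) Z Y b1]
    exact ih a2 a3 b2 b3 t1 t2 (by omega)

lemma tau_end {m j : ℕ} {Y : Repn k (St S m)} (hY : Y.Indec) (fY : Y.FinDim)
    (tY : TauIs S m (natc (Q := Q) Y.dimv) j) : homDim Y Y = 1 := by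
  induction j generalizing m with
  | zero =>
    have hd := dead_dimv (TauIs.zero_iff.1 tY)
    have h1 := dead_ext0 (Y := Y) (S.rd m).sink fY hd
    have h2 := (ext0_iff_dim fY fY).1 h1
    rw [hd, natc_single] at h2
    have h3 : eulerZ (St S m) (Pi.single (S.sq m) 1) (Pi.single (S.sq m) 1) = 1 := by
      unfold eulerZ
      have : ∀ a, (Pi.single (S.sq m) 1 : (St S m).V → ℤ) ((St S m).s a) = 0 := fun a =>
        Pi.single_eq_of_ne ((S.rd m).sink a) _
      simp only [this]
      simp [Pi.single_apply]
    rw [h3] at h2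
    exact_mod_cast h2
  | succ j ih =>
    obtain ⟨n1, t1⟩ := TauIs.succ_iff.1 tY
    obtain ⟨a1, a2, a3, a4⟩ := live_step hY fY n1
    rw [← a4] at t1
    rw [← rfl_homDim (S.rd m) Y Y a1]
    exact ih a2 a3 t1

lemma tau_nonneg {m : ℕ} {Y : Repn k (St S m)} (hY : Y.Indec) (fY : Y.FinDim)
    (hn : ∀ j, ¬ TauIs S m (natc (Q := Q) Y.dimv) j) (j : ℕ) (v : Q.V) :
    0 ≤ Dg Q S.sq m j (natc (Q := Q) Y.dimv) v := by
  induction j generalizing m with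
  | zero => exact Int.natCast_nonneg _
  | succ j ih =>
    have n1 : natc (Q := Q) Y.dimv ≠ Pi.single (S.sq m) 1 := fun h => hn 0 (.now _ _ h)
    obtain ⟨a1, a2, a3, a4⟩ := live_step hY fY n1
    show 0 ≤ Dg Q S.sq (m+1) j _ v
    rw [← a4]
    apply ih a2 a3
    intro l hl
    rw [a4] at hl
    exact hn (l+1) (.later _ _ _ n1 hl)

lemma base (S : SeqD Q) (P : ∀ (s t : Q.A → Q.V), Prop) (h : P (S.σ 0) (S.τ 0)) : P Q.s Q.t := by
  rw [S.h0s, S.h0t] at h; exact h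

/-- the tau invariant -/
noncomputable def tau (S : SeqD Q) (d : Q.V → ℕ) : ℕ := by
  classical
  exact if h : ∃ j, TauIs S 0 (natc d) j then h.choose else 0

lemma tau_spec {Y : Repn k Q} (hY : Y.Indec) (fY : Y.FinDim) :
    TauIs S 0 (natc (Q := Q) Y.dimv) (tau S Y.dimv) := by
  have h : ∃ j, TauIs S 0 (natc Y.dimv) j := by
    have := base S (fun s t => ∀ Y : Repn k (mkQ Q s t), Y.Indec → Y.FinDim →
        ∃ j, TauIs S 0 (natc (Q := Q) Y.dimv) j) (fun Y hY fY => by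
      by_contra hcon
      push Not at hcon
      have h1 := S.term _ (tau_nonneg (S := S) (m := 0) hY fY hcon)
      apply hY.1
      rw [isZero_iff_dimv fY]
      funext v
      have := congrFun h1 v
      have h2 : ((Y.dimv v : ℕ) : ℤ) = 0 := this
      exact_mod_cast h2)
    exact this Y hY fY
  unfold tau
  rw [dif_pos h]
  exact h.choose_spec

lemma ind_iso (S : SeqD Q) {Y Z : Repn k Q} (hY : Y.Indec) (fY : Y.FinDim) (hZ : Z.Indec)
    (fZ : Z.FinDim) (h : tau S Y.dimv = tau S Z.dimv) : IsoP Y Z := by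
  have := base S (fun s t => ∀ Y Z : Repn k (mkQ Q s t), Y.Indec → Y.FinDim → Z.Indec → Z.FinDim →
    ∀ j, TauIs S 0 (natc (Q := Q) Y.dimv) j → TauIs S 0 (natc (Q := Q) Z.dimv) j → IsoP Y Z)
    (fun Y Z a b c d j e f => tau_iso (S := S) (m := 0) a b c d e f)
  exact this Y Z hY fY hZ fZ _ (tau_spec hY fY) (h ▸ tau_spec hZ fZ)

lemma ind_ext0 (S : SeqD Q) {Y Z : Repn k Q} (hY : Y.Indec) (fY : Y.FinDim) (hZ : Z.Indec)
    (fZ : Z.FinDim) (h : tau S Y.dimv ≤ tau S Z.dimv) : ext0 Y Z := by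
  have := base S (fun s t => ∀ Y Z : Repn k (mkQ Q s t), Y.Indec → Y.FinDim → Z.Indec → Z.FinDim →
    ∀ j l, TauIs S 0 (natc (Q := Q) Y.dimv) j → TauIs S 0 (natc (Q := Q) Z.dimv) l → j ≤ l → ext0 Y Z)
    (fun Y Z a b c d j l e f g => tau_ext0 (S := S) (m := 0) a b c d e f g)
  exact this Y Z hY fY hZ fZ _ _ (tau_spec hY fY) (tau_spec hZ fZ) h

lemma ind_hom0 (S : SeqD Q) {Y Z : Repn k Q} (hY : Y.Indec) (fY : Y.FinDim) (hZ : Z.Indec)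
    (fZ : Z.FinDim) (h : tau S Y.dimv < tau S Z.dimv) : homDim Z Y = 0 := by
  have := base S (fun s t => ∀ Y Z : Repn k (mkQ Q s t), Y.Indec → Y.FinDim → Z.Indec → Z.FinDim →
    ∀ j l, TauIs S 0 (natc (Q := Q) Y.dimv) j → TauIs S 0 (natc (Q := Q) Z.dimv) l → j < l → homDim Z Y = 0)
    (fun Y Z a b c d j l e f g => tau_hom0 (S := S) (m := 0) a b c d e f g)
  exact this Y Z hY fY hZ fZ _ _ (tau_spec hY fY) (tau_spec hZ fZ) h

lemma ind_end (S : SeqD Q) {Y : Repn k Q} (hY : Y.Indec) (fY : Y.FinDim) : homDim Y Y = 1 := by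
  have := base S (fun s t => ∀ Y : Repn k (mkQ Q s t), Y.Indec → Y.FinDim →
    ∀ j, TauIs S 0 (natc (Q := Q) Y.dimv) j → homDim Y Y = 1)
    (fun Y a b j e => tau_end (S := S) (m := 0) a b e)
  exact this Y hY fY _ (tau_spec hY fY)

lemma ind_root (S : SeqD Q) {Y : Repn k Q} (hY : Y.Indec) (fY : Y.FinDim) : IsPosRoot Q Y.dimv := by
  refine ⟨fun h => hY.1 ((isZero_iff_dimv fY).2 h), ?_⟩
  have h1 := (ext0_iff_dim fY fY).1 (ind_ext0 S hY fY hY fY le_rfl)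
  rw [ind_end S hY fY] at h1
  exact h1.symm

end
end HP

set_option linter.all false

namespace HP
open Repn

section
variable {k : Type} [Field k] {Q : QuiverData}

/-- decomposition into indecomposables, recorded by the multiset of dimension vectors -/
inductive Cls : Repn k Q → Multiset (Q.V → ℕ) → Prop
  | zero (M : Repn k Q) (h : M.IsZero) : Cls M 0
  | cons (M A B : Repn k Q) (t : Multiset (Q.V → ℕ)) (hA : A.Indec) (fA : A.FinDim)
      (h : IsoP M (A.dsum B)) (hB : Cls B t) : Cls M (A.dimv ::ₘ t)

@[reducible] def zR (k : Type) [Field k] (Q : QuiverData) : Repn k Q where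
  space _ := PUnit
  map _ := 0

lemma zR_zero : (zR k Q).IsZero := fun _ _ => rfl

lemma Cls.iso {M M' : Repn k Q} {s : Multiset (Q.V → ℕ)} (h : IsoP M M') (c : Cls M s) : Cls M' s := by
  cases c with
  | zero _ hz => exact .zero _ (h.isZero hz)
  | cons _ A B t hA fA h' hB => exact .cons _ A B t hA fA (h.symm.trans h') hB

lemma Cls.finDim {M : Repn k Q} {s : Multiset (Q.V → ℕ)} (c : Cls M s) : M.FinDim := by
  induction c with
  | zero _ hz => exact finDim_of_isZero hz
  | cons _ A B t hA fA h' hB ih => exact h'.symm.finDim (finDim_dsum fA ih)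

lemma Cls.dimv {M : Repn k Q} {s : Multiset (Q.V → ℕ)} (c : Cls M s) : M.dimv = s.sum := by
  induction c with
  | zero _ hz => rw [(isZero_iff_dimv (finDim_of_isZero hz)).1 hz]; rfl
  | cons _ A B t hA fA h' hB ih =>
    rw [h'.dimv, dimv_dsum fA hB.finDim, ih, Multiset.sum_cons]

lemma Cls.isZero {M : Repn k Q} (c : Cls M 0) : M.IsZero := by
  rw [isZero_iff_dimv c.finDim, c.dimv]; rfl

lemma Cls.single {A : Repn k Q} (hA : A.Indec) (fA : A.FinDim) : Cls A {A.dimv} :=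
  .cons A A (zR k Q) 0 hA fA (dsum_isZero_right zR_zero).symm (.zero _ zR_zero)

lemma Cls.dsum {M N : Repn k Q} {s t : Multiset (Q.V → ℕ)} (c : Cls M s) (d : Cls N t) :
    Cls (M.dsum N) (s + t) := by
  induction c with
  | zero _ hz => rw [zero_add]; exact d.iso (dsum_isZero_left hz).symm
  | cons _ A B u hA fA h' hB ih =>
    rw [Multiset.cons_add]
    exact .cons _ A (B.dsum N) _ hA fA ((h'.dsum_congr (IsoP.refl N)).trans (dsum_assoc _ _ _)) ih

open Classical in
lemma Cls.extract {M : Repn k Q} {s : Multiset (Q.V → ℕ)} (c : Cls M s) {α : Q.V → ℕ} (h : α ∈ s) :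
    ∃ A B : Repn k Q, A.Indec ∧ A.FinDim ∧ A.dimv = α ∧ IsoP M (A.dsum B) ∧ Cls B (s.erase α) := by
  induction c with
  | zero _ hz => simp at h
  | cons _ A B t hA fA h' hB ih =>
    by_cases he : A.dimv = α
    · subst he
      exact ⟨A, B, hA, fA, rfl, h', by rw [Multiset.erase_cons_head]; exact hB⟩
    · rcases Multiset.mem_cons.1 h with h1 | h1
      · exact absurd h1.symm he
      · obtain ⟨A', B', i1, i2, i3, i4, i5⟩ := ih h1
        refine ⟨A', A.dsum B', i1, i2, i3, ?_, ?_⟩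
        · exact (h'.trans ((IsoP.refl A).dsum_congr i4)).trans (dsum_left_comm _ _ _)
        · rw [Multiset.erase_cons_tail _ he]
          exact .cons _ A B' _ hA fA (IsoP.refl _) i5

lemma Cls.cons' {A B : Repn k Q} {t : Multiset (Q.V → ℕ)} (hA : A.Indec) (fA : A.FinDim)
    (c : Cls B t) : Cls (A.dsum B) (A.dimv ::ₘ t) := .cons _ A B t hA fA (IsoP.refl _) c

lemma Cls.exists {M : Repn k Q} (h : M.FinDim) : ∃ s, Cls M s := by
  induction hn : (∑ v, M.dimv v) using Nat.strong_induction_on generalizing M with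
  | _ n ih =>
    by_cases hz : M.IsZero
    · exact ⟨0, .zero _ hz⟩
    by_cases hi : M.Indec
    · exact ⟨_, .single hi h⟩
    unfold Indec at hi
    push Not at hi
    obtain ⟨Y, Z, hYZ, hY, hZ⟩ := hi hz
    have fd := IsoP.finDim hYZ h
    have fY := finDim_dsum_left fd
    have fZ := finDim_dsum_right fd
    have hd : M.dimv = Y.dimv + Z.dimv := by rw [IsoP.dimv hYZ, dimv_dsum fY fZ]
    have hp : ∀ W : Repn k Q, W.FinDim → ¬ W.IsZero → 0 < ∑ v, W.dimv v := by
      intro W fW hW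
      by_contra hc
      apply hW
      rw [isZero_iff_dimv fW]
      funext v
      have h1 : ∑ v, W.dimv v = 0 := by omega
      exact Finset.sum_eq_zero_iff.1 h1 v (Finset.mem_univ v)
    have h1 := hp Y fY hY
    have h2 := hp Z fZ hZ
    rw [hd] at hn
    simp only [Pi.add_apply, Finset.sum_add_distrib] at hn
    obtain ⟨s, cs⟩ := ih _ (by omega) fY rfl
    obtain ⟨t, ct⟩ := ih _ (by omega) fZ rfl
    exact ⟨s + t, (cs.dsum ct).iso (IsoP.symm hYZ)⟩

lemma Cls.isoP (S : SeqD Q) {M N : Repn k Q} {s : Multiset (Q.V → ℕ)} (c : Cls M s) (d : Cls N s) :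
    IsoP M N := by
  classical
  induction c generalizing N with
  | zero _ hz => exact iso_of_isZero hz d.isZero
  | cons _ A B t hA fA h' hB ih =>
    obtain ⟨A', B', i1, i2, i3, i4, i5⟩ := d.extract (Multiset.mem_cons_self _ _)
    rw [Multiset.erase_cons_head] at i5
    exact (h'.trans ((ind_iso S hA fA i1 i2 (by rw [i3])).dsum_congr (ih i5))).trans i4.symm

lemma Cls.root (S : SeqD Q) {M : Repn k Q} {s : Multiset (Q.V → ℕ)} (c : Cls M s) {α : Q.V → ℕ} (h : α ∈ s) :
    IsPosRoot Q α := by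
  classical
  obtain ⟨A, B, i1, i2, i3, i4, i5⟩ := c.extract h
  exact i3 ▸ ind_root S i1 i2

lemma tau_inj (S : SeqD Q) {A B : Repn k Q} (hA : A.Indec) (fA : A.FinDim) (hB : B.Indec) (fB : B.FinDim) :
    tau S A.dimv = tau S B.dimv ↔ A.dimv = B.dimv :=
  ⟨fun h => (ind_iso S hA fA hB fB h).dimv, fun h => by rw [h]⟩

open Classical in
lemma Cls.homDim_min (S : SeqD Q) {M A : Repn k Q} {s : Multiset (Q.V → ℕ)} (c : Cls M s)
    (hA : A.Indec) (fA : A.FinDim) (h : ∀ β ∈ s, tau S A.dimv ≤ tau S β) :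
    homDim M A = s.count A.dimv := by
  induction c with
  | zero M hz =>
    rw [Multiset.count_zero]
    have : Subsingleton (Hm M A) := ⟨fun f g => by
      apply Subtype.ext; funext v; ext x; rw [hz v x, map_zero, map_zero]⟩
    exact Module.finrank_zero_of_subsingleton
  | cons _ B C t hB fB h' hC ih =>
    rw [homDim_congr h' (IsoP.refl A), homDim_dsum_left fB hC.finDim fA,
      ih fun β hβ => h β (Multiset.mem_cons_of_mem hβ), Multiset.count_cons, add_comm]
    congr 1
    have hle := h _ (Multiset.mem_cons_self B.dimv t)
    split_ifs with he
    · rw [homDim_congr (IsoP.refl B) (ind_iso S hA fA hB fB (by rw [he]))]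
      exact ind_end S hB fB
    · refine ind_hom0 S hA fA hB fB (lt_of_le_of_ne hle fun h2 => he ?_)
      exact (tau_inj S hA fA hB fB).1 h2

lemma Cls.unique_aux (S : SeqD Q) {M N : Repn k Q} {s t : Multiset (Q.V → ℕ)} (c : Cls M s)
    (d : Cls N t) (h : ∀ A : Repn k Q, A.Indec → A.FinDim → homDim M A = homDim N A) : s = t := by
  classical
  induction hn : s.card generalizing s t M N with
  | zero =>
    have hs := Multiset.card_eq_zero.1 hn
    subst hs
    by_contra hne
    have : ∃ α ∈ t, ∀ β ∈ t, tau S α ≤ tau S β := by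
      obtain ⟨α, hα, h2⟩ := t.toFinset.exists_min_image (tau S)
        (Multiset.toFinset_nonempty.2 (Ne.symm hne))
      exact ⟨α, Multiset.mem_toFinset.1 hα, fun β hβ => h2 β (Multiset.mem_toFinset.2 hβ)⟩
    obtain ⟨α, hα, hmin⟩ := this
    obtain ⟨A, B, i1, i2, i3, i4, i5⟩ := d.extract hα
    subst i3
    have h1 := h A i1 i2
    rw [c.homDim_min S i1 i2 (by simp), d.homDim_min S i1 i2 hmin, Multiset.count_zero] at h1
    exact Multiset.count_eq_zero.1 h1.symm hα
  | succ n ih =>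
    have hs0 : s ≠ 0 := by rintro rfl; simp at hn
    obtain ⟨α, hα, hmin⟩ : ∃ α ∈ s + t, ∀ β ∈ s + t, tau S α ≤ tau S β := by
      obtain ⟨α, hα, h2⟩ := (s+t).toFinset.exists_min_image (tau S)
        (Multiset.toFinset_nonempty.2 (by intro h0; exact hs0 (by simpa using (add_eq_zero.1 h0).1)))
      exact ⟨α, Multiset.mem_toFinset.1 hα, fun β hβ => h2 β (Multiset.mem_toFinset.2 hβ)⟩
    obtain ⟨A, i1, i2, i3⟩ : ∃ A : Repn k Q, A.Indec ∧ A.FinDim ∧ A.dimv = α := by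
      rcases Multiset.mem_add.1 hα with h1 | h1
      · obtain ⟨A, B, i1, i2, i3, -⟩ := c.extract h1
        exact ⟨A, i1, i2, i3⟩
      · obtain ⟨A, B, i1, i2, i3, -⟩ := d.extract h1
        exact ⟨A, i1, i2, i3⟩
    have h1 := h A i1 i2
    subst i3
    rw [c.homDim_min S i1 i2 (fun β hβ => hmin β (Multiset.mem_add.2 (Or.inl hβ))),
      d.homDim_min S i1 i2 (fun β hβ => hmin β (Multiset.mem_add.2 (Or.inr hβ)))] at h1
    have hs : A.dimv ∈ s := by
      rcases Multiset.mem_add.1 hα with h2 | h2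
      · exact h2
      · rw [← Multiset.count_pos] at *; omega
    have ht : A.dimv ∈ t := by
      rw [← Multiset.count_pos] at *; omega
    obtain ⟨A1, B1, i1', i2', i3', i4, i5⟩ := c.extract hs
    obtain ⟨A2, B2, j1, j2, j3, j4, j5⟩ := d.extract ht
    have hAA := ind_iso S i1' i2' j1 j2 (by rw [i3', j3])
    have := ih i5 j5 (fun Y hY fY => by
      have h3 := h Y hY fY
      rw [homDim_congr i4 (IsoP.refl Y), homDim_congr j4 (IsoP.refl Y),
        homDim_dsum_left i2' i5.finDim fY, homDim_dsum_left j2 j5.finDim fY,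
        homDim_congr hAA (IsoP.refl Y)] at h3
      exact Nat.add_left_cancel h3) (by rw [Multiset.card_erase_of_mem hs, hn]; rfl)
    rw [← Multiset.cons_erase hs, this, Multiset.cons_erase ht]

lemma Cls.unique (S : SeqD Q) {M : Repn k Q} {s t : Multiset (Q.V → ℕ)} (c : Cls M s)
    (d : Cls M t) : s = t := Cls.unique_aux S c d fun _ _ _ => rfl

lemma Cls.ext0_of {M N : Repn k Q} {s : Multiset (Q.V → ℕ)} (c : Cls M s)
    (h : ∀ A B : Repn k Q, A.Indec → A.FinDim → A.dimv ∈ s → IsoP M (A.dsum B) → ext0 A N) : ext0 M N := by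
  induction c with
  | zero _ hz => exact ext0_of_isZero_left hz
  | cons _ A B t hA fA h' hB ih =>
    refine ext0_congr h'.symm (IsoP.refl N) (ext0_dsum_left.2 ⟨h A B hA fA (by simp) h', ih ?_⟩)
    intro A' B' hA' fA' hm hi
    refine h A' (A.dsum B') hA' fA' (Multiset.mem_cons_of_mem hm) ?_
    exact (h'.trans ((IsoP.refl A).dsum_congr hi)).trans (dsum_left_comm _ _ _)

lemma Cls.ext0_tau (S : SeqD Q) {A N : Repn k Q} {s : Multiset (Q.V → ℕ)} (hA : A.Indec) (fA : A.FinDim)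
    (c : Cls N s) (h : ∀ β ∈ s, tau S A.dimv ≤ tau S β) : ext0 A N := by
  induction c with
  | zero _ hz => exact ext0_of_isZero_right hz
  | cons _ B C t hB fB h' hC ih =>
    refine ext0_congr (IsoP.refl A) h'.symm (ext0_dsum_right.2 ⟨?_, ih ?_⟩)
    · exact ind_ext0 S hA fA hB fB (h _ (by simp))
    · exact fun β hβ => h β (Multiset.mem_cons_of_mem hβ)

lemma homDim_pos {Y : Repn k Q} (fY : Y.FinDim) (h : ¬ Y.IsZero) : 0 < homDim Y Y := by
  have := finite_Hm fY fY
  have : Nontrivial (Hm Y Y) := by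
    refine ⟨⟨⟨gid Y, mem_Hm.2 (isHom_gid Y)⟩, 0, fun he => h ?_⟩⟩
    intro v x
    have h1 := congrFun (congrArg Subtype.val he) v
    exact LinearMap.congr_fun h1 x
  exact Module.finrank_pos

lemma exists_indec (S : SeqD Q) (k : Type) [Field k] {α : Q.V → ℕ} (hα : IsPosRoot Q α) :
    ∃ A : Repn k Q, A.Indec ∧ A.FinDim ∧ A.dimv = α := by
  classical
  have hne : ∃ n, ∃ E : Repn k Q, E.FinDim ∧ E.dimv = α ∧ homDim E E = n := by
    refine ⟨_, { space := fun v => Fin (α v) → k, map := fun _ => 0 }, fun v => ?_, ?_, rfl⟩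
    · show Module.Finite k (Fin (α v) → k)
      infer_instance
    · funext v
      exact Module.finrank_fin_fun k
  obtain ⟨E, fE, dE, hE⟩ := Nat.find_spec hne
  have hmin : ∀ E' : Repn k Q, E'.FinDim → E'.dimv = α → homDim E E ≤ homDim E' E' := by
    intro E' f d
    rw [hE]
    exact Nat.find_min' hne ⟨E', f, d, rfl⟩
  have hsplit : ∀ A B : Repn k Q, IsoP E (A.dsum B) → ext0 A B := by
    intro A B hAB c
    by_contra hc
    have fd := hAB.finDim fE
    have fA := finDim_dsum_left fd
    have fB := finDim_dsum_right fd
    have h1 := homDim_exr_lt fA fB c (fun ⟨f, hf⟩ => hc ⟨f, hf⟩)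
    have h2 := hmin (exr A B c) (finDim_exr fA fB c) (by
      rw [dimv_exr fA fB, ← dE, hAB.dimv, dimv_dsum fA fB])
    rw [homDim_congr hAB hAB] at h2
    omega
  obtain ⟨s, cs⟩ := Cls.exists fE
  have hself : ext0 E E := by
    refine cs.ext0_of fun A B hA fA _ hi => ?_
    exact ext0_congr (IsoP.refl A) hi.symm
      (ext0_dsum_right.2 ⟨ind_ext0 S hA fA hA fA le_rfl, hsplit A B hi⟩)
  have h1 := (ext0_iff_dim fE fE).1 hself
  rw [dE] at h1
  have h2 : homDim E E = 1 := by
    have := hα.2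
    unfold titsZ at this
    rw [this] at h1
    exact_mod_cast h1
  refine ⟨E, ⟨fun hz => hα.1 (by rw [← dE]; exact (isZero_iff_dimv fE).1 hz), ?_⟩, fE, dE⟩
  intro Y Z hYZ
  by_contra hcon
  push Not at hcon
  have fd := IsoP.finDim hYZ fE
  have fY := finDim_dsum_left fd
  have fZ := finDim_dsum_right fd
  rw [homDim_congr hYZ hYZ, homDim_dsum_left fY fZ fd, homDim_dsum_right fY fZ fY,
    homDim_dsum_right fY fZ fZ] at h2
  have := homDim_pos fY hcon.1
  have := homDim_pos fZ hcon.2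
  omega

lemma Cls.of_roots (S : SeqD Q) (k : Type) [Field k] {s : Multiset (Q.V → ℕ)}
    (h : ∀ α ∈ s, IsPosRoot Q α) : ∃ M : Repn k Q, Cls M s := by
  induction s using Multiset.induction_on with
  | empty => exact ⟨zR k Q, .zero _ zR_zero⟩
  | cons α s ih =>
    obtain ⟨M, hM⟩ := ih fun β hβ => h β (Multiset.mem_cons_of_mem hβ)
    obtain ⟨A, hA, fA, rfl⟩ := exists_indec S k (h α (Multiset.mem_cons_self _ _))
    exact ⟨_, hM.cons' hA fA⟩

lemma cls_fam (ι : Type) [Fintype ι] : ∀ (Xi : ι → Repn k Q), (∀ i, (Xi i).Indec ∧ (Xi i).FinDim) →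
    Cls (dsumFam Xi) (Finset.univ.val.map fun i => (Xi i).dimv) := by
  refine Fintype.induction_empty_option
    (P := fun ι _ => ∀ (Xi : ι → Repn k Q), (∀ i, (Xi i).Indec ∧ (Xi i).FinDim) →
      Cls (dsumFam Xi) (Finset.univ.val.map fun i => (Xi i).dimv)) ?_ ?_ ?_ ι
  · intro α β _ e ih Xi hXi
    letI := Fintype.ofEquiv β e.symm
    have h1 := ih (fun i => Xi (e i)) (fun i => hXi _)
    have h2 : IsoP (dsumFam fun i => Xi (e i)) (dsumFam Xi) := by
      refine IsoP.symm ⟨isoOf (fun v => LinearMap.pi fun i => LinearMap.proj (e i)) ?_ ?_⟩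
      · intro a x; rfl
      · intro v
        constructor
        · intro x y hxy
          funext i
          have := congrFun hxy (e.symm i)
          have h3 : x (e (e.symm i)) = y (e (e.symm i)) := this
          rw [e.apply_symm_apply] at h3
          exact h3
        · intro y
          refine ⟨fun i => cast (congrArg (fun i => (Xi i).space v) (e.apply_symm_apply i)) (y (e.symm i)), ?_⟩
          funext i
          show cast _ (y (e.symm (e i))) = y i
          apply eq_of_heq
          refine (cast_heq _ _).trans ?_
          rw [e.symm_apply_apply]
    refine Cls.iso h2 ?_
    convert h1 using 1
    have : (Finset.univ : Finset β).val = (Finset.univ : Finset α).val.map e := by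
      rw [← Finset.map_univ_equiv e]; rfl
    rw [this, Multiset.map_map]; rfl
  · intro Xi hXi
    exact .zero _ fun v x => funext fun i => i.elim
  · intro α _ ih Xi hXi
    have h1 := ih (fun i => Xi (some i)) (fun i => hXi _)
    have h2 : IsoP (dsumFam Xi) ((Xi none).dsum (dsumFam fun i => Xi (some i))) := by
      refine ⟨isoOf (fun v => LinearMap.prod (LinearMap.proj none)
        (LinearMap.pi fun i => LinearMap.proj (some i))) ?_ ?_⟩
      · intro a x; rfl
      · intro v
        constructor
        · intro x y hxy
          funext i
          cases i with
          | none => exact congrArg Prod.fst hxy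
          | some i => exact congrFun (congrArg Prod.snd hxy) i
        · rintro ⟨y, z⟩
          refine ⟨fun i => match i with | none => y | some i => z i, rfl⟩
    have h3 := (h1.cons' (hXi none).1 (hXi none).2).iso h2.symm
    convert h3 using 1
    rw [univ_option]
    simp [Finset.insertNone, Multiset.map_map]

lemma cls_of_hasClass {M : Repn k Q} {μ : (Q.V → ℕ) → ℕ} (h : HasClassDynkin M μ) :
    ∃ s : Multiset (Q.V → ℕ), Cls M s ∧ ∀ d, s.count d = μ d := by
  classical
  obtain ⟨ι, _, Xi, r, h1, h2, h3⟩ := h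
  refine ⟨_, (cls_fam ι Xi fun i => ⟨(h1 i).1, (h1 i).2.1⟩).iso (IsoP.symm h3), fun d => ?_⟩
  rw [h2, Multiset.count_map, Nat.card_eq_fintype_card, Fintype.card_subtype]
  show _ = (Finset.univ.filter _).val.card
  rw [Finset.filter_val]
  congr 1
  apply Multiset.filter_congr
  intro i _
  rw [(h1 i).2.2]
  exact eq_comm

end
end HP

set_option linter.all false

namespace HP
open Repn

section
variable {k : Type} [Field k] {Q : QuiverData}

/-- exact pairs -/
@[reducible] def ES (M N X : Repn k Q) : Type :=
  {p : Gr N X × Gr X M // IsHom p.1 ∧ IsHom p.2 ∧ (∀ v, Function.Injective (p.1 v)) ∧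
    (∀ v, Function.Surjective (p.2 v)) ∧ ∀ v, LinearMap.range (p.1 v) = LinearMap.ker (p.2 v)}

/-- cocycles together with an isomorphism to the middle term -/
@[reducible] def T1 (M N X : Repn k Q) : Type :=
  {p : Co M N × Gr (N.dsum M) X // IsHom (M := exr M N p.1) p.2 ∧ ∀ v, Function.Bijective (p.2 v)}

def iso_equiv {M N : Repn k Q} (X : Repn k Q) (φ : Iso M N) : Iso M X ≃ Iso N X where
  toFun e := itrans (isymm φ) e
  invFun e := itrans φ e
  left_inv e := iso_ext fun v x => by
    show e.e v ((φ.e v).symm (φ.e v x)) = _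
    rw [LinearEquiv.symm_apply_apply]
  right_inv e := iso_ext fun v x => by
    show e.e v (φ.e v ((φ.e v).symm x)) = _
    rw [LinearEquiv.apply_symm_apply]

def iso_equiv' {M N : Repn k Q} (X : Repn k Q) (φ : Iso M N) : Iso X M ≃ Iso X N where
  toFun e := itrans e φ
  invFun e := itrans e (isymm φ)
  left_inv e := iso_ext fun v x => by
    show (φ.e v).symm (φ.e v (e.e v x)) = _
    rw [LinearEquiv.symm_apply_apply]
  right_inv e := iso_ext fun v x => by
    show φ.e v ((φ.e v).symm (e.e v x)) = _
    rw [LinearEquiv.apply_symm_apply]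

noncomputable def En (M N X : Repn k Q) : ℕ := Nat.card {c : Co M N // IsoP (exr M N c) X}

lemma card_T1 (M N X : Repn k Q) : Nat.card (T1 M N X) = En M N X * autCard X := by
  unfold En autCard
  rw [← Nat.card_prod]
  symm
  refine Nat.card_eq_of_bijective
    (fun p : {c : Co M N // IsoP (exr M N c) X} × Iso X X =>
      (⟨(p.1.1, ihom (M := exr M N p.1.1) (itrans p.1.2.some p.2)), isHom_ihom (itrans p.1.2.some p.2),
        fun v => ((itrans p.1.2.some p.2).e v).bijective⟩ : T1 M N X)) ⟨?_, ?_⟩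
  · rintro ⟨⟨c, hc⟩, α⟩ ⟨⟨c', hc'⟩, α'⟩ h
    have h1 := congrArg Subtype.val h
    have h2 : c = c' := congrArg Prod.fst h1
    subst h2
    have h3 := congrArg Prod.snd h1
    have : α = α' := iso_ext fun v x => by
      have h4 := LinearMap.congr_fun (congrFun h3 v) ((hc.some.e v).symm x)
      have h5 : α.e v (hc.some.e v ((hc.some.e v).symm x)) = α'.e v (hc.some.e v ((hc.some.e v).symm x)) := h4
      rw [LinearEquiv.apply_symm_apply] at h5
      exact h5
    rw [this]
  · rintro ⟨⟨c, φ⟩, h1, h2⟩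
    let ψ : Iso (exr M N c) X := isoOf φ h1 h2
    have hc : IsoP (exr M N c) X := ⟨ψ⟩
    refine ⟨(⟨c, hc⟩, itrans (isymm hc.some) ψ), ?_⟩
    apply Subtype.ext
    refine Prod.ext rfl ?_
    funext v
    refine LinearMap.ext fun x => ?_
    show ψ.e v ((hc.some.e v).symm (hc.some.e v x)) = φ v x
    rw [LinearEquiv.symm_apply_apply]
    rfl

lemma card_ES (M N X : Repn k Q) :
    Nat.card (ES M N X) = hallNum M N X * (autCard M * autCard N) := by
  have h1 : Nat.card (Σ U : {U : Subrep X // IsoP U.repn N ∧ IsoP U.quot M}, Iso U.1.quot M × Iso N U.1.repn)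
      = hallNum M N X * (autCard M * autCard N) := by
    unfold hallNum autCard
    rw [← Nat.card_prod, ← Nat.card_prod]
    refine Nat.card_congr ?_
    refine (Equiv.sigmaCongrRight fun U => ?_).trans (Equiv.sigmaEquivProd _ _)
    exact Equiv.prodCongr (iso_equiv M U.2.2.some) (iso_equiv' N U.2.1.some)
  rw [← h1]
  symm
  refine Nat.card_eq_of_bijective
    (fun p : (Σ U : {U : Subrep X // IsoP U.repn N ∧ IsoP U.quot M}, Iso U.1.quot M × Iso N U.1.repn) =>
      (⟨(fun v => (p.1.1.sub v).subtype.comp (p.2.2.e v).toLinearMap,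
        fun v => (p.2.1.e v).toLinearMap.comp (p.1.1.sub v).mkQ), ?_, ?_, ?_, ?_, ?_⟩ : ES M N X)) ⟨?_, ?_⟩
  · intro a x
    exact congrArg Subtype.val (p.2.2.comm a x)
  · intro a x
    exact p.2.1.comm a (Submodule.Quotient.mk x)
  · intro v
    exact (Subtype.val_injective).comp (p.2.2.e v).injective
  · intro v
    exact (p.2.1.e v).surjective.comp (Submodule.mkQ_surjective _)
  · intro v
    ext x
    constructor
    · rintro ⟨n, rfl⟩
      show p.2.1.e v (Submodule.Quotient.mk (p.2.2.e v n).1) = 0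
      rw [(Submodule.Quotient.mk_eq_zero _).2 (p.2.2.e v n).2, map_zero]
    · intro hx
      have hx' : p.2.1.e v (Submodule.Quotient.mk x) = 0 := hx
      rw [LinearEquiv.map_eq_zero_iff, Submodule.Quotient.mk_eq_zero] at hx'
      refine ⟨(p.2.2.e v).symm ⟨x, hx'⟩, ?_⟩
      show ((p.2.2.e v ((p.2.2.e v).symm ⟨x, hx'⟩)) : X.space v) = x
      rw [LinearEquiv.apply_symm_apply]
  · rintro ⟨⟨U, hU⟩, β, α⟩ ⟨⟨U', hU'⟩, β', α'⟩ h
    have h0 := congrArg Subtype.val h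
    have hf := congrArg Prod.fst h0
    have hg := congrArg Prod.snd h0
    have hr : ∀ (U : Subrep X) (α : Iso N U.repn) v,
        LinearMap.range ((U.sub v).subtype.comp (α.e v).toLinearMap) = U.sub v := by
      intro U α v
      rw [LinearMap.range_comp, LinearEquiv.range, Submodule.map_top, Submodule.range_subtype]
    have hUU : U = U' := Subrep.ext' fun v => by
      rw [← hr U α v, ← hr U' α' v]
      exact congrArg LinearMap.range (congrFun hf v)
    subst hUU
    have e1 : α = α' := iso_ext fun v x => Subtype.ext (LinearMap.congr_fun (congrFun hf v) x)
    have e2 : β = β' := iso_ext fun v x => by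
      obtain ⟨x, rfl⟩ := Submodule.mkQ_surjective _ x
      exact LinearMap.congr_fun (congrFun hg v) x
    rw [e1, e2]
  · rintro ⟨⟨f, g⟩, hf, hg, hi, hs, he⟩
    let U := ranS f hf
    have hk : ∀ v, U.sub v ≤ LinearMap.ker (g v) := fun v => (he v).le
    let α : Iso N U.repn := isoOf (fun v => (f v).rangeRestrict)
      (fun a x => Subtype.ext (hf a x)) (fun v => ⟨fun x y hxy => hi v (congrArg Subtype.val hxy),
        LinearMap.surjective_rangeRestrict _⟩)
    let β : Iso U.quot M := isoOf (fun v => (U.sub v).liftQ (g v) (hk v))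
      (fun a x => by
        obtain ⟨x, rfl⟩ := Submodule.mkQ_surjective _ x
        exact hg a x)
      (fun v => by
        constructor
        · rw [← LinearMap.ker_eq_bot]
          exact Submodule.ker_liftQ_eq_bot _ _ _ (he v).ge
        · intro m
          obtain ⟨x, rfl⟩ := hs v m
          exact ⟨Submodule.Quotient.mk x, rfl⟩)
    refine ⟨⟨⟨U, ⟨isymm α⟩, ⟨β⟩⟩, β, α⟩, ?_⟩
    apply Subtype.ext
    rfl

lemma card_T1' (M N X : Repn k Q) : Nat.card (T1 M N X) = Nat.card (ES M N X) * Nat.card (Gr M N) := by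
  rw [← Nat.card_prod]
  symm
  have hsec : ∀ p : ES M N X, ∃ r : Gr M X, ∀ v m, p.1.2 v (r v m) = m := by
    rintro ⟨⟨f, g⟩, hf, hg, hi, hs, he⟩
    choose r hr using fun v => LinearMap.exists_rightInverse_of_surjective (g v) (LinearMap.range_eq_top.2 (hs v))
    exact ⟨r, fun v m => LinearMap.congr_fun (hr v) m⟩
  choose r0 hr0 using hsec
  have hret : ∀ p : ES M N X, ∃ l : Gr X N, ∀ v n, l v (p.1.1 v n) = n := by
    rintro ⟨⟨f, g⟩, hf, hg, hi, hs, he⟩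
    choose r hr using fun v => LinearMap.exists_leftInverse_of_injective (f v) (LinearMap.ker_eq_bot.2 (hi v))
    exact ⟨r, fun v m => LinearMap.congr_fun (hr v) m⟩
  choose l hl using hret
  have hfl : ∀ (p : ES M N X) v x, p.1.2 v x = 0 → p.1.1 v (l p v x) = x := by
    intro p v x hx
    have : x ∈ LinearMap.range (p.1.1 v) := by rw [p.2.2.2.2.2 v]; exact hx
    obtain ⟨n, rfl⟩ := this
    rw [hl]
  have hgf : ∀ (p : ES M N X) v n, p.1.2 v (p.1.1 v n) = 0 := by
    intro p v n
    have : p.1.1 v n ∈ LinearMap.ker (p.1.2 v) := by rw [← p.2.2.2.2.2 v]; exact ⟨n, rfl⟩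
    exact this
  let r : ES M N X → Gr M N → Gr M X := fun p h v => r0 p v + (p.1.1 v).comp (h v)
  have hr : ∀ (p : ES M N X) h v m, p.1.2 v (r p h v m) = m := by
    intro p h v m
    show p.1.2 v (r0 p v m + p.1.1 v (h v m)) = m
    rw [map_add, hgf, hr0, add_zero]
  let cc : ES M N X → Gr M N → Co M N := fun p h a =>
    (l p (Q.t a)).comp ((X.map a).comp (r p h (Q.s a)) - (r p h (Q.t a)).comp (M.map a))
  have hcc : ∀ (p : ES M N X) h a m, p.1.1 (Q.t a) (cc p h a m) = X.map a (r p h (Q.s a) m) - r p h (Q.t a) (M.map a m) := by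
    intro p h a m
    apply hfl
    show p.1.2 _ (X.map a (r p h (Q.s a) m) - r p h (Q.t a) (M.map a m)) = 0
    rw [map_sub, hr, p.2.2.1, hr, sub_self]
  refine Nat.card_eq_of_bijective (fun x : ES M N X × Gr M N =>
    (⟨(cc x.1 x.2, fun v => (x.1.1.1 v).coprod (r x.1 x.2 v)), ?_, ?_⟩ : T1 M N X)) ⟨?_, ?_⟩
  · obtain ⟨p, h⟩ := x
    rintro a ⟨n, m⟩
    show p.1.1 _ (N.map a n + cc p h a m) + r p h _ (M.map a m) = X.map a (p.1.1 _ n + r p h _ m)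
    rw [map_add, map_add, hcc, p.2.1 a n]
    abel
  · obtain ⟨p, h⟩ := x
    intro v
    constructor
    · rw [← LinearMap.ker_eq_bot, Submodule.eq_bot_iff]
      rintro ⟨n, m⟩ hnm
      have h1 : p.1.1 v n + r p h v m = 0 := hnm
      have h2 := congrArg (p.1.2 v) h1
      rw [map_add, hgf, hr, map_zero, zero_add] at h2
      subst h2
      rw [map_zero, add_zero] at h1
      have h3 : n = 0 := p.2.2.2.1 v (h1.trans (map_zero _).symm)
      rw [h3]; rfl
    · intro x
      refine ⟨(l p v (x - r p h v (p.1.2 v x)), p.1.2 v x), ?_⟩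
      show p.1.1 v (l p v (x - r p h v (p.1.2 v x))) + r p h v (p.1.2 v x) = x
      rw [hfl]
      · abel
      · rw [map_sub, hr, sub_self]
  · rintro ⟨p, h⟩ ⟨p', h'⟩ he
    have he1 := congrArg Prod.snd (congrArg Subtype.val he)
    have hv : ∀ v n m, p.1.1 v n + r p h v m = p'.1.1 v n + r p' h' v m := fun v n m =>
      LinearMap.congr_fun (congrFun he1 v) (n, m)
    have h1 : p.1.1 = p'.1.1 := by
      funext v; refine LinearMap.ext fun n => ?_
      have := hv v n 0
      simpa using this
    have h2 : p.1.2 = p'.1.2 := by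
      funext v; refine LinearMap.ext fun x => ?_
      have hx : x = p.1.1 v (l p v (x - r p h v (p.1.2 v x))) + r p h v (p.1.2 v x) := by
        rw [hfl]
        · abel
        · rw [map_sub, hr, sub_self]
      have h3 := congrArg (p'.1.2 v) hx
      rw [hv, map_add, hgf, hr, zero_add] at h3
      exact h3.symm
    have hp : p = p' := Subtype.ext (Prod.ext h1 h2)
    subst hp
    have : h = h' := by
      funext v; refine LinearMap.ext fun m => p.2.2.2.1 v ?_
      have h3 := hv v 0 m
      have h4 : p.1.1 v 0 + (r0 p v m + p.1.1 v (h v m)) = p.1.1 v 0 + (r0 p v m + p.1.1 v (h' v m)) := h3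
      exact add_left_cancel (add_left_cancel h4)
    rw [this]
  · rintro ⟨⟨c, φ⟩, h1, h2⟩
    let e : ∀ v, (N.space v × M.space v) ≃ₗ[k] X.space v := fun v => LinearEquiv.ofBijective (φ v) (h2 v)
    have hφ : ∀ a n m, φ (Q.t a) (N.map a n + c a m, M.map a m) = X.map a (φ (Q.s a) (n, m)) :=
      fun a n m => h1 a (n, m)
    have hes : ∀ v x, φ v ((e v).symm x) = x := fun v x => (e v).apply_symm_apply x
    have hse : ∀ v x, (e v).symm (φ v x) = x := fun v x => (e v).symm_apply_apply x
    let p : ES M N X := ⟨(fun v => (φ v).comp (LinearMap.inl k _ _),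
        fun v => (LinearMap.snd k _ _).comp (e v).symm.toLinearMap), by
      intro a n
      have := hφ a n 0
      rw [map_zero, map_zero, add_zero] at this
      exact this, by
      intro a x
      obtain ⟨⟨n, m⟩, rfl⟩ := (h2 (Q.s a)).2 x
      show ((e _).symm (X.map a (φ _ (n, m)))).2 = M.map a ((e _).symm (φ _ (n, m))).2
      rw [← hφ, hse, hse], fun v => (h2 v).1.comp (LinearMap.inl_injective), fun v => 
        (Prod.snd_surjective).comp (e v).symm.surjective, fun v => by
      ext x
      constructor
      · rintro ⟨n, rfl⟩
        show ((e v).symm (φ v (n, 0))).2 = 0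
        rw [hse]
      · intro hx
        have hx' : ((e v).symm x).2 = 0 := hx
        refine ⟨((e v).symm x).1, ?_⟩
        show φ v (((e v).symm x).1, 0) = x
        rw [← hx', Prod.mk.eta, hes]⟩
    let h : Gr M N := fun v => (l p v).comp ((φ v).comp (LinearMap.inr k _ _) - r0 p v)
    have hh : ∀ v m, r p h v m = φ v (0, m) := by
      intro v m
      show r0 p v m + p.1.1 v (l p v (φ v (0, m) - r0 p v m)) = _
      rw [hfl]
      · abel
      · rw [map_sub, hr0]
        show ((e v).symm (φ v (0, m))).2 - m = 0
        rw [hse, sub_self]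
    refine ⟨(p, h), ?_⟩
    apply Subtype.ext
    refine Prod.ext ?_ ?_
    · funext a; refine LinearMap.ext fun m => p.2.2.2.1 _ ?_
      show p.1.1 _ (cc p h a m) = φ _ (c a m, 0)
      rw [hcc, hh, hh, ← hφ, ← map_sub]
      congr 1
      simp
    · funext v; refine LinearMap.ext fun x => ?_
      obtain ⟨n, m⟩ := x
      show φ v (n, 0) + r p h v m = φ v (n, m)
      rw [hh, ← map_add]
      simp

theorem riedtmann (M N X : Repn k Q) :
    En M N X * autCard X = hallNum M N X * (autCard M * autCard N) * Nat.card (Gr M N) := by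
  rw [← card_T1, card_T1', card_ES]

end
end HP

set_option linter.all false

namespace HP
open Repn

section
variable {k : Type} [Field k] {Q : QuiverData}

lemma fin_sp [Finite k] {X : Repn k Q} (h : X.FinDim) (v : Q.V) : Finite (X.space v) := by
  haveI := h v
  exact Module.finite_of_finite k

lemma fin_Gr [Finite k] {M N : Repn k Q} (h : M.FinDim) (h' : N.FinDim) : Finite (Gr M N) := by
  haveI := finite_Gr h h'
  exact Module.finite_of_finite k

lemma fin_Co [Finite k] {M N : Repn k Q} (h : M.FinDim) (h' : N.FinDim) : Finite (Co M N) := by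
  haveI := finite_Co h h'
  exact Module.finite_of_finite k

lemma fin_Iso [Finite k] {M N : Repn k Q} (h : M.FinDim) (h' : N.FinDim) : Finite (Iso M N) := by
  haveI := fin_Gr h h'
  refine Finite.of_injective (fun e : Iso M N => ihom e) fun e f hef => iso_ext fun v x => ?_
  exact LinearMap.congr_fun (congrFun hef v) x

lemma fin_Subrep [Finite k] {X : Repn k Q} (h : X.FinDim) : Finite (Subrep X) := by
  haveI := fin_sp h
  refine Finite.of_injective (fun (U : Subrep X) (v : Q.V) => (U.sub v : Set (X.space v))) ?_
  intro U W hUW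
  exact Subrep.ext' fun v => SetLike.coe_injective (congrFun hUW v)

lemma card_of_finrank [Finite k] (V : Type) [AddCommGroup V] [Module k V] [Module.Finite k V] :
    Nat.card V = Nat.card k ^ Module.finrank k V := Module.natCard_eq_pow_finrank

lemma card_Gr [Finite k] {M N : Repn k Q} (h : M.FinDim) (h' : N.FinDim) :
    Nat.card (Gr M N) = Nat.card k ^ (∑ v, M.dimv v * N.dimv v) := by
  haveI := finite_Gr h h'
  rw [card_of_finrank (k := k) (Gr M N), finrank_Gr h h']

lemma card_Co [Finite k] {M N : Repn k Q} (h : M.FinDim) (h' : N.FinDim) :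
    Nat.card (Co M N) = Nat.card k ^ (∑ a, M.dimv (Q.s a) * N.dimv (Q.t a)) := by
  haveI := finite_Co h h'
  rw [card_of_finrank (k := k) (Co M N), finrank_Co h h']

lemma autCard_pos [Finite k] {M : Repn k Q} (h : M.FinDim) : 0 < autCard M := by
  haveI := fin_Iso h h
  haveI : Nonempty (Iso M M) := ⟨irefl M⟩
  exact Nat.card_pos

lemma autCard_congr {M N : Repn k Q} (h : IsoP M N) : autCard M = autCard N := by
  obtain ⟨φ⟩ := h
  exact Nat.card_congr ((iso_equiv M φ).trans (iso_equiv' N φ))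

lemma En_congr {M N X X' : Repn k Q} (h : IsoP X X') : En M N X = En M N X' := by
  unfold En
  congr 1
  have : ∀ c, IsoP (exr M N c) X ↔ IsoP (exr M N c) X' := fun c =>
    ⟨fun h' => h'.trans h, fun h' => h'.trans h.symm⟩
  simp only [this]

lemma hallNum_congr [Finite k] {M N X X' : Repn k Q} (hM : M.FinDim) (hN : N.FinDim) (h : IsoP X X') :
    hallNum M N X = hallNum M N X' := by
  have h1 := riedtmann M N X
  rw [En_congr h, autCard_congr h, riedtmann] at h1
  have hG : 0 < Nat.card (Gr M N) := by
    haveI := fin_Gr hM hN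
    exact Nat.card_pos
  have := autCard_pos hM
  have := autCard_pos hN
  have h2 := Nat.eq_of_mul_eq_mul_right hG h1
  exact (Nat.eq_of_mul_eq_mul_right (by positivity) h2).symm

variable {A B : Repn k Q}

abbrev StabC (U1 : Subrep A) (U2 : Subrep B) (c : Co A B) : Prop :=
  ∀ a x, x ∈ U1.sub (Q.s a) → c a x ∈ U2.sub (Q.t a)

@[reducible] def resC (U1 : Subrep A) (U2 : Subrep B) (c : Co A B) (h : StabC U1 U2 c) : Co U1.repn U2.repn :=
  fun a => (c a).restrict (h a)

@[reducible] def indC (U1 : Subrep A) (U2 : Subrep B) (c : Co A B) (h : StabC U1 U2 c) : Co U1.quot U2.quot :=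
  fun a => Submodule.mapQ _ _ (c a) (h a)

/-- graph type submodule -/
def grS (U1 : Subrep A) (U2 : Subrep B) (f : Gr A B) (v : Q.V) : Submodule k (B.space v × A.space v) where
  carrier := {p | p.2 ∈ U1.sub v ∧ p.1 - f v p.2 ∈ U2.sub v}
  add_mem' := by
    rintro p q ⟨h1, h2⟩ ⟨h3, h4⟩
    refine ⟨add_mem h1 h3, ?_⟩
    have : (p + q).1 - f v (p + q).2 = (p.1 - f v p.2) + (q.1 - f v q.2) := by
      simp only [Prod.fst_add, Prod.snd_add, map_add]; abel
    rw [this]; exact add_mem h2 h4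
  zero_mem' := by simp
  smul_mem' := by
    rintro c p ⟨h1, h2⟩
    refine ⟨Submodule.smul_mem _ c h1, ?_⟩
    have : (c • p).1 - f v (c • p).2 = c • (p.1 - f v p.2) := by
      simp only [Prod.smul_fst, Prod.smul_snd, map_smul, smul_sub]
    rw [this]; exact Submodule.smul_mem _ c h2

lemma mem_grS {U1 : Subrep A} {U2 : Subrep B} {f : Gr A B} {v : Q.V} {p : B.space v × A.space v} :
    p ∈ grS U1 U2 f v ↔ p.2 ∈ U1.sub v ∧ p.1 - f v p.2 ∈ U2.sub v := Iff.rfl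

lemma grS_stable (U1 : Subrep A) (U2 : Subrep B) (f : Gr A B) (c : Co A B) (h : StabC U1 U2 c)
    (a : Q.A) : (grS U1 U2 f (Q.s a)).map ((exr A B (c - extMap A B f)).map a) ≤ grS U1 U2 f (Q.t a) := by
  rintro _ ⟨⟨b, x⟩, ⟨h1, h2⟩, rfl⟩
  refine ⟨Subrep.mem U1 h1, ?_⟩
  show B.map a b + (c a x - (B.map a (f _ x) - f _ (A.map a x))) - f _ (A.map a x) ∈ _
  have : B.map a b + (c a x - (B.map a (f _ x) - f _ (A.map a x))) - f _ (A.map a x) =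
    B.map a (b - f _ x) + c a x := by rw [map_sub]; abel
  rw [this]
  exact add_mem (Subrep.mem U2 h2) (h a x h1)

lemma green_sub (U1 : Subrep A) (U2 : Subrep B) (f : Gr A B) (c : Co A B) (h : StabC U1 U2 c)
    (W : Subrep (exr A B (c - extMap A B f))) (hW : ∀ v, W.sub v = grS U1 U2 f v) :
    IsoP W.repn (exr U1.repn U2.repn (resC U1 U2 c h)) := by
  refine repnIso (K := exr U1.repn U2.repn (resC U1 U2 c h))
    (fun v => LinearMap.prod ((U2.sub v).subtype.comp (LinearMap.fst k _ _) +
      ((f v).comp (U1.sub v).subtype).comp (LinearMap.snd k _ _))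
      ((U1.sub v).subtype.comp (LinearMap.snd k _ _))) ?_ ?_ W ?_
  · rintro a ⟨⟨y, hy⟩, ⟨x, hx⟩⟩
    refine Prod.ext ?_ rfl
    show (B.map a y + c a x) + f _ (A.map a x) = B.map a (y + f _ x) +
      (c a x - (B.map a (f _ x) - f _ (A.map a x)))
    rw [map_add]; abel
  · rintro v ⟨⟨y, hy⟩, ⟨x, hx⟩⟩ ⟨⟨y', hy'⟩, ⟨x', hx'⟩⟩ he
    have h2 : x = x' := congrArg Prod.snd he
    have h1 : y + f v x = y' + f v x' := congrArg Prod.fst he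
    subst h2
    have h3 := add_right_cancel h1
    subst h3
    rfl
  · intro v
    rw [hW]
    ext ⟨b, x⟩
    constructor
    · rintro ⟨⟨⟨y, hy⟩, ⟨z, hz⟩⟩, he⟩
      have h2 : z = x := congrArg Prod.snd he
      have h1 : y + f v z = b := congrArg Prod.fst he
      subst h2 h1
      refine ⟨hz, ?_⟩
      show y + f v z - f v z ∈ _
      rw [add_sub_cancel_right]; exact hy
    · rintro ⟨h1, h2⟩
      refine ⟨(⟨b - f v x, h2⟩, ⟨x, h1⟩), ?_⟩
      refine Prod.ext ?_ rfl
      show b - f v x + f v x = b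
      abel

lemma green_quot (U1 : Subrep A) (U2 : Subrep B) (f : Gr A B) (c : Co A B) (h : StabC U1 U2 c)
    (W : Subrep (exr A B (c - extMap A B f))) (hW : ∀ v, W.sub v = grS U1 U2 f v) :
    IsoP W.quot (exr U1.quot U2.quot (indC U1 U2 c h)) := by
  refine quotIso (L := exr U1.quot U2.quot (indC U1 U2 c h))
    (fun v => LinearMap.prod ((U2.sub v).mkQ.comp (LinearMap.fst k _ _ - (f v).comp (LinearMap.snd k _ _)))
      ((U1.sub v).mkQ.comp (LinearMap.snd k _ _))) ?_ ?_ W ?_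
  · rintro a ⟨b, x⟩
    refine Prod.ext ?_ rfl
    show (U2.sub _).mkQ (B.map a b + (c a x - (B.map a (f _ x) - f _ (A.map a x))) - f _ (A.map a x)) =
      (U2.sub _).mkQ (B.map a (b - f _ x)) + (U2.sub _).mkQ (c a x)
    rw [← map_add]
    congr 1
    rw [map_sub]; abel
  · rintro v ⟨y, x⟩
    obtain ⟨y, rfl⟩ := Submodule.mkQ_surjective _ y
    obtain ⟨x, rfl⟩ := Submodule.mkQ_surjective _ x
    refine ⟨(y + f v x, x), ?_⟩
    refine Prod.ext ?_ rfl
    show (U2.sub v).mkQ (y + f v x - f v x) = _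
    rw [add_sub_cancel_right]
  · intro v
    rw [hW]
    ext ⟨b, x⟩
    rw [LinearMap.mem_ker, mem_grS]
    show ((U2.sub v).mkQ (b - f v x), (U1.sub v).mkQ x) = 0 ↔ _
    rw [Prod.mk_eq_zero]
    simp only [Submodule.mkQ_apply, Submodule.Quotient.mk_eq_zero]
    exact and_comm

end
end HP

set_option linter.all false

namespace HP
open Repn

section
variable {k : Type} [Field k] {Q : QuiverData}

variable {A B : Repn k Q}

lemma green_sub' (U1 : Subrep A) (U2 : Subrep B) (f : Gr A B) (c : Co A B) (h : StabC U1 U2 c)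
    (c0 : Co A B) (hc : c0 = c - extMap A B f)
    (W : Subrep (exr A B c0)) (hW : ∀ v, W.sub v = grS U1 U2 f v) :
    IsoP W.repn (exr U1.repn U2.repn (resC U1 U2 c h)) := by
  subst hc; exact green_sub U1 U2 f c h W hW

lemma green_quot' (U1 : Subrep A) (U2 : Subrep B) (f : Gr A B) (c : Co A B) (h : StabC U1 U2 c)
    (c0 : Co A B) (hc : c0 = c - extMap A B f)
    (W : Subrep (exr A B c0)) (hW : ∀ v, W.sub v = grS U1 U2 f v) :
    IsoP W.quot (exr U1.quot U2.quot (indC U1 U2 c h)) := by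
  subst hc; exact green_quot U1 U2 f c h W hW

@[reducible] def ZT (M N : Repn k Q) (U1 : Subrep A) (U2 : Subrep B) : Type :=
  {c : Co A B // ∃ h : StabC U1 U2 c, IsoP (exr U1.repn U2.repn (resC U1 U2 c h)) N ∧
    IsoP (exr U1.quot U2.quot (indC U1 U2 c h)) M}

@[reducible] def PT (M N : Repn k Q) (A B : Repn k Q) : Type :=
  {p : Co A B × (∀ v, Submodule k (B.space v × A.space v)) //
    ∃ h, IsoP (Subrep.mk (X := exr A B p.1) p.2 h).repn N ∧ IsoP (Subrep.mk (X := exr A B p.1) p.2 h).quot M}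

lemma exists_lift (U1 : Subrep A) (U2 : Subrep B) (θ : Gr U1.repn U2.quot) :
    ∃ f : Gr A B, ∀ v (x : U1.sub v), (U2.sub v).mkQ (f v x) = θ v x := by
  have : ∀ v, ∃ f : A.space v →ₗ[k] B.space v, ∀ x : U1.sub v, (U2.sub v).mkQ (f x) = θ v x := by
    intro v
    obtain ⟨g, hg⟩ := LinearMap.exists_extend (p := U1.sub v) (θ v)
    obtain ⟨s, hs⟩ := LinearMap.exists_rightInverse_of_surjective (U2.sub v).mkQ
      (LinearMap.range_eq_top.2 (Submodule.mkQ_surjective _))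
    refine ⟨s.comp g, fun x => ?_⟩
    have h1 := LinearMap.congr_fun hs (g x)
    have h2 := LinearMap.congr_fun hg x
    exact h1.trans h2
  choose f hf using this
  exact ⟨f, hf⟩

noncomputable def lft (U1 : Subrep A) (U2 : Subrep B) (θ : Gr U1.repn U2.quot) : Gr A B :=
  (exists_lift U1 U2 θ).choose

lemma lft_spec (U1 : Subrep A) (U2 : Subrep B) (θ : Gr U1.repn U2.quot) (v) (x : U1.sub v) :
    (U2.sub v).mkQ (lft U1 U2 θ v x) = θ v x := (exists_lift U1 U2 θ).choose_spec v x

lemma grS_inj {U1 U1' : Subrep A} {U2 U2' : Subrep B} {f f' : Gr A B}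
    (h : ∀ v, grS U1 U2 f v = grS U1' U2' f' v) : U1 = U1' ∧ U2 = U2' := by
  have key : ∀ {U1 U1' : Subrep A} {U2 U2' : Subrep B} {f f' : Gr A B}
    (h : ∀ v, grS U1 U2 f v = grS U1' U2' f' v), (∀ v, U1.sub v ≤ U1'.sub v) ∧ ∀ v, U2.sub v ≤ U2'.sub v := by
    intro U1 U1' U2 U2' f f' h
    constructor
    · intro v x hx
      have : ((f v x, x) : B.space v × A.space v) ∈ grS U1 U2 f v := ⟨hx, by simp⟩
      rw [h v] at this
      exact this.1
    · intro v x hx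
      have : ((x, 0) : B.space v × A.space v) ∈ grS U1 U2 f v := ⟨zero_mem _, by simpa using hx⟩
      rw [h v] at this
      simpa using this.2
  obtain ⟨a, b⟩ := key h
  obtain ⟨a', b'⟩ := key fun v => (h v).symm
  exact ⟨Subrep.ext' fun v => le_antisymm (a v) (a' v), Subrep.ext' fun v => le_antisymm (b v) (b' v)⟩

lemma exists_graph {V W : Type} [AddCommGroup V] [Module k V] [AddCommGroup W] [Module k W]
    (S : Submodule k (V × W)) : ∃ f : W →ₗ[k] V, ∀ x ∈ S.map (LinearMap.snd k V W), (f x, x) ∈ S := by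
  let p : S →ₗ[k] S.map (LinearMap.snd k V W) :=
    (LinearMap.snd k V W).restrict fun x hx => Submodule.mem_map_of_mem hx
  have hp : Function.Surjective p := by
    rintro ⟨_, ⟨y, hy, rfl⟩⟩
    exact ⟨⟨y, hy⟩, rfl⟩
  obtain ⟨s, hs⟩ := LinearMap.exists_rightInverse_of_surjective p (LinearMap.range_eq_top.2 hp)
  obtain ⟨g, hg⟩ := LinearMap.exists_extend (p := S.map (LinearMap.snd k V W))
    ((LinearMap.fst k V W).comp (S.subtype.comp s))
  refine ⟨g, fun x hx => ?_⟩
  have h1 : g x = ((s ⟨x, hx⟩).1).1 := LinearMap.congr_fun hg ⟨x, hx⟩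
  have h2 := congrArg Subtype.val (LinearMap.congr_fun hs ⟨x, hx⟩)
  have h3 : ((s ⟨x, hx⟩).1).2 = x := h2
  have : (g x, x) = (s ⟨x, hx⟩).1 := Prod.ext h1 h3.symm
  rw [this]; exact (s ⟨x, hx⟩).2

lemma green_bij (M N A B : Repn k Q) :
    Nat.card (Σ U : Subrep A × Subrep B, Gr U.1.repn U.2.quot × ZT M N U.1 U.2) = Nat.card (PT M N A B) := by
  refine Nat.card_eq_of_bijective
    (fun x => (⟨(x.2.2.1 - extMap A B (lft x.1.1 x.1.2 x.2.1), grS x.1.1 x.1.2 (lft x.1.1 x.1.2 x.2.1)),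
      grS_stable _ _ _ _ x.2.2.2.1,
      (green_sub _ _ _ _ x.2.2.2.1 _ fun v => rfl).trans x.2.2.2.2.1,
      (green_quot _ _ _ _ x.2.2.2.1 _ fun v => rfl).trans x.2.2.2.2.2⟩ : PT M N A B)) ⟨?_, ?_⟩
  · rintro ⟨⟨U1, U2⟩, ⟨θ, c, hc⟩⟩ ⟨⟨U1', U2'⟩, ⟨θ', c', hc'⟩⟩ h
    have h0 := congrArg Subtype.val h
    have h1 : c - extMap A B (lft U1 U2 θ) = c' - extMap A B (lft U1' U2' θ') := congrArg Prod.fst h0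
    have h2 : grS U1 U2 (lft U1 U2 θ) = grS U1' U2' (lft U1' U2' θ') := congrArg Prod.snd h0
    obtain ⟨e1, e2⟩ := grS_inj (congrFun h2)
    subst e1 e2
    have h3 : θ = θ' := by
      funext v
      refine LinearMap.ext fun x => ?_
      have hx : ((lft U1 U2 θ v x, (x : A.space v)) : B.space v × A.space v) ∈ grS U1 U2 (lft U1 U2 θ) v :=
        ⟨x.2, by simp⟩
      rw [h2] at hx
      have h4 := hx.2
      rw [← lft_spec, ← lft_spec]
      exact (Submodule.Quotient.eq _).2 h4
    subst h3
    have h4 : c = c' := sub_left_injective h1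
    subst h4
    rfl
  · rintro ⟨⟨c, W⟩, hs, hN, hM⟩
    let WW : Subrep (exr A B c) := ⟨W, hs⟩
    have hmem : ∀ a b x, (b, x) ∈ W (Q.s a) → (B.map a b + c a x, A.map a x) ∈ W (Q.t a) := by
      intro a b x hx
      exact hs a (Submodule.mem_map_of_mem hx)
    let U1 : Subrep A := ⟨fun v => (W v).map (LinearMap.snd k _ _), by
      rintro a _ ⟨_, ⟨⟨b, x⟩, hx, rfl⟩, rfl⟩
      exact ⟨_, hmem a b x hx, rfl⟩⟩
    let U2 : Subrep B := ⟨fun v => (W v).comap (LinearMap.inl k _ _), by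
      rintro a _ ⟨b, hb, rfl⟩
      have := hmem a b 0 hb
      simpa using this⟩
    have hg : ∀ v, ∃ f : A.space v →ₗ[k] B.space v, ∀ x ∈ U1.sub v, (f x, x) ∈ W v :=
      fun v => exists_graph (W v)
    choose f0 hf0 using hg
    let θ : Gr U1.repn U2.quot := fun v => (U2.sub v).mkQ.comp ((f0 v).comp (U1.sub v).subtype)
    have hf : ∀ v, ∀ x ∈ U1.sub v, (lft U1 U2 θ v x, x) ∈ W v := by
      intro v x hx
      have h1 : (U2.sub v).mkQ (lft U1 U2 θ v x) = (U2.sub v).mkQ (f0 v x) := lft_spec U1 U2 θ v ⟨x, hx⟩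
      have h2 : lft U1 U2 θ v x - f0 v x ∈ U2.sub v := (Submodule.Quotient.eq _).1 h1
      have h3 : (lft U1 U2 θ v x - f0 v x, (0 : A.space v)) ∈ W v := h2
      have h4 := add_mem h3 (hf0 v x hx)
      simpa using h4
    set f := lft U1 U2 θ with hfdef
    have hst : StabC U1 U2 (c + extMap A B f) := by
      intro a x hx
      have h1 := hmem a _ _ (hf _ x hx)
      have h2 := hf _ _ (Subrep.mem U1 hx)
      have h3 := sub_mem h1 h2
      show (c a x + (B.map a (f _ x) - f _ (A.map a x)), (0 : A.space (Q.t a))) ∈ W (Q.t a)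
      have h4 : ((c a x + (B.map a (f _ x) - f _ (A.map a x)), (0 : A.space (Q.t a)))) =
        (B.map a (f _ x) + c a x, A.map a x) - (f _ (A.map a x), A.map a x) := by
        refine Prod.ext ?_ ?_
        · show _ = B.map a (f _ x) + c a x - f _ (A.map a x)
          show c a x + (B.map a (f _ x) - f _ (A.map a x)) = _
          abel
        · show (0 : A.space (Q.t a)) = A.map a x - A.map a x
          rw [sub_self]
      rw [h4]; exact h3
    have hW : ∀ v, W v = grS U1 U2 f v := by
      intro v
      ext ⟨b, x⟩
      rw [mem_grS]
      constructor
      · intro h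
        have hx : x ∈ U1.sub v := ⟨_, h, rfl⟩
        refine ⟨hx, ?_⟩
        have h3 := sub_mem h (hf v x hx)
        show (b - f v x, (0 : A.space v)) ∈ W v
        simpa using h3
      · rintro ⟨hx, hb⟩
        have h1 : (b - f v x, (0 : A.space v)) ∈ W v := hb
        have := add_mem h1 (hf v x hx)
        simpa using this
    have hcc : c = (c + extMap A B f) - extMap A B f := by rw [add_sub_cancel_right]
    refine ⟨⟨(U1, U2), θ, ⟨c + extMap A B f, hst,
      (green_sub' U1 U2 f _ hst c hcc WW hW).symm.trans hN,
      (green_quot' U1 U2 f _ hst c hcc WW hW).symm.trans hM⟩⟩, ?_⟩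
    apply Subtype.ext
    refine Prod.ext ?_ ?_
    · exact hcc.symm
    · funext v
      exact (hW v).symm

lemma card_ZT (M N : Repn k Q) (U1 : Subrep A) (U2 : Subrep B) :
    Nat.card (ZT M N U1 U2) = Nat.card (Co U1.quot U2.repn) * (En U1.repn U2.repn N * En U1.quot U2.quot M) := by
  unfold En
  rw [← Nat.card_prod, ← Nat.card_prod]
  symm
  have hρ : ∀ v, ∃ ρ : A.space v →ₗ[k] U1.sub v, ∀ x : U1.sub v, ρ x = x := by
    intro v
    obtain ⟨g, hg⟩ := LinearMap.exists_extend (p := U1.sub v) LinearMap.id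
    exact ⟨g, fun x => LinearMap.congr_fun hg x⟩
  have hσ : ∀ v, ∃ σ : (B.space v ⧸ U2.sub v) →ₗ[k] B.space v, ∀ x, (U2.sub v).mkQ (σ x) = x := by
    intro v
    obtain ⟨s, hs⟩ := LinearMap.exists_rightInverse_of_surjective (U2.sub v).mkQ
      (LinearMap.range_eq_top.2 (Submodule.mkQ_surjective _))
    exact ⟨s, fun x => LinearMap.congr_fun hs x⟩
  choose ρ hρ using hρ
  choose σ hσ using hσ
  let F : Co U1.quot U2.repn → Co U1.repn U2.repn → Co U1.quot U2.quot → Co A B := fun c3 c1 c2 a =>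
    ((U2.sub _).subtype.comp ((c1 a).comp (ρ _))) + ((σ _).comp ((c2 a).comp (U1.sub _).mkQ))
      + ((U2.sub _).subtype.comp ((c3 a).comp (U1.sub _).mkQ))
  have hF : ∀ c3 c1 c2 a x, F c3 c1 c2 a x = (c1 a (ρ _ x) : B.space (Q.t a)) + σ _ (c2 a ((U1.sub _).mkQ x))
      + (c3 a ((U1.sub _).mkQ x) : B.space (Q.t a)) := fun _ _ _ _ _ => rfl
  have hF1 : ∀ c3 c1 c2 a (x : U1.sub (Q.s a)), F c3 c1 c2 a x = c1 a x := by
    intro c3 c1 c2 a x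
    rw [hF, hρ]
    have : (U1.sub (Q.s a)).mkQ x = 0 := (Submodule.Quotient.mk_eq_zero _).2 x.2
    rw [this, map_zero, map_zero, map_zero]
    simp
  have hFs : ∀ c3 c1 c2, StabC U1 U2 (F c3 c1 c2) := by
    intro c3 c1 c2 a x hx
    have := hF1 c3 c1 c2 a ⟨x, hx⟩
    have h2 : F c3 c1 c2 a x = c1 a ⟨x, hx⟩ := this
    rw [h2]; exact (c1 a ⟨x, hx⟩).2
  have hF2 : ∀ c3 c1 c2 a x, (U2.sub _).mkQ (F c3 c1 c2 a x) = c2 a ((U1.sub _).mkQ x) := by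
    intro c3 c1 c2 a x
    have e0 : ∀ y : U2.sub (Q.t a), (U2.sub (Q.t a)).mkQ (y : B.space (Q.t a)) = 0 :=
      fun y => (Submodule.Quotient.mk_eq_zero _).2 y.2
    rw [hF, map_add, map_add, hσ, e0, e0, zero_add, add_zero]
  have hres : ∀ c3 c1 c2, resC U1 U2 (F c3 c1 c2) (hFs c3 c1 c2) = c1 := by
    intro c3 c1 c2
    funext a
    refine LinearMap.ext fun x => Subtype.ext (hF1 c3 c1 c2 a x)
  have hind : ∀ c3 c1 c2, indC U1 U2 (F c3 c1 c2) (hFs c3 c1 c2) = c2 := by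
    intro c3 c1 c2
    funext a
    refine LinearMap.ext fun x => ?_
    obtain ⟨x, rfl⟩ := Submodule.mkQ_surjective _ x
    exact hF2 c3 c1 c2 a x
  refine Nat.card_eq_of_bijective
    (fun p : Co U1.quot U2.repn × ({c // IsoP (exr U1.repn U2.repn c) N} × {c // IsoP (exr U1.quot U2.quot c) M}) =>
      (⟨F p.1 p.2.1.1 p.2.2.1, hFs _ _ _, by rw [hres]; exact p.2.1.2, by rw [hind]; exact p.2.2.2⟩ : ZT M N U1 U2))
      ⟨?_, ?_⟩
  · rintro ⟨c3, ⟨c1, h1⟩, ⟨c2, h2⟩⟩ ⟨c3', ⟨c1', h1'⟩, ⟨c2', h2'⟩⟩ h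
    have h0 : F c3 c1 c2 = F c3' c1' c2' := congrArg Subtype.val h
    have e1 : c1 = c1' := by
      funext a
      refine LinearMap.ext fun x => Subtype.ext ?_
      rw [← hF1 c3 c1 c2, h0, hF1]
    have e2 : c2 = c2' := by
      funext a
      refine LinearMap.ext fun x => ?_
      obtain ⟨x, rfl⟩ := Submodule.mkQ_surjective _ x
      rw [← hF2 c3 c1 c2, h0, hF2]
    subst e1 e2
    have e3 : c3 = c3' := by
      funext a
      refine LinearMap.ext fun x => Subtype.ext ?_
      obtain ⟨x, rfl⟩ := Submodule.mkQ_surjective _ x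
      have h4 := LinearMap.congr_fun (congrFun h0 a) x
      rw [hF, hF] at h4
      exact add_left_cancel h4
    subst e3
    rfl
  · rintro ⟨c, hs, hN, hM⟩
    let c1 := resC U1 U2 c hs
    let c2 := indC U1 U2 c hs
    let d : Co A B := fun a => c a - ((U2.sub _).subtype.comp ((c1 a).comp (ρ _))) - ((σ _).comp ((c2 a).comp (U1.sub _).mkQ))
    have hd : ∀ a x, d a x = c a x - c a (ρ _ x) - σ _ ((U2.sub _).mkQ (c a x)) := fun _ _ => rfl
    have hd1 : ∀ a x, d a x ∈ U2.sub (Q.t a) := by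
      intro a x
      have : (U2.sub (Q.t a)).mkQ (d a x) = 0 := by
        have e0 : (U2.sub (Q.t a)).mkQ (c a (ρ _ x)) = 0 :=
          (Submodule.Quotient.mk_eq_zero _).2 (hs a _ (ρ _ x).2)
        rw [hd, map_sub, map_sub, hσ, e0]
        simp
      exact (Submodule.Quotient.mk_eq_zero _).1 this
    have hd2 : ∀ a x, x ∈ U1.sub (Q.s a) → d a x = 0 := by
      intro a x hx
      have e1 : ρ _ x = ⟨x, hx⟩ := hρ _ ⟨x, hx⟩
      have e0 : (U2.sub (Q.t a)).mkQ (c a x) = 0 := (Submodule.Quotient.mk_eq_zero _).2 (hs a _ hx)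
      rw [hd, e0, e1]
      simp
    let c3 : Co U1.quot U2.repn := fun a => Submodule.liftQ _ ((d a).codRestrict (U2.sub (Q.t a)) (hd1 a)) (by
      intro x hx
      rw [LinearMap.mem_ker]
      exact Subtype.ext (hd2 a x hx))
    have hc : F c3 c1 c2 = c := by
      funext a
      refine LinearMap.ext fun x => ?_
      rw [hF]
      show c a (ρ _ x) + σ _ ((U2.sub _).mkQ (c a x)) + (c a x - c a (ρ _ x) - σ _ ((U2.sub _).mkQ (c a x))) = c a x
      abel
    exact ⟨⟨c3, ⟨c1, hN⟩, ⟨c2, hM⟩⟩, Subtype.ext hc⟩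

lemma card_PT [Finite k] {M N : Repn k Q} (hA : A.FinDim) (hB : B.FinDim) (hM : M.FinDim) (hN : N.FinDim)
    (h0 : ext0 A B) : Nat.card (PT M N A B) = Nat.card (Co A B) * hallNum M N (B.dsum A) := by
  have h1 : ∀ c, hallNum M N (exr A B c) = hallNum M N (B.dsum A) := fun c =>
    hallNum_congr hM hN (exr_split h0 c)
  have h2 : Nat.card (Σ c : Co A B, {U : Subrep (exr A B c) // IsoP U.repn N ∧ IsoP U.quot M}) =
      Nat.card (Co A B) * hallNum M N (B.dsum A) := by
    haveI := fin_Co hA hB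
    letI := Fintype.ofFinite (Co A B)
    haveI : ∀ c : Co A B, Finite (Subrep (exr A B c)) := fun c => fin_Subrep (finDim_exr hA hB c)
    rw [Nat.card_sigma]
    have : ∀ c : Co A B, Nat.card {U : Subrep (exr A B c) // IsoP U.repn N ∧ IsoP U.quot M} = hallNum M N (B.dsum A) :=
      fun c => h1 c
    simp only [this, Finset.sum_const, Finset.card_univ, smul_eq_mul, Nat.card_eq_fintype_card]
  rw [← h2]
  refine Nat.card_congr
    { toFun := fun p => ⟨p.1.1, ⟨p.1.2, p.2.choose⟩, p.2.choose_spec.1, p.2.choose_spec.2⟩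
      invFun := fun x => ⟨(x.1, x.2.1.sub), x.2.1.stable, x.2.2.1, x.2.2.2⟩
      left_inv := fun p => rfl
      right_inv := fun x => rfl }

/-- Green's formula in the split case -/
lemma green [Finite k] {M N : Repn k Q} (hA : A.FinDim) (hB : B.FinDim) (hM : M.FinDim) (hN : N.FinDim)
    (h0 : ext0 A B) [Fintype (Subrep A × Subrep B)] : Nat.card (Co A B) * hallNum M N (B.dsum A) =
      ∑ U : Subrep A × Subrep B, Nat.card (Gr U.1.repn U.2.quot) * (Nat.card (Co U.1.quot U.2.repn) *
        (En U.1.repn U.2.repn N * En U.1.quot U.2.quot M)) := by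
  rw [← card_PT hA hB hM hN h0, ← green_bij]
  haveI := fin_Co hA hB
  haveI : ∀ U : Subrep A × Subrep B, Finite (Gr U.1.repn U.2.quot × ZT M N U.1 U.2) := fun U => by
    haveI := fin_Gr (finDim_repn hA U.1) (finDim_quot hB U.2)
    infer_instance
  rw [Nat.card_sigma]
  refine Finset.sum_congr rfl fun U _ => ?_
  rw [Nat.card_prod, card_ZT]

end
end HP

set_option linter.all false

namespace HP
open Repn

section
variable {k : Type} [Field k] {Q : QuiverData}

lemma hom_zero_of_homDim {M N : Repn k Q} (fM : M.FinDim) (fN : N.FinDim) (h : homDim M N = 0) {g : Gr M N}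
    (hg : IsHom g) : g = 0 := by
  haveI := finite_Gr fM fN
  have h1 : Hm M N = ⊥ := Submodule.finrank_eq_zero.1 h
  have h2 := mem_Hm.2 hg
  rw [h1] at h2
  exact h2

/-- a nonzero map to an indecomposable of minimal index splits -/
lemma Cls.split (S : SeqD Q) {M A : Repn k Q} {s : Multiset (Q.V → ℕ)} (c : Cls M s)
    (hA : A.Indec) (fA : A.FinDim) (h : ∀ β ∈ s, tau S A.dimv ≤ tau S β) {g : Gr M A} (hg : IsHom g)
    (h0 : g ≠ 0) : ∃ j : Gr A M, IsHom j ∧ ∀ v x, g v (j v x) = x := by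
  induction c with
  | zero M hz =>
    exact absurd (by funext v; ext x; rw [hz v x, map_zero, map_zero]) h0
  | cons M B C t hB fB h' hC ih =>
    obtain ⟨φ⟩ := h'
    let ψ := isymm φ
    let iB : Gr B M := gcomp (ihom ψ) (fun v => LinearMap.inl k _ _)
    let iC : Gr C M := gcomp (ihom ψ) (fun v => LinearMap.inr k _ _)
    have hiB : IsHom iB := (isHom_ihom ψ).comp (isHom_inl B C)
    have hiC : IsHom iC := (isHom_ihom ψ).comp (isHom_inr B C)
    have hdec : ∀ v x, ∃ b c, x = iB v b + iC v c := by
      intro v x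
      refine ⟨(φ.e v x).1, (φ.e v x).2, ?_⟩
      show x = (φ.e v).symm ((φ.e v x).1, 0) + (φ.e v).symm (0, (φ.e v x).2)
      rw [← map_add]
      simp
    by_cases hC0 : gcomp g iC = 0
    · have hB0 : gcomp g iB ≠ 0 := by
        intro hB0
        apply h0
        funext v
        ext x
        obtain ⟨b, c, rfl⟩ := hdec v x
        rw [map_add]
        have e1 : g v (iB v b) = 0 := LinearMap.congr_fun (congrFun hB0 v) b
        have e2 : g v (iC v c) = 0 := LinearMap.congr_fun (congrFun hC0 v) c
        rw [e1, e2]; simp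
      have hgB : IsHom (gcomp g iB) := hg.comp hiB
      have hle := h _ (Multiset.mem_cons_self B.dimv t)
      have heq : tau S A.dimv = tau S B.dimv := by
        by_contra hne
        exact hB0 (hom_zero_of_homDim fB fA (ind_hom0 S hA fA hB fB (lt_of_le_of_ne hle hne)) hgB)
      obtain ⟨η⟩ := ind_iso S hA fA hB fB heq
      -- gcomp g iB ∘ η is a nonzero scalar
      have he : IsHom (gcomp (gcomp g iB) (ihom η)) := hgB.comp (isHom_ihom η)
      have h1 : Module.finrank k (Hm A A) = 1 := ind_end S hA fA
      have hid : (⟨gid A, mem_Hm.2 (isHom_gid A)⟩ : Hm A A) ≠ 0 := by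
        intro h2
        apply hA.1
        intro v x
        exact LinearMap.congr_fun (congrFun (congrArg Subtype.val h2) v) x
      obtain ⟨r, hr⟩ := (finrank_eq_one_iff_of_nonzero' _ hid).1 h1 ⟨_, mem_Hm.2 he⟩
      have hr' : ∀ v x, r • x = g v (iB v (η.e v x)) := fun v x =>
        LinearMap.congr_fun (congrFun (congrArg Subtype.val hr) v) x
      have hr0 : r ≠ 0 := by
        rintro rfl
        apply hB0
        funext v
        ext x
        have := hr' v ((η.e v).symm x)
        rw [LinearEquiv.apply_symm_apply, zero_smul] at this
        exact this.symm
      refine ⟨r⁻¹ • gcomp iB (ihom η), (hiB.comp (isHom_ihom η)).smul r⁻¹, fun v x => ?_⟩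
      show g v (r⁻¹ • iB v (η.e v x)) = x
      rw [map_smul, ← hr', smul_smul, inv_mul_cancel₀ hr0, one_smul]
    · obtain ⟨j, hj, hj'⟩ := ih (fun β hβ => h β (Multiset.mem_cons_of_mem hβ)) (hg.comp hiC) hC0
      exact ⟨gcomp iC j, hiC.comp hj, hj'⟩

lemma split_ker {X A : Repn k Q} {g : Gr X A} (hg : IsHom g) {j : Gr A X} (hj : IsHom j)
    (h : ∀ v x, g v (j v x) = x) : IsoP X (A.dsum (kerS g hg).repn) := by
  have hc : IsoP X ((ranS j hj).repn.dsum (kerS g hg).repn) := by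
    refine isoOfCompl _ _ fun v => ?_
    constructor
    · rw [Submodule.disjoint_def]
      rintro _ ⟨y, rfl⟩ hy
      have hy' : g v (j v y) = 0 := hy
      rw [h] at hy'
      rw [hy', map_zero]
    · rw [codisjoint_iff, Submodule.eq_top_iff']
      intro x
      refine Submodule.mem_sup.2 ⟨j v (g v x), ⟨_, rfl⟩, x - j v (g v x), ?_, by abel⟩
      show g v (x - j v (g v x)) = 0
      rw [map_sub, h, sub_self]
  refine hc.trans (IsoP.dsum_congr ?_ (IsoP.refl _))
  refine repnIso j hj (fun v x y hxy => ?_) _ fun v => rfl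
  rw [← h v x, hxy, h]

lemma ker_iso (S : SeqD Q) {A B : Repn k Q} {t : Multiset (Q.V → ℕ)} (hA : A.Indec) (fA : A.FinDim)
    (c : Cls B t) (h : ∀ β ∈ t, tau S A.dimv ≤ tau S β) {g : Gr (B.dsum A) A} (hg : IsHom g) (h0 : g ≠ 0) :
    (∀ v, Function.Surjective (g v)) ∧ IsoP B (kerS g hg).repn := by
  have cX : Cls (B.dsum A) (A.dimv ::ₘ t) := (c.cons' hA fA).iso (dsum_comm A B)
  obtain ⟨j, hj, hj'⟩ := cX.split S hA fA (by
    intro β hβ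
    rcases Multiset.mem_cons.1 hβ with rfl | hβ
    · exact le_rfl
    · exact h β hβ) hg h0
  refine ⟨fun v x => ⟨j v x, hj' v x⟩, ?_⟩
  obtain ⟨u, hu⟩ := Cls.exists (finDim_repn cX.finDim (kerS g hg))
  have h1 : Cls (B.dsum A) (A.dimv ::ₘ u) := (hu.cons' hA fA).iso (split_ker hg hj hj').symm
  have h2 := (Multiset.cons_inj_right _).1 (cX.unique S h1)
  subst h2
  exact c.isoP S hu

lemma card_ES_min [Finite k] (S : SeqD Q) {A B : Repn k Q} {t : Multiset (Q.V → ℕ)} (hA : A.Indec) (fA : A.FinDim)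
    (c : Cls B t) (h : ∀ β ∈ t, tau S A.dimv ≤ tau S β) :
    Nat.card (ES A B (B.dsum A)) = (Nat.card k ^ (t.count A.dimv + 1) - 1) * autCard B := by
  classical
  have cX : Cls (B.dsum A) (A.dimv ::ₘ t) := (c.cons' hA fA).iso (dsum_comm A B)
  have hdim : homDim (B.dsum A) A = t.count A.dimv + 1 := by
    rw [cX.homDim_min S hA fA (by
      intro β hβ
      rcases Multiset.mem_cons.1 hβ with rfl | hβ
      · exact le_rfl
      · exact h β hβ)]
    convert Multiset.count_cons_self _ _
  have hcard : Nat.card {g : Hm (B.dsum A) A // g ≠ 0} = Nat.card k ^ (t.count A.dimv + 1) - 1 := by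
    haveI := finite_Hm cX.finDim fA
    haveI : Finite (Hm (B.dsum A) A) := Module.finite_of_finite k
    letI := Fintype.ofFinite (Hm (B.dsum A) A)
    rw [← hdim]
    have h1 : Nat.card (Hm (B.dsum A) A) = Nat.card k ^ homDim (B.dsum A) A :=
      card_of_finrank (k := k) (Hm (B.dsum A) A)
    rw [← h1, Nat.card_eq_fintype_card, Nat.card_eq_fintype_card, Fintype.card_subtype_compl,
      Fintype.card_subtype_eq]
  rw [← hcard]
  unfold autCard
  rw [← Nat.card_prod]
  symm
  have hk : ∀ g : {g : Hm (B.dsum A) A // g ≠ 0}, (∀ v, Function.Surjective (g.1.1 v)) ∧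
      IsoP B (kerS g.1.1 (mem_Hm.1 g.1.2)).repn := fun g =>
    ker_iso S hA fA c h (mem_Hm.1 g.1.2) fun h0 => g.2 (Subtype.ext h0)
  let φ : ∀ g : {g : Hm (B.dsum A) A // g ≠ 0}, Iso B (kerS g.1.1 (mem_Hm.1 g.1.2)).repn := fun g => (hk g).2.some
  refine Nat.card_eq_of_bijective
    (fun p : {g : Hm (B.dsum A) A // g ≠ 0} × Iso B B =>
      (⟨(fun v => ((kerS p.1.1.1 (mem_Hm.1 p.1.1.2)).sub v).subtype.comp (((φ p.1).e v).toLinearMap.comp (p.2.e v).toLinearMap),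
        p.1.1.1), ?_, mem_Hm.1 p.1.1.2, ?_, (hk p.1).1, ?_⟩ : ES A B (B.dsum A))) ⟨?_, ?_⟩
  · intro a x
    exact congrArg Subtype.val ((itrans p.2 (φ p.1)).comm a x)
  · intro v
    exact Subtype.val_injective.comp (((φ p.1).e v).injective.comp (p.2.e v).injective)
  · intro v
    ext x
    constructor
    · rintro ⟨n, rfl⟩
      exact ((φ p.1).e v (p.2.e v n)).2
    · intro hx
      refine ⟨(p.2.e v).symm (((φ p.1).e v).symm ⟨x, hx⟩), ?_⟩
      show (((φ p.1).e v (p.2.e v ((p.2.e v).symm (((φ p.1).e v).symm ⟨x, hx⟩)))) : (B.dsum A).space v) = x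
      rw [LinearEquiv.apply_symm_apply, LinearEquiv.apply_symm_apply]
  · rintro ⟨g, α⟩ ⟨g', α'⟩ he
    have h0 := congrArg Subtype.val he
    have hg : g = g' := Subtype.ext (Subtype.ext (congrArg Prod.snd h0))
    subst hg
    have hf := congrArg Prod.fst h0
    have : α = α' := iso_ext fun v x => by
      have h3 := LinearMap.congr_fun (congrFun hf v) x
      exact ((φ g).e v).injective (Subtype.ext h3)
    rw [this]
  · rintro ⟨⟨f, g⟩, hf, hg, hi, hs, he⟩
    have hg0 : g ≠ 0 := by
      rintro rfl
      apply hA.1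
      intro v x
      obtain ⟨y, rfl⟩ := hs v x
      rfl
    let g' : {g : Hm (B.dsum A) A // g ≠ 0} := ⟨⟨g, mem_Hm.2 hg⟩, fun h0 => hg0 (congrArg Subtype.val h0)⟩
    let U := kerS g hg
    have hU : ∀ v x, f v x ∈ U.sub v := fun v x => (he v).le ⟨x, rfl⟩
    let α : Iso B U.repn := isoOf (fun v => (f v).codRestrict _ (hU v))
      (fun a x => Subtype.ext (hf a x)) (fun v => ⟨fun x y hxy => hi v (congrArg Subtype.val hxy), by
        rintro ⟨x, hx⟩
        obtain ⟨y, hy⟩ := (he v).ge hx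
        exact ⟨y, Subtype.ext hy⟩⟩)
    refine ⟨(g', itrans α (isymm (φ g'))), ?_⟩
    apply Subtype.ext
    refine Prod.ext ?_ rfl
    funext v
    refine LinearMap.ext fun x => ?_
    show (((φ g').e v (((φ g').e v).symm (α.e v x))) : (B.dsum A).space v) = f v x
    rw [LinearEquiv.apply_symm_apply]
    rfl

lemma aut_rec [Finite k] (S : SeqD Q) {A B : Repn k Q} {t : Multiset (Q.V → ℕ)} (hA : A.Indec) (fA : A.FinDim)
    (c : Cls B t) (h : ∀ β ∈ t, tau S A.dimv ≤ tau S β) :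
    Nat.card (Co A B) * autCard (B.dsum A) =
      (Nat.card k ^ (t.count A.dimv + 1) - 1) * autCard B * Nat.card (Gr A B) := by
  have h1 := riedtmann A B (B.dsum A)
  have h0 : ext0 A B := c.ext0_tau S hA fA h
  have h2 : En A B (B.dsum A) = Nat.card (Co A B) := by
    unfold En
    exact Nat.card_congr (Equiv.subtypeUnivEquiv fun x => exr_split h0 x)
  rw [h2, ← card_ES, card_ES_min S hA fA c h] at h1
  exact h1

end
end HP

set_option linter.all false

namespace HP
open Repn

section

lemma poly_small (D R : Polynomial ℤ) (hD : D.Monic) (hR : R.degree < D.degree)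
    (h : ∀ p : ℕ, p.Prime → ∃ n : ℤ, D.eval (p : ℤ) * n = R.eval (p : ℤ)) : R = 0 := by
  have inj : Function.Injective (Int.castRingHom ℝ) := Int.cast_injective
  have h1 : (R.map (Int.castRingHom ℝ)).degree < (D.map (Int.castRingHom ℝ)).degree := by
    rw [Polynomial.degree_map_eq_of_injective inj, Polynomial.degree_map_eq_of_injective inj]
    exact hR
  have h2 := Polynomial.div_tendsto_zero_of_degree_lt _ _ h1
  have h3 : ∀ᶠ x : ℝ in Filter.atTop, |Polynomial.eval x (R.map (Int.castRingHom ℝ)) /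
      Polynomial.eval x (D.map (Int.castRingHom ℝ))| < 1 := by
    have := h2.abs
    rw [abs_zero] at this
    exact this.eventually_lt_const one_pos
  have hDne : (D.map (Int.castRingHom ℝ)) ≠ 0 := (hD.map _).ne_zero
  have h4 : ∀ᶠ x : ℝ in Filter.atTop, Polynomial.eval x (D.map (Int.castRingHom ℝ)) ≠ 0 :=
    Polynomial.eventually_no_roots _ hDne
  obtain ⟨N, hN⟩ := Filter.eventually_atTop.1 (h3.and h4)
  obtain ⟨N', hN'⟩ := exists_nat_ge N
  refine Polynomial.eq_zero_of_infinite_isRoot R ?_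
  have hinf : ((fun p : ℕ => (p : ℤ)) '' {p : ℕ | p.Prime ∧ N' ≤ p}).Infinite := by
    refine Set.Infinite.image (fun a _ b _ hab => by exact_mod_cast hab) ?_
    refine Set.infinite_of_not_bddAbove ?_
    rintro ⟨b, hb⟩
    obtain ⟨p, hp, hpp⟩ := Nat.exists_infinite_primes (max N' (b+1))
    have := hb (⟨hpp, le_trans (le_max_left _ _) hp⟩ : p ∈ {p : ℕ | p.Prime ∧ N' ≤ p})
    have := le_trans (le_max_right N' (b+1)) hp
    omega
  refine hinf.mono ?_
  rintro _ ⟨p, ⟨hp, hpN⟩, rfl⟩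
  obtain ⟨n, hn⟩ := h p hp
  obtain ⟨h5, h6⟩ := hN (p : ℝ) (hN'.trans (by exact_mod_cast hpN))
  have ev : ∀ F : Polynomial ℤ, Polynomial.eval (p : ℝ) (F.map (Int.castRingHom ℝ)) = ((F.eval (p : ℤ) : ℤ) : ℝ) := by
    intro F
    have := Polynomial.eval_intCast_map (Int.castRingHom ℝ) F (p : ℤ)
    simpa using this
  rw [ev, ev, ← hn] at h5
  rw [ev] at h6
  rw [Int.cast_mul, mul_div_cancel_left₀ _ h6] at h5
  have hn0 : n = 0 := by
    rw [← Int.abs_lt_one_iff]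
    exact_mod_cast h5
  show R.eval (p : ℤ) = 0
  rw [← hn, hn0, mul_zero]

lemma poly_dvd (D P : Polynomial ℤ) (hD : D.Monic)
    (h : ∀ p : ℕ, p.Prime → ∃ n : ℤ, D.eval (p : ℤ) * n = P.eval (p : ℤ)) : ∃ F, P = D * F := by
  refine ⟨P /ₘ D, ?_⟩
  have h1 := Polynomial.modByMonic_add_div P D
  have h2 : P %ₘ D = 0 := by
    refine poly_small D _ hD (Polynomial.degree_modByMonic_lt _ hD) fun p hp => ?_
    obtain ⟨n, hn⟩ := h p hp
    refine ⟨n - (P /ₘ D).eval (p : ℤ), ?_⟩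
    have h3 := congrArg (Polynomial.eval (p : ℤ)) h1
    rw [Polynomial.eval_add, Polynomial.eval_mul] at h3
    linear_combination hn - h3
  rw [h2, zero_add] at h1
  exact h1.symm

variable {Q : QuiverData}

abbrev Rt (Q : QuiverData) (s : Multiset (Q.V → ℕ)) : Prop := ∀ α ∈ s, IsPosRoot Q α

lemma int_pol (S : SeqD Q) (s1 s2 s3 : Multiset (Q.V → ℕ))
    (f : ∀ (k : Type) [Field k], Repn k Q → Repn k Q → Repn k Q → ℕ) (D P : Polynomial ℤ) (hD : D.Monic)
    (h : ∀ (k : Type) [Field k] [Finite k] (M N X : Repn k Q), Cls M s1 → Cls N s2 → Cls X s3 →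
      D.eval (Nat.card k : ℤ) * (f k M N X : ℤ) = P.eval (Nat.card k : ℤ) ∧ D.eval (Nat.card k : ℤ) ≠ 0) :
    ∃ F : Polynomial ℤ, ∀ (k : Type) [Field k] [Finite k] (M N X : Repn k Q), Cls M s1 → Cls N s2 → Cls X s3 →
      (f k M N X : ℤ) = F.eval (Nat.card k : ℤ) := by
  by_cases hr : Rt Q s1 ∧ Rt Q s2 ∧ Rt Q s3
  · obtain ⟨r1, r2, r3⟩ := hr
    obtain ⟨F, hF⟩ := poly_dvd D P hD fun p hp => by
      haveI : Fact p.Prime := ⟨hp⟩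
      obtain ⟨M, hM⟩ := Cls.of_roots S (ZMod p) r1
      obtain ⟨N, hN⟩ := Cls.of_roots S (ZMod p) r2
      obtain ⟨X, hX⟩ := Cls.of_roots S (ZMod p) r3
      have := (h (ZMod p) M N X hM hN hX).1
      rw [Nat.card_zmod] at this
      exact ⟨_, this⟩
    refine ⟨F, fun k _ _ M N X hM hN hX => ?_⟩
    obtain ⟨h1, h2⟩ := h k M N X hM hN hX
    rw [hF, Polynomial.eval_mul] at h1
    exact mul_left_cancel₀ h2 h1
  · refine ⟨0, fun k _ _ M N X hM hN hX => ?_⟩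
    exact absurd ⟨fun α h => hM.root S h, fun α h => hN.root S h, fun α h => hX.root S h⟩ hr

def Pol (Q : QuiverData) (s1 s2 s3 : Multiset (Q.V → ℕ)) : Prop :=
  ∃ F : Polynomial ℤ, ∀ (k : Type) [Field k] [Finite k] (M N X : Repn k Q), Cls M s1 → Cls N s2 → Cls X s3 →
      (hallNum M N X : ℤ) = F.eval (Nat.card k : ℤ)

def EPol (Q : QuiverData) (s1 s2 s3 : Multiset (Q.V → ℕ)) : Prop :=
  ∃ F : Polynomial ℤ, ∀ (k : Type) [Field k] [Finite k] (M N X : Repn k Q), Cls M s1 → Cls N s2 → Cls X s3 →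
      (En M N X : ℤ) = F.eval (Nat.card k : ℤ)

@[reducible] def gE (Q : QuiverData) (d e : Q.V → ℕ) : ℕ := ∑ v, d v * e v
@[reducible] def cE (Q : QuiverData) (d e : Q.V → ℕ) : ℕ := ∑ a, d (Q.s a) * e (Q.t a)

lemma cls_card_Gr {k : Type} [Field k] [Finite k] {M N : Repn k Q} {s t : Multiset (Q.V → ℕ)} (c : Cls M s)
    (d : Cls N t) : Nat.card (Gr M N) = Nat.card k ^ gE Q s.sum t.sum := by
  rw [card_Gr c.finDim d.finDim, c.dimv, d.dimv]

lemma cls_card_Co {k : Type} [Field k] [Finite k] {M N : Repn k Q} {s t : Multiset (Q.V → ℕ)} (c : Cls M s)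
    (d : Cls N t) : Nat.card (Co M N) = Nat.card k ^ cE Q s.sum t.sum := by
  rw [card_Co c.finDim d.finDim, c.dimv, d.dimv]

lemma ext0_card_le {k : Type} [Field k] [Finite k] {M N : Repn k Q} (h : M.FinDim) (h' : N.FinDim)
    (h0 : ext0 M N) : cE Q M.dimv N.dimv ≤ gE Q M.dimv N.dimv := by
  haveI := finite_Gr h h'
  haveI := finite_Co h h'
  have := LinearMap.finrank_le_finrank_of_surjective (f := extMap M N) h0
  unfold cE gE
  rw [← finrank_Gr h h', ← finrank_Co h h']
  exact this

lemma exists_min (S : SeqD Q) {s : Multiset (Q.V → ℕ)} (hs : s ≠ 0) : ∃ α ∈ s, ∀ β ∈ s, tau S α ≤ tau S β := by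
  classical
  obtain ⟨α, hα, h2⟩ := s.toFinset.exists_min_image (tau S) (Multiset.toFinset_nonempty.2 hs)
  exact ⟨α, Multiset.mem_toFinset.1 hα, fun β hβ => h2 β (Multiset.mem_toFinset.2 hβ)⟩

lemma card_k_pos {k : Type} [Field k] [Finite k] : 0 < Nat.card k := Nat.card_pos

lemma aut_pol (S : SeqD Q) (s : Multiset (Q.V → ℕ)) : ∃ F : Polynomial ℤ, F.Monic ∧
    ∀ (k : Type) [Field k] [Finite k] (X : Repn k Q), Cls X s → (autCard X : ℤ) = F.eval (Nat.card k : ℤ) := by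
  classical
  induction hn : s.card generalizing s with
  | zero =>
    have := Multiset.card_eq_zero.1 hn
    subst this
    refine ⟨1, Polynomial.monic_one, fun k _ _ X c => ?_⟩
    have : autCard X = 1 := by
      unfold autCard
      rw [Nat.card_eq_one_iff_unique]
      refine ⟨⟨fun e f => iso_ext fun v x => ?_⟩, ⟨irefl X⟩⟩
      rw [c.isZero v (e.e v x), c.isZero v (f.e v x)]
    rw [this]; simp
  | succ n ih =>
    obtain ⟨α, hα, hmin⟩ := exists_min S (s := s) (by rintro rfl; simp at hn)
    obtain ⟨F, hF, hF'⟩ := ih (s.erase α) (by rw [Multiset.card_erase_of_mem hα, hn]; rfl)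
    refine ⟨(Polynomial.X ^ ((s.erase α).count α + 1) - 1) * (F * Polynomial.X ^ (gE Q α (s.erase α).sum -
      cE Q α (s.erase α).sum)), ?_, ?_⟩
    · refine Polynomial.Monic.mul ?_ (hF.mul (Polynomial.monic_X_pow _))
      exact Polynomial.monic_X_pow_sub_C (1 : ℤ) (Nat.succ_ne_zero _)
    · intro k _ _ X c
      obtain ⟨A, B, hA, fA, hd, hi, hB⟩ := c.extract hα
      have hB' : Cls B (s.erase α) := by convert hB
      subst hd
      have hm : ∀ β ∈ s.erase A.dimv, tau S A.dimv ≤ tau S β := fun β hβ => hmin β (Multiset.mem_of_mem_erase hβ)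
      have h1 := aut_rec S hA fA hB' hm
      have h0 : ext0 A B := hB'.ext0_tau S hA fA hm
      have hle := ext0_card_le fA hB'.finDim h0
      rw [card_Gr fA hB'.finDim, card_Co fA hB'.finDim, ← autCard_congr (hi.trans (dsum_comm A B))] at h1
      have hq : 0 < Nat.card k := card_k_pos
      have h2 : Nat.card k ^ (gE Q A.dimv B.dimv) = Nat.card k ^ cE Q A.dimv B.dimv *
          Nat.card k ^ (gE Q A.dimv B.dimv - cE Q A.dimv B.dimv) := by
        rw [← pow_add, Nat.add_sub_cancel' hle]
      have h3 : Nat.card k ^ cE Q A.dimv B.dimv * autCard X = Nat.card k ^ cE Q A.dimv B.dimv *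
        ((Nat.card k ^ (Multiset.count A.dimv (s.erase A.dimv) + 1) - 1) * (autCard B *
          Nat.card k ^ (gE Q A.dimv B.dimv - cE Q A.dimv B.dimv))) := by
        have h1' : Nat.card k ^ cE Q A.dimv B.dimv * autCard X =
          (Nat.card k ^ (Multiset.count A.dimv (s.erase A.dimv) + 1) - 1) * autCard B *
            Nat.card k ^ (gE Q A.dimv B.dimv) := by convert h1
        rw [h1', h2]; ring
      have h4 := Nat.eq_of_mul_eq_mul_left (by positivity) h3
      rw [h4, ← hB'.dimv]
      rw [Nat.cast_mul, Nat.cast_sub (Nat.one_le_pow _ _ hq), Nat.cast_mul, hF' k B hB']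
      simp
end
end HP

set_option linter.all false

namespace HP
open Repn

section
variable {Q : QuiverData}

lemma epol_of_pol (S : SeqD Q) {s1 s2 s3 : Multiset (Q.V → ℕ)} (h : Pol Q s1 s2 s3) : EPol Q s1 s2 s3 := by
  obtain ⟨F, hF⟩ := h
  obtain ⟨a1, m1, h1⟩ := aut_pol S s1
  obtain ⟨a2, m2, h2⟩ := aut_pol S s2
  obtain ⟨a3, m3, h3⟩ := aut_pol S s3
  refine int_pol S s1 s2 s3 (fun k _ M N X => En M N X) a3 (F * (a1 * a2) * Polynomial.X ^ gE Q s1.sum s2.sum) m3 ?_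
  intro k _ _ M N X hM hN hX
  have hr := riedtmann M N X
  rw [cls_card_Gr hM hN] at hr
  have hr' : (En M N X : ℤ) * autCard X = hallNum M N X * (autCard M * autCard N) * (Nat.card k : ℤ) ^ gE Q s1.sum s2.sum := by
    exact_mod_cast hr
  rw [h1 k M hM, h2 k N hN, h3 k X hX, hF k M N X hM hN hX] at hr'
  refine ⟨?_, ?_⟩
  · rw [mul_comm, hr']; simp
  · rw [← h3 k X hX]
    exact_mod_cast (autCard_pos hX.finDim).ne'

lemma pol_of_epol (S : SeqD Q) {s1 s2 s3 : Multiset (Q.V → ℕ)} (h : EPol Q s1 s2 s3) : Pol Q s1 s2 s3 := by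
  obtain ⟨F, hF⟩ := h
  obtain ⟨a1, m1, h1⟩ := aut_pol S s1
  obtain ⟨a2, m2, h2⟩ := aut_pol S s2
  obtain ⟨a3, m3, h3⟩ := aut_pol S s3
  refine int_pol S s1 s2 s3 (fun k _ M N X => hallNum M N X) ((a1 * a2) * Polynomial.X ^ gE Q s1.sum s2.sum)
    (F * a3) ((m1.mul m2).mul (Polynomial.monic_X_pow _)) ?_
  intro k _ _ M N X hM hN hX
  have hr := riedtmann M N X
  rw [cls_card_Gr hM hN] at hr
  have hr' : (En M N X : ℤ) * autCard X = hallNum M N X * (autCard M * autCard N) * (Nat.card k : ℤ) ^ gE Q s1.sum s2.sum := by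
    exact_mod_cast hr
  have hq : (Nat.card k : ℤ) ≠ 0 := by exact_mod_cast (card_k_pos (k := k)).ne'
  have e1 : (autCard M : ℤ) ≠ 0 := by exact_mod_cast (autCard_pos hM.finDim).ne'
  have e2 : (autCard N : ℤ) ≠ 0 := by exact_mod_cast (autCard_pos hN.finDim).ne'
  have hD : ((a1 * a2) * Polynomial.X ^ gE Q s1.sum s2.sum).eval (Nat.card k : ℤ) =
      (autCard M : ℤ) * autCard N * (Nat.card k : ℤ) ^ gE Q s1.sum s2.sum := by
    rw [h1 k M hM, h2 k N hN]; simp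
  rw [hD, Polynomial.eval_mul, ← hF k M N X hM hN hX, ← h3 k X hX, hr']
  exact ⟨by ring, mul_ne_zero (mul_ne_zero e1 e2) (pow_ne_zero _ hq)⟩

lemma En_ext0 {k : Type} [Field k] [Finite k] (S : SeqD Q) {M N X : Repn k Q} {s1 s2 s3 : Multiset (Q.V → ℕ)}
    (hM : Cls M s1) (hN : Cls N s2) (hX : Cls X s3) (h0 : ext0 M N) :
    (s1 + s2 = s3 → En M N X = Nat.card k ^ cE Q s1.sum s2.sum) ∧ (s1 + s2 ≠ s3 → En M N X = 0) := by
  have hd : Cls (N.dsum M) (s1 + s2) := (hM.dsum hN).iso (dsum_comm M N)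
  constructor
  · rintro rfl
    rw [← cls_card_Co hM hN]
    exact Nat.card_congr (Equiv.subtypeUnivEquiv fun c => (exr_split h0 c).trans (hd.isoP S hX))
  · intro hne
    unfold En
    haveI : IsEmpty {c : Co M N // IsoP (exr M N c) X} := ⟨fun c => hne (by
      exact (hd.iso ((exr_split h0 c.1).symm.trans c.2)).unique S hX)⟩
    exact Nat.card_of_isEmpty

lemma epol_ext (S : SeqD Q) {s1 s2 : Multiset (Q.V → ℕ)} (s3 : Multiset (Q.V → ℕ)) (h : s1 = 0 ∨ s2 = 0) :
    EPol Q s1 s2 s3 := by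
  have h0 : ∀ (k : Type) [Field k] [Finite k] (M N : Repn k Q), Cls M s1 → Cls N s2 → ext0 M N := by
    rintro k _ _ M N hM hN
    rcases h with rfl | rfl
    · exact ext0_of_isZero_left hM.isZero
    · exact ext0_of_isZero_right hN.isZero
  by_cases hs : s1 + s2 = s3
  · refine ⟨Polynomial.X ^ cE Q s1.sum s2.sum, fun k _ _ M N X hM hN hX => ?_⟩
    rw [(En_ext0 S hM hN hX (h0 k M N hM hN)).1 hs]; simp
  · refine ⟨0, fun k _ _ M N X hM hN hX => ?_⟩
    rw [(En_ext0 S hM hN hX (h0 k M N hM hN)).2 hs]; simp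

lemma epol_mismatch (S : SeqD Q) {s1 s2 s3 : Multiset (Q.V → ℕ)} (h : s1.sum + s2.sum ≠ s3.sum) :
    EPol Q s1 s2 s3 := by
  refine ⟨0, fun k _ _ M N X hM hN hX => ?_⟩
  have : En M N X = 0 := by
    unfold En
    haveI : IsEmpty {c : Co M N // IsoP (exr M N c) X} := ⟨fun c => h (by
      have h1 := c.2.dimv
      rw [dimv_exr hM.finDim hN.finDim, hX.dimv, hM.dimv, hN.dimv] at h1
      rw [← h1, add_comm])⟩
    exact Nat.card_of_isEmpty
  rw [this]; simp

noncomputable def hallC {k : Type} [Field k] (X : Repn k Q) (s1 s2 : Multiset (Q.V → ℕ)) : ℕ :=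
  Nat.card {U : Subrep X // Cls U.repn s2 ∧ Cls U.quot s1}

noncomputable def EnC {k : Type} [Field k] (M N : Repn k Q) (s : Multiset (Q.V → ℕ)) : ℕ :=
  Nat.card {c : Co M N // Cls (exr M N c) s}

lemma hallC_eq {k : Type} [Field k] (S : SeqD Q) {M N X : Repn k Q} {s1 s2 : Multiset (Q.V → ℕ)}
    (hM : Cls M s1) (hN : Cls N s2) : hallC X s1 s2 = hallNum M N X := by
  refine Nat.card_congr (Equiv.subtypeEquivRight fun U => ?_)
  constructor
  · rintro ⟨h1, h2⟩
    exact ⟨h1.isoP S hN, h2.isoP S hM⟩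
  · rintro ⟨h1, h2⟩
    exact ⟨hN.iso (IsoP.symm h1), hM.iso (IsoP.symm h2)⟩

lemma EnC_eq {k : Type} [Field k] (S : SeqD Q) {M N X : Repn k Q} {s : Multiset (Q.V → ℕ)}
    (hX : Cls X s) : EnC M N s = En M N X := by
  refine Nat.card_congr (Equiv.subtypeEquivRight fun U => ?_)
  exact ⟨fun h => h.isoP S hX, fun h => hX.iso h.symm⟩

lemma hallC_pol (S : SeqD Q) {s1 s2 s3 : Multiset (Q.V → ℕ)} (h : Pol Q s1 s2 s3) :
    ∃ F : Polynomial ℤ, ∀ (k : Type) [Field k] [Finite k] (X : Repn k Q), Cls X s3 →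
      (hallC X s1 s2 : ℤ) = F.eval (Nat.card k : ℤ) := by
  by_cases hr : Rt Q s1 ∧ Rt Q s2
  · obtain ⟨F, hF⟩ := h
    refine ⟨F, fun k _ _ X hX => ?_⟩
    obtain ⟨M, hM⟩ := Cls.of_roots S k hr.1
    obtain ⟨N, hN⟩ := Cls.of_roots S k hr.2
    rw [hallC_eq S hM hN]
    exact hF k M N X hM hN hX
  · refine ⟨0, fun k _ _ X hX => ?_⟩
    have : hallC X s1 s2 = 0 := by
      unfold hallC
      haveI : IsEmpty {U : Subrep X // Cls U.repn s2 ∧ Cls U.quot s1} :=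
        ⟨fun U => hr ⟨fun α h => U.2.2.root S h, fun α h => U.2.1.root S h⟩⟩
      exact Nat.card_of_isEmpty
    rw [this]; simp

lemma EnC_pol (S : SeqD Q) {s1 s2 s3 : Multiset (Q.V → ℕ)} (h : EPol Q s1 s2 s3) :
    ∃ F : Polynomial ℤ, ∀ (k : Type) [Field k] [Finite k] (M N : Repn k Q), Cls M s1 → Cls N s2 →
      (EnC M N s3 : ℤ) = F.eval (Nat.card k : ℤ) := by
  by_cases hr : Rt Q s3
  · obtain ⟨F, hF⟩ := h
    refine ⟨F, fun k _ _ M N hM hN => ?_⟩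
    obtain ⟨X, hX⟩ := Cls.of_roots S k hr
    rw [EnC_eq S hX]
    exact hF k M N X hM hN hX
  · refine ⟨0, fun k _ _ M N hM hN => ?_⟩
    have : EnC M N s3 = 0 := by
      unfold EnC
      haveI : IsEmpty {c : Co M N // Cls (exr M N c) s3} :=
        ⟨fun U => hr fun α h => U.2.root S h⟩
      exact Nat.card_of_isEmpty
    rw [this]; simp

@[reducible] def sz (s : Multiset (Q.V → ℕ)) : ℕ := ∑ v, s.sum v

lemma sz_add (s t : Multiset (Q.V → ℕ)) : sz (s + t) = sz s + sz t := by
  simp [sz, Finset.sum_add_distrib]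

lemma root_pos {α : Q.V → ℕ} (h : IsPosRoot Q α) : 0 < ∑ v, α v := by
  rw [Nat.pos_iff_ne_zero]
  intro h0
  apply h.1
  funext v
  exact (Finset.sum_eq_zero_iff.1 h0) v (Finset.mem_univ v)

lemma card_le_sz {s : Multiset (Q.V → ℕ)} (h : Rt Q s) : s.card ≤ sz s := by
  induction s using Multiset.induction_on with
  | empty => simp
  | cons a s ih =>
    have h1 := ih fun α hα => h α (Multiset.mem_cons_of_mem hα)
    have h2 := root_pos (h a (Multiset.mem_cons_self a s))
    have h3 : sz (a ::ₘ s) = (∑ v, a v) + sz s := by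
      simp [sz, Finset.sum_add_distrib]
    rw [Multiset.card_cons, h3]; omega

lemma sz_pos {s : Multiset (Q.V → ℕ)} (h : Rt Q s) (h0 : s ≠ 0) : 0 < sz s :=
  lt_of_lt_of_le (Multiset.card_pos.2 h0) (card_le_sz h)

open Classical in
noncomputable def Tset (d : Q.V → ℕ) : Finset (Multiset (Q.V → ℕ)) :=
  ((∑ v, d v) • (Finset.Iic d).val).powerset.toFinset

lemma mem_Tset {s : Multiset (Q.V → ℕ)} {d : Q.V → ℕ} (h : Rt Q s) (hd : s.sum ≤ d) : s ∈ Tset d := by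
  classical
  unfold Tset
  rw [Multiset.mem_toFinset, Multiset.mem_powerset, Multiset.le_iff_count]
  intro a
  by_cases ha : a ∈ s
  · rw [Multiset.count_nsmul]
    have h1 : a ≤ d := le_trans (Multiset.single_le_sum (fun _ _ => zero_le) a ha) hd
    have h2 : Multiset.count a (Finset.Iic d).val = 1 :=
      Multiset.count_eq_one_of_mem (Finset.nodup _) (Finset.mem_Iic.2 h1)
    rw [h2, mul_one]
    refine (Multiset.count_le_card _ _).trans ((card_le_sz h).trans ?_)
    exact Finset.sum_le_sum fun v _ => hd v
  · rw [Multiset.count_eq_zero_of_notMem ha]; exact Nat.zero_le _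

end
end HP

set_option linter.all false

namespace HP
open Repn

section
variable {Q : QuiverData}

lemma sum_regroup {k : Type} [Field k] [Finite k] (S : SeqD Q) {A B : Repn k Q} (fA : A.FinDim) (fB : B.FinDim)
    {d : Q.V → ℕ} (hA : A.dimv ≤ d) (hB : B.dimv ≤ d) [Fintype (Subrep A × Subrep B)]
    (f : Subrep A × Subrep B → ℤ)
    (g : (Multiset (Q.V → ℕ) × Multiset (Q.V → ℕ)) × (Multiset (Q.V → ℕ) × Multiset (Q.V → ℕ)) → ℤ)
    (h : ∀ U a1 a2 b1 b2, Cls U.1.quot a1 → Cls U.1.repn a2 → Cls U.2.quot b1 → Cls U.2.repn b2 →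
      f U = g ((a1, a2), (b1, b2))) :
    ∑ U, f U = ∑ y ∈ (Tset d ×ˢ Tset d) ×ˢ (Tset d ×ˢ Tset d),
      (hallC A y.1.1 y.1.2 : ℤ) * hallC B y.2.1 y.2.2 * g y := by
  classical
  have e1 : ∀ U : Subrep A, ∃ a, Cls U.quot a := fun U => Cls.exists (finDim_quot fA U)
  have e2 : ∀ U : Subrep A, ∃ a, Cls U.repn a := fun U => Cls.exists (finDim_repn fA U)
  have e3 : ∀ U : Subrep B, ∃ a, Cls U.quot a := fun U => Cls.exists (finDim_quot fB U)
  have e4 : ∀ U : Subrep B, ∃ a, Cls U.repn a := fun U => Cls.exists (finDim_repn fB U)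
  choose c1 h1 using e1
  choose c2 h2 using e2
  choose c3 h3 using e3
  choose c4 h4 using e4
  let cl : Subrep A × Subrep B → (Multiset (Q.V → ℕ) × Multiset (Q.V → ℕ)) × (Multiset (Q.V → ℕ) × Multiset (Q.V → ℕ)) :=
    fun U => ((c1 U.1, c2 U.1), (c3 U.2, c4 U.2))
  have hT : ∀ {X : Repn k Q} (fX : X.FinDim) (hX : X.dimv ≤ d) (U : Subrep X) {a b}, Cls U.quot a → Cls U.repn b →
      a ∈ Tset d ∧ b ∈ Tset d := by
    intro X fX hX U a b ha hb
    have hs := dimv_sub_quot fX U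
    rw [ha.dimv, hb.dimv] at hs
    refine ⟨mem_Tset (fun α h => ha.root S h) (le_trans ?_ hX), mem_Tset (fun α h => hb.root S h) (le_trans ?_ hX)⟩
    · rw [← hs]; intro v; exact Nat.le_add_right _ _
    · rw [← hs]; intro v; exact Nat.le_add_left _ _
  rw [← Finset.sum_fiberwise_of_maps_to (s := Finset.univ) (g := cl)
    (t := (Tset d ×ˢ Tset d) ×ˢ (Tset d ×ˢ Tset d)) (fun U _ => by
      obtain ⟨i1, i2⟩ := hT fA hA U.1 (h1 U.1) (h2 U.1)
      obtain ⟨i3, i4⟩ := hT fB hB U.2 (h3 U.2) (h4 U.2)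
      simp only [Finset.mem_product]
      exact ⟨⟨i1, i2⟩, i3, i4⟩)]
  refine Finset.sum_congr rfl fun y _ => ?_
  obtain ⟨⟨a1, a2⟩, ⟨b1, b2⟩⟩ := y
  have hc : ∀ U, cl U = ((a1, a2), (b1, b2)) ↔ (Cls U.1.repn a2 ∧ Cls U.1.quot a1) ∧ (Cls U.2.repn b2 ∧ Cls U.2.quot b1) := by
    intro U
    constructor
    · intro hU
      simp only [cl, Prod.mk.injEq] at hU
      obtain ⟨⟨rfl, rfl⟩, rfl, rfl⟩ := hU
      exact ⟨⟨h2 _, h1 _⟩, h4 _, h3 _⟩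
    · rintro ⟨⟨i2, i1⟩, i4, i3⟩
      simp only [cl, Prod.mk.injEq]
      exact ⟨⟨(h1 _).unique S i1, (h2 _).unique S i2⟩, (h3 _).unique S i3, (h4 _).unique S i4⟩
  have hcard : (Finset.univ.filter fun U => cl U = ((a1, a2), (b1, b2))).card = hallC A a1 a2 * hallC B b1 b2 := by
    rw [← Fintype.card_subtype, ← Nat.card_eq_fintype_card]
    unfold hallC
    rw [← Nat.card_prod]
    refine Nat.card_congr ((Equiv.subtypeEquivRight hc).trans ?_)
    exact Equiv.subtypeProdEquivProd (p := fun U : Subrep A => Cls U.repn a2 ∧ Cls U.quot a1)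
      (q := fun U : Subrep B => Cls U.repn b2 ∧ Cls U.quot b1)
  rw [Finset.sum_congr rfl (g := fun _ => g ((a1, a2), (b1, b2)))]
  · rw [Finset.sum_const, hcard, nsmul_eq_mul, Nat.cast_mul]
  · intro U hU
    rw [Finset.mem_filter] at hU
    obtain ⟨⟨i2, i1⟩, i4, i3⟩ := (hc U).1 hU.2
    exact h U a1 a2 b1 b2 i1 i2 i3 i4

lemma green_step (S : SeqD Q) {s1 s2 s3 : Multiset (Q.V → ℕ)} (r1 : Rt Q s1) (r2 : Rt Q s2) (r3 : Rt Q s3)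
    (n1 : s1 ≠ 0) (n2 : s2 ≠ 0) (hs : s1.sum + s2.sum = s3.sum) (hc : 2 ≤ s3.card)
    (ih : ∀ u1 u2 u3 : Multiset (Q.V → ℕ), sz u3 < sz s3 → Pol Q u1 u2 u3) : Pol Q s1 s2 s3 := by
  classical
  obtain ⟨α, hα, hmin⟩ := exists_min S (s := s3) (by rintro rfl; simp at hc)
  obtain ⟨t, ht⟩ : ∃ t, t = s3.erase α := ⟨_, rfl⟩
  have hs3 : {α} + t = s3 := by rw [ht, Multiset.singleton_add, Multiset.cons_erase hα]
  have rt : Rt Q t := fun β hβ => r3 β (by rw [ht] at hβ; exact Multiset.mem_of_mem_erase hβ)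
  have ra : Rt Q {α} := fun β hβ => r3 β (by rw [Multiset.mem_singleton.1 hβ]; exact hα)
  have nt : t ≠ 0 := by
    rintro rfl
    rw [← hs3] at hc; simp at hc
  have z1 := sz_pos r1 n1
  have z2 := sz_pos r2 n2
  have zt := sz_pos rt nt
  have za := sz_pos ra (Multiset.singleton_ne_zero α)
  have zs : sz s1 + sz s2 = sz s3 := by
    rw [← sz_add]; unfold sz; rw [Multiset.sum_add, hs]
  have zs' : sz {α} + sz t = sz s3 := by rw [← sz_add, hs3]
  have pA := fun a1 a2 => hallC_pol S (ih a1 a2 {α} (by omega))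
  have pB := fun b1 b2 => hallC_pol S (ih b1 b2 t (by omega))
  have p2 := fun a b => epol_of_pol S (ih a b s2 (by omega))
  have p1 := fun a b => epol_of_pol S (ih a b s1 (by omega))
  choose FA hFA using pA
  choose FB hFB using pB
  choose F2 hF2 using p2
  choose F1 hF1 using p1
  let d := s3.sum
  refine int_pol S s1 s2 s3 (fun k _ M N X => hallNum M N X) (Polynomial.X ^ cE Q α t.sum)
    (∑ y ∈ (Tset d ×ˢ Tset d) ×ˢ (Tset d ×ˢ Tset d), FA y.1.1 y.1.2 * FB y.2.1 y.2.2 *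
      (Polynomial.X ^ gE Q y.1.2.sum y.2.1.sum * (Polynomial.X ^ cE Q y.1.1.sum y.2.2.sum *
        (F2 y.1.2 y.2.2 * F1 y.1.1 y.2.1)))) (Polynomial.monic_X_pow _) ?_
  intro k _ _ M N X hM hN hX
  have hq : (Nat.card k : ℤ) ≠ 0 := by exact_mod_cast (card_k_pos (k := k)).ne'
  refine ⟨?_, by rw [Polynomial.eval_pow, Polynomial.eval_X]; exact pow_ne_zero _ hq⟩
  obtain ⟨A, B, hA, fA, hd, hi, hB⟩ := hX.extract hα
  have hB' : Cls B t := by rw [ht]; convert hB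
  have hA' : Cls A {α} := by rw [← hd]; exact Cls.single hA fA
  have hm : ∀ β ∈ t, tau S A.dimv ≤ tau S β := fun β hβ => by
    rw [hd]; rw [ht] at hβ; exact hmin β (Multiset.mem_of_mem_erase hβ)
  have h0 : ext0 A B := hB'.ext0_tau S hA fA hm
  haveI := fin_Subrep fA
  haveI := fin_Subrep hB'.finDim
  letI : Fintype (Subrep A × Subrep B) := Fintype.ofFinite _
  have hg := green (M := M) (N := N) fA hB'.finDim hM.finDim hN.finDim h0
  rw [← hallNum_congr hM.finDim hN.finDim (hi.trans (dsum_comm A B)), cls_card_Co hA' hB',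
    Multiset.sum_singleton] at hg
  have hg' := congrArg (Nat.cast : ℕ → ℤ) hg
  rw [Nat.cast_sum, sum_regroup S fA hB'.finDim (d := d) (by
      rw [hA'.dimv]; show _ ≤ s3.sum; rw [← hs3, Multiset.sum_add]; intro v; exact Nat.le_add_right _ _) (by
      rw [hB'.dimv]; show _ ≤ s3.sum; rw [← hs3, Multiset.sum_add]; intro v; exact Nat.le_add_left _ _) _
    (fun y => (Polynomial.X ^ gE Q y.1.2.sum y.2.1.sum * (Polynomial.X ^ cE Q y.1.1.sum y.2.2.sum *
        (F2 y.1.2 y.2.2 * F1 y.1.1 y.2.1)) : Polynomial ℤ).eval (Nat.card k : ℤ))] at hg'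
  · rw [Polynomial.eval_finset_sum]
    have e : (Polynomial.X ^ cE Q α t.sum : Polynomial ℤ).eval (Nat.card k : ℤ) * (hallNum M N X : ℤ) =
        ((Nat.card k ^ cE Q α t.sum * hallNum M N X : ℕ) : ℤ) := by simp
    refine e.trans (hg'.trans ?_)
    refine Finset.sum_congr rfl fun y _ => ?_
    rw [hFA y.1.1 y.1.2 k A hA', hFB y.2.1 y.2.2 k B hB', Polynomial.eval_mul (p := FA y.1.1 y.1.2 * FB y.2.1 y.2.2),
      Polynomial.eval_mul (p := FA y.1.1 y.1.2)]
  · intro U a1 a2 b1 b2 i1 i2 i3 i4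
    rw [cls_card_Gr i2 i3, cls_card_Co i1 i4]
    push_cast
    rw [hF2 a2 b2 k U.1.repn U.2.repn N i2 i4 hN, hF1 a1 b1 k U.1.quot U.2.quot M i1 i3 hM]
    simp

lemma single_step (S : SeqD Q) {s1 s2 s3 : Multiset (Q.V → ℕ)} (r1 : Rt Q s1) (r2 : Rt Q s2) (r3 : Rt Q s3)
    (hs : s1.sum + s2.sum = s3.sum) (hc : s3.card = 1)
    (ih : ∀ s, Rt Q s → s.sum = s3.sum → 2 ≤ s.card → EPol Q s1 s2 s) : EPol Q s1 s2 s3 := by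
  classical
  have hE : ∀ s ∈ (Tset s3.sum).erase s3, ∃ F : Polynomial ℤ, ∀ (k : Type) [Field k] [Finite k] (M N : Repn k Q),
      Cls M s1 → Cls N s2 → (EnC M N s : ℤ) = F.eval (Nat.card k : ℤ) := by
    intro s hsm
    have hne := (Finset.mem_erase.1 hsm).1
    refine EnC_pol S ?_
    by_cases hr : Rt Q s
    swap
    · exact ⟨0, fun k _ _ M N X hM hN hX => absurd (fun α h => hX.root S h) hr⟩
    by_cases hss : s.sum = s3.sum
    swap
    · exact epol_mismatch S (by rw [hs]; exact fun h => hss h.symm)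
    refine ih s hr hss ?_
    obtain ⟨α, rfl⟩ := Multiset.card_eq_one.1 hc
    by_contra h2
    have h3 : s.card = 0 ∨ s.card = 1 := by omega
    rcases h3 with h3 | h3
    · rw [Multiset.card_eq_zero.1 h3] at hss
      refine (r3 α (Multiset.mem_singleton_self α)).1 ?_
      simpa using hss.symm
    · obtain ⟨β, rfl⟩ := Multiset.card_eq_one.1 h3
      apply hne
      simpa using hss
  choose! F hF using hE
  refine ⟨Polynomial.X ^ cE Q s1.sum s2.sum - ∑ s ∈ (Tset s3.sum).erase s3, F s, fun k _ _ M N X hM hN hX => ?_⟩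
  rw [← EnC_eq S hX]
  haveI := fin_Co hM.finDim hN.finDim
  letI := Fintype.ofFinite (Co M N)
  have e1 : ∀ c : Co M N, ∃ s, Cls (exr M N c) s := fun c => Cls.exists (finDim_exr hM.finDim hN.finDim c)
  choose cl hcl using e1
  have hfib : ∀ s, EnC M N s = (Finset.univ.filter fun c => cl c = s).card := by
    intro s
    unfold EnC
    rw [← Fintype.card_subtype, ← Nat.card_eq_fintype_card]
    refine Nat.card_congr (Equiv.subtypeEquivRight fun c => ?_)
    constructor
    · intro h; exact (hcl c).unique S h
    · rintro rfl; exact hcl c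
  have htot : Nat.card (Co M N) = ∑ s ∈ Tset s3.sum, EnC M N s := by
    rw [Nat.card_eq_fintype_card, ← Finset.card_univ, Finset.card_eq_sum_card_fiberwise (f := cl) (t := Tset s3.sum)]
    · exact Finset.sum_congr rfl fun s _ => (hfib s).symm
    · intro c _
      refine mem_Tset (fun α h => (hcl c).root S h) (le_of_eq ?_)
      rw [← (hcl c).dimv, dimv_exr hM.finDim hN.finDim, hM.dimv, hN.dimv, ← hs, add_comm]
  rw [← Finset.add_sum_erase _ _ (mem_Tset r3 le_rfl), cls_card_Co hM hN] at htot
  have htot' := congrArg (Nat.cast : ℕ → ℤ) htot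
  push_cast at htot'
  rw [Polynomial.eval_sub, Polynomial.eval_finset_sum, Polynomial.eval_pow, Polynomial.eval_X, htot',
    Finset.sum_congr rfl fun s hsm => hF s hsm k M N hM hN]
  ring

lemma pol_all (S : SeqD Q) (n : ℕ) : ∀ s1 s2 s3 : Multiset (Q.V → ℕ), sz s3 = n → Pol Q s1 s2 s3 := by
  induction n using Nat.strong_induction_on with
  | _ n ih =>
    have key : ∀ s1 s2 s3 : Multiset (Q.V → ℕ), sz s3 = n → 
        ((Rt Q s1 ∧ Rt Q s2 ∧ Rt Q s3 ∧ s1 ≠ 0 ∧ s2 ≠ 0 ∧ s1.sum + s2.sum = s3.sum ∧ s3.card = 1) → Pol Q s1 s2 s3) → 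
        Pol Q s1 s2 s3 := by
      intro s1 s2 s3 hn hone
      by_cases hr : Rt Q s1 ∧ Rt Q s2 ∧ Rt Q s3
      swap
      · refine ⟨0, fun k _ _ M N X hM hN hX => ?_⟩
        exact absurd ⟨fun α h => hM.root S h, fun α h => hN.root S h, fun α h => hX.root S h⟩ hr
      obtain ⟨r1, r2, r3⟩ := hr
      by_cases h0 : s1 = 0 ∨ s2 = 0
      · exact pol_of_epol S (epol_ext S s3 h0)
      rw [not_or] at h0
      by_cases hs : s1.sum + s2.sum = s3.sum
      swap
      · exact pol_of_epol S (epol_mismatch S hs)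
      by_cases hc : s3.card = 1
      · exact hone ⟨r1, r2, r3, h0.1, h0.2, hs, hc⟩
      by_cases hc0 : s3.card = 0
      · exfalso
        rw [Multiset.card_eq_zero] at hc0
        subst hc0
        have h1 := sz_pos r1 h0.1
        have h2 : sz (s1 + s2) = sz (0 : Multiset (Q.V → ℕ)) := by
          unfold sz; rw [Multiset.sum_add, hs]
        rw [sz_add] at h2
        have h3 : sz (0 : Multiset (Q.V → ℕ)) = 0 := by simp [sz]
        omega
      · exact green_step S r1 r2 r3 h0.1 h0.2 hs (by omega) fun u1 u2 u3 hu => ih _ (hn ▸ hu) u1 u2 u3 rfl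
    intro s1 s2 s3 hn
    refine key s1 s2 s3 hn ?_
    rintro ⟨r1, r2, r3, n1, n2, hs, hc⟩
    refine pol_of_epol S (single_step S r1 r2 r3 hs hc ?_)
    intro s hr hss hcc
    refine epol_of_pol S (key s1 s2 s (by rw [← hn]; unfold sz; rw [hss]) ?_)
    rintro ⟨-, -, -, -, -, -, h1⟩
    omega

lemma hall_main (hQ : PD Q) (μ ν ξ : (Q.V → ℕ) → ℕ) :
    ∃ F : Polynomial ℤ,
      ∀ (k : Type) [Field k] [Fintype k] (M N X : Repn k Q),
        HasClassDynkin M μ → HasClassDynkin N ν → HasClassDynkin X ξ →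
        (hallNum M N X : ℤ) = F.eval ((Fintype.card k : ℤ)) := by
  classical
  rcases isEmpty_or_nonempty Q.V with hV | hV
  · refine ⟨1, fun k _ _ M N X _ _ _ => ?_⟩
    have : hallNum M N X = 1 := by
      unfold hallNum
      rw [Nat.card_eq_one_iff_unique]
      refine ⟨⟨fun U W => Subtype.ext (Subrep.ext' fun v => hV.elim v)⟩, ⟨⟨⟨fun v => ⊤, fun a => le_top⟩, ?_, ?_⟩⟩⟩
      · exact ⟨⟨fun v => hV.elim v, fun a => (hV.false (Q.s a)).elim⟩⟩
      · exact ⟨⟨fun v => hV.elim v, fun a => (hV.false (Q.s a)).elim⟩⟩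
    rw [this]; simp
  · obtain ⟨S⟩ := exists_seqD hQ
    by_cases h : ∃ s1 s2 s3 : Multiset (Q.V → ℕ), (∀ d, s1.count d = μ d) ∧ (∀ d, s2.count d = ν d) ∧ ∀ d, s3.count d = ξ d
    · obtain ⟨s1, s2, s3, h1, h2, h3⟩ := h
      obtain ⟨F, hF⟩ := pol_all S _ s1 s2 s3 rfl
      refine ⟨F, fun k _ _ M N X hM hN hX => ?_⟩
      obtain ⟨t1, c1, e1⟩ := cls_of_hasClass hM
      obtain ⟨t2, c2, e2⟩ := cls_of_hasClass hN
      obtain ⟨t3, c3, e3⟩ := cls_of_hasClass hX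
      have i1 : t1 = s1 := Multiset.ext.2 fun d => by rw [h1, ← e1 d]
      have i2 : t2 = s2 := Multiset.ext.2 fun d => by rw [h2, ← e2 d]
      have i3 : t3 = s3 := Multiset.ext.2 fun d => by rw [h3, ← e3 d]
      subst i1 i2 i3
      rw [hF k M N X c1 c2 c3, Nat.card_eq_fintype_card]
    · refine ⟨0, fun k _ _ M N X hM hN hX => ?_⟩
      obtain ⟨t1, c1, e1⟩ := cls_of_hasClass hM
      obtain ⟨t2, c2, e2⟩ := cls_of_hasClass hN
      obtain ⟨t3, c3, e3⟩ := cls_of_hasClass hX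
      refine absurd ⟨t1, t2, t3, fun d => ?_, fun d => ?_, fun d => ?_⟩ h
      · rw [← e1 d]
      · rw [← e2 d]
      · rw [← e3 d]

end
end HP

/-- **Hall polynomials exist for Dynkin quivers** (Ringel; Theorem 3 of the paper).
For all finitely supported functions `μ ν ξ : Φ₊ → ℕ` there is a polynomial
`F ∈ ℤ[T]`, depending only on `Q, μ, ν, ξ`, such that for every finite field `k`
with `q` elements and all `kQ`-modules `M, N, X` with `[M] = μ`, `[N] = ν`,
`[X] = ξ` one has `F_{MN}^X = F(q)`. -/
theorem hall_polynomials_exist_dynkin (Q : QuiverData) (hQ : IsDynkin Q)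
    (μ ν ξ : (Q.V → ℕ) → ℕ)
    (hμfin : (Function.support μ).Finite) (hμroot : ∀ d, μ d ≠ 0 → IsPosRoot Q d)
    (hνfin : (Function.support ν).Finite) (hνroot : ∀ d, ν d ≠ 0 → IsPosRoot Q d)
    (hξfin : (Function.support ξ).Finite) (hξroot : ∀ d, ξ d ≠ 0 → IsPosRoot Q d) :
    ∃ F : Polynomial ℤ,
      ∀ (k : Type) [Field k] [Fintype k] (M N X : Repn k Q),
        M.FinDim → N.FinDim → X.FinDim →
        HasClassDynkin M μ → HasClassDynkin N ν → HasClassDynkin X ξ →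
        (hallNum M N X : ℤ) = F.eval ((Fintype.card k : ℤ)) := by
  exact (HP.hall_main hQ.2 μ ν ξ).imp fun F h k _ _ M N X _ _ _ => h k M N X
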